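/- Let r, n ≥ 1. There exists a function c assigning a nonnegative integer c(μ) to every integer partition μ, with c(μ) = 0 unless μ has at most n parts and |μ| ≤ 2rn − r − n, such that for every ℓ ≥ 1 and every d ∈ ℕ^ℓ, the dimension over ℚ of the multidegree-d component of R/J equals Σ_μ c(μ)·K_{μ,d}, where K_{μ,d} is the number of semistandard Young tableaux of shape μ with entries in {1,…,ℓ} and content d (exactly d_i entries equal to i). Equivalently, the multigraded Hilbert series of the diagonal co-quasi-invariant space of G(r,n) in ℓ sets of n variables is a positive-integer linear combination Σ_μ c(μ)·s_μ(q_1,…,q_ℓ) of Schur polynomials whose coefficients c(μ) are independent of ℓ. -/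

import Mathlib

/-!
Statement 0: the multigraded Hilbert series of the diagonal co-quasi-invariant space of
`G(r,n)` in `ℓ` sets of `n` variables is a positive-integer combination of Schur polynomials
(equivalently, of SSYT counts) with coefficients independent of `ℓ`, supported on partitions
with at most `n` parts and size at most `2rn - r - n`.
-/

open scoped Classical

noncomputable section

/-- The polynomial ring `ℚ[x_{ij} : 1 ≤ i ≤ ℓ, 1 ≤ j ≤ n]`. -/
abbrev PolyR (ℓ n : ℕ) : Type := MvPolynomial (Fin ℓ × Fin n) ℚ

/-- The monomial quasi-invariant `M_A` attached to a matrix `A` given as a list of columns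
(each column a function `Fin ℓ → ℕ`): the sum over all strictly increasing choices of
columns of variables of the corresponding product of powers. -/
noncomputable def Mlist (n : ℕ) {ℓ : ℕ} (A : List (Fin ℓ → ℕ)) : PolyR ℓ n :=
  ∑ s ∈ Finset.univ.filter (fun s : Fin A.length → Fin n => StrictMono s),
    ∏ c : Fin A.length, ∏ i : Fin ℓ, MvPolynomial.X (i, s c) ^ (A.get c i)

/-- `A` (a list of columns) is an `r`-composition-matrix: it is nonempty and each column sum
is a positive multiple of `r`. -/
def IsRCompList (r : ℕ) {ℓ : ℕ} (A : List (Fin ℓ → ℕ)) : Prop :=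
  A ≠ [] ∧ ∀ V ∈ A, (∑ i, V i) ≠ 0 ∧ r ∣ (∑ i, V i)

/-- The ideal `J` generated by the monomial quasi-invariants `M_A`, for `A` an
`r`-composition-matrix with `ℓ` rows and at most `n` columns. -/
noncomputable def Jdeal (r n ℓ : ℕ) : Ideal (PolyR ℓ n) :=
  Ideal.span {f | ∃ A : List (Fin ℓ → ℕ), IsRCompList r A ∧ A.length ≤ n ∧ f = Mlist n A}

/-- The submodule of polynomials that are multihomogeneous of multidegree `d ∈ ℕ^ℓ`
(total degree `d i` in the `i`-th row of variables). -/
noncomputable def homogComp (ℓ n : ℕ) (d : Fin ℓ → ℕ) : Submodule ℚ (PolyR ℓ n) :=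
  MvPolynomial.weightedHomogeneousSubmodule ℚ (fun p : Fin ℓ × Fin n => Pi.single p.1 1) d

/-- The dimension over `ℚ` of the multidegree-`d` component of `R/J`, i.e. of the image of
the multihomogeneous component of degree `d` in the quotient by the ideal `J`. -/
noncomputable def compDim (r n ℓ : ℕ) (d : Fin ℓ → ℕ) : ℕ :=
  Module.finrank ℚ
    ↥((homogComp ℓ n d).map (Ideal.Quotient.mkₐ ℚ (Jdeal r n ℓ)).toLinearMap)

/-- The Kostka number `K_{μ,d}`: the number of semistandard Young tableaux of shape `μ`
with entries in `{0, …, ℓ-1}` having exactly `d v` entries equal to `v` for each `v`. -/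
noncomputable def ssytCount (μ : YoungDiagram) (ℓ : ℕ) (d : Fin ℓ → ℕ) : ℕ :=
  Nat.card {T : SemistandardYoungTableau μ //
    (∀ c ∈ μ.cells, T c.1 c.2 < ℓ) ∧
    ∀ v : Fin ℓ, (μ.cells.filter (fun c => T c.1 c.2 = (v : ℕ))).card = d v}

/-! ### Vanishing of `R/J` in large degree -/

namespace CoQuasi

/-- The monomial `X_j^V`, with junk value `0` when `j` is not a column index. -/
def colMon (n : ℕ) {ℓ : ℕ} (V : Fin ℓ → ℕ) (j : ℕ) : PolyR ℓ n :=
  if h : j < n then ∏ i, MvPolynomial.X (i, ⟨j, h⟩) ^ V i else 0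

lemma colMon_add (n : ℕ) {ℓ : ℕ} (V W : Fin ℓ → ℕ) (j : ℕ) :
    colMon n (V + W) j = colMon n V j * colMon n W j := by
  unfold colMon
  split_ifs with h
  · simp [pow_add, Finset.prod_mul_distrib]
  · simp

/-- The fundamental quasi-symmetric polynomial of a word of column exponents, in the `k` columns
of variables starting at column `p`. A letter with flag `true` forces a strict increase of the
column index after it. -/
def fund (n : ℕ) {ℓ : ℕ} : List ((Fin ℓ → ℕ) × Bool) → ℕ → ℕ → PolyR ℓ n
  | [], _, _ => 1
  | _ :: _, 0, _ => 0
  | x :: w, k + 1, p =>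
      fund n (x :: w) k (p + 1) +
        colMon n x.1 p * (if x.2 then fund n w k (p + 1) else fund n w (k + 1) p)
termination_by w k => w.length + k

/-- The monomial quasi-symmetric polynomial in the `k` columns of variables starting at
column `p`. -/
def monQ (n : ℕ) {ℓ : ℕ} : List (Fin ℓ → ℕ) → ℕ → ℕ → PolyR ℓ n
  | [], _, _ => 1
  | _ :: _, 0, _ => 0
  | x :: w, k + 1, p => monQ n (x :: w) k (p + 1) + colMon n x p * monQ n w k (p + 1)

lemma fund_succ (n : ℕ) {ℓ : ℕ} (x : (Fin ℓ → ℕ) × Bool) (w : List ((Fin ℓ → ℕ) × Bool))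
    (k p : ℕ) : fund n (x :: w) (k + 1) p = fund n (x :: w) k (p + 1) +
      colMon n x.1 p * (if x.2 then fund n w k (p + 1) else fund n w (k + 1) p) := by
  rw [fund]

lemma fund_merge (n : ℕ) {ℓ : ℕ} (f g : Fin ℓ → ℕ) (s : Bool) (w : List ((Fin ℓ → ℕ) × Bool))
    (k p : ℕ) :
    fund n ((f, false) :: (g, s) :: w) k p =
      fund n ((f, true) :: (g, s) :: w) k p + fund n ((f + g, s) :: w) k p := by
  induction k generalizing p with
  | zero => simp [fund]
  | succ k ih =>
    rw [fund_succ n (f, false), fund_succ n (f, true), fund_succ n (f + g, s), ih]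
    simp only [Bool.false_eq_true, if_false, if_true, colMon_add]
    rw [fund_succ n (g, s)]
    ring

lemma fund_cons_true (n : ℕ) {ℓ : ℕ} (f : Fin ℓ → ℕ) (w : List ((Fin ℓ → ℕ) × Bool))
    (As : List (List (Fin ℓ → ℕ))) (h : ∀ k p, fund n w k p = (As.map (monQ n · k p)).sum)
    (k p : ℕ) :
    fund n ((f, true) :: w) k p = ((As.map (f :: ·)).map (monQ n · k p)).sum := by
  induction k generalizing p with
  | zero =>
    rw [fund, List.map_map]
    symm
    apply List.sum_eq_zero
    simp [monQ]
  | succ k ih =>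
    rw [fund, ih, if_pos rfl, h, ← List.sum_map_mul_left, List.map_map, List.map_map,
      ← List.sum_map_add]
    simp [Function.comp_def, monQ]

/-- A fundamental quasi-symmetric polynomial is a sum of monomial ones. -/
lemma fund_eq_sum_monQ (n : ℕ) {ℓ : ℕ} {P : (Fin ℓ → ℕ) → Prop}
    (hP : ∀ f g, P f → P g → P (f + g)) (m : ℕ) (w : List ((Fin ℓ → ℕ) × Bool))
    (hm : w.length = m) (hw : w ≠ []) (hPw : ∀ x ∈ w, P x.1) :
    ∃ As : List (List (Fin ℓ → ℕ)), (∀ A ∈ As, A ≠ [] ∧ ∀ V ∈ A, P V) ∧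
      ∀ k p, fund n w k p = (As.map (monQ n · k p)).sum := by
  induction m using Nat.strong_induction_on generalizing w with
  | _ m ih =>
  match w, hw with
  | [(f, s)], _ =>
    refine ⟨[[f]], ?_, fun k p => ?_⟩
    · simpa using hPw
    · induction k generalizing p with
      | zero => simp [fund, monQ]
      | succ k ih => rw [fund, ih]; simp [fund, monQ]
  | (f, s) :: (g, t) :: w', _ =>
    have hf : P f := hPw (f, s) (by simp)
    have hg : P g := hPw (g, t) (by simp)
    have hw' : ∀ x ∈ (g, t) :: w', P x.1 := fun x hx => hPw x (List.mem_cons_of_mem _ hx)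
    obtain ⟨As, hAs, hAs'⟩ := ih (w'.length + 1) (by simp [← hm]) ((g, t) :: w')
      (by simp) (by simp) hw'
    have h1 : ∀ A ∈ As.map (f :: ·), A ≠ [] ∧ ∀ V ∈ A, P V := by
      intro A hA
      obtain ⟨B, hB, rfl⟩ := List.mem_map.1 hA
      exact ⟨by simp, by simpa [hf] using (hAs B hB).2⟩
    cases s
    · obtain ⟨Bs, hBs, hBs'⟩ := ih (w'.length + 1) (by simp [← hm]) ((f + g, t) :: w')
        (by simp) (by simp) (by
          simp only [List.mem_cons, forall_eq_or_imp] at hw' ⊢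
          exact ⟨hP _ _ hf hg, hw'.2⟩)
      refine ⟨As.map (f :: ·) ++ Bs, ?_, fun k p => ?_⟩
      · intro A hA
        rcases List.mem_append.1 hA with h | h
        exacts [h1 A h, hBs A h]
      · rw [fund_merge, fund_cons_true n f _ As hAs', hBs' k p, List.map_append, List.sum_append]
    · exact ⟨As.map (f :: ·), h1, fund_cons_true n f _ As hAs'⟩

lemma monQ_eq_zero (n : ℕ) {ℓ : ℕ} (A : List (Fin ℓ → ℕ)) (k p : ℕ) (h : k < A.length) :
    monQ n A k p = 0 := by
  induction k generalizing A p with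
  | zero => cases A <;> simp_all [monQ]
  | succ k ih =>
    cases A with
    | nil => simp at h
    | cons a A => rw [monQ, ih _ _ (by simp at h ⊢; omega), ih _ _ (by simp at h ⊢; omega)]; simp

/-- The sum defining `Mlist`, restricted to columns from `p` on. -/
def tailSum (n : ℕ) {ℓ : ℕ} (A : List (Fin ℓ → ℕ)) (p : ℕ) : PolyR ℓ n :=
  ∑ s : Fin A.length → Fin n, if StrictMono s ∧ ∀ c, p ≤ (s c : ℕ) then
    ∏ c : Fin A.length, colMon n (A.get c) (s c) else 0

lemma tailSum_zero (n : ℕ) {ℓ : ℕ} (A : List (Fin ℓ → ℕ)) : tailSum n A 0 = Mlist n A := by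
  unfold tailSum Mlist
  rw [Finset.sum_filter]
  refine Finset.sum_congr rfl fun s _ => ?_
  simp [colMon]

lemma tailSum_cons (n : ℕ) {ℓ : ℕ} (a : Fin ℓ → ℕ) (A : List (Fin ℓ → ℕ)) (p : ℕ) :
    tailSum n (a :: A) p =
      ∑ x : Fin n, if p ≤ (x : ℕ) then colMon n a x * tailSum n A (x + 1) else 0 := by
  unfold tailSum
  refine ((Fin.consEquiv (n := A.length) fun _ => Fin n).sum_comp _).symm.trans ?_
  rw [Fintype.sum_prod_type]
  refine Finset.sum_congr rfl fun x _ => ?_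
  split_ifs with hx
  · rw [Finset.mul_sum]
    refine Finset.sum_congr rfl fun t _ => ?_
    have : (StrictMono (Fin.cons x t : Fin (A.length + 1) → Fin n) ∧
        ∀ c, p ≤ ((Fin.cons x t : Fin (A.length + 1) → Fin n) c : ℕ)) ↔
        (StrictMono t ∧ ∀ c, (x : ℕ) + 1 ≤ t c) := by
      constructor
      · rintro ⟨h1, -⟩
        refine ⟨fun c c' h => ?_, fun c => ?_⟩
        · simpa using h1 (Fin.succ_lt_succ_iff.2 h)
        · simpa using h1 (Fin.succ_pos c)
      · rintro ⟨h1, h2⟩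
        refine ⟨fun c c' h => ?_, fun c => ?_⟩
        · induction c using Fin.cases with
          | zero =>
            induction c' using Fin.cases with
            | zero => simp at h
            | succ c' => simpa using h2 c'
          | succ c =>
            induction c' using Fin.cases with
            | zero => simp at h
            | succ c' => simpa using h1 (Fin.succ_lt_succ_iff.1 h)
        · induction c using Fin.cases with
          | zero => simpa using hx
          | succ c => have := h2 c; simp; omega
    refine (if_congr this (Fin.prod_univ_succ _) rfl).trans ?_
    split_ifs <;> simp
  · refine Finset.sum_eq_zero fun t _ => if_neg ?_
    rintro ⟨-, h⟩
    exact hx (by simpa using h 0)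

lemma monQ_eq_tailSum (n : ℕ) {ℓ : ℕ} (A : List (Fin ℓ → ℕ)) (k p : ℕ) (h : p + k = n) :
    monQ n A k p = tailSum n A p := by
  induction k generalizing A p with
  | zero =>
    cases A with
    | nil => simp [monQ, tailSum, Subsingleton.strictMono]
    | cons a A =>
      rw [tailSum_cons, monQ, Finset.sum_eq_zero]
      intro x _
      rw [if_neg (by omega)]
  | succ k ih =>
    cases A with
    | nil => simp [monQ, tailSum, Subsingleton.strictMono]
    | cons a A =>
      rw [monQ, ih _ _ (by omega), ih _ _ (by omega), tailSum_cons, tailSum_cons]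
      have hp : p < n := by omega
      rw [← Finset.add_sum_erase _ _ (Finset.mem_univ (⟨p, hp⟩ : Fin n)),
        ← Finset.add_sum_erase _ (fun x : Fin n => if p ≤ (x : ℕ) then _ else _)
          (Finset.mem_univ (⟨p, hp⟩ : Fin n))]
      simp only [le_refl, if_true, Nat.not_succ_le_self, if_false, zero_add]
      rw [add_comm]
      congr 1
      refine Finset.sum_congr rfl fun x hx => ?_
      have : (x : ℕ) ≠ p := fun h => (Finset.mem_erase.1 hx).1 (Fin.ext h)
      exact if_congr (by omega) rfl rfl

lemma fund_mem_Jdeal (r n : ℕ) {ℓ : ℕ} (hr : 1 ≤ r) (w : List ((Fin ℓ → ℕ) × Bool))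
    (hw : w ≠ []) (hPw : ∀ x ∈ w, ∑ i, x.1 i = r) : fund n w n 0 ∈ Jdeal r n ℓ := by
  obtain ⟨As, h1, h2⟩ := fund_eq_sum_monQ n
    (P := fun V : Fin ℓ → ℕ => (∑ i, V i) ≠ 0 ∧ r ∣ ∑ i, V i)
    (by
      rintro f g ⟨hf, hf'⟩ ⟨hg, hg'⟩
      simp only [Pi.add_apply, Finset.sum_add_distrib]
      exact ⟨by omega, dvd_add hf' hg'⟩) _ w rfl hw (fun x hx => by
        rw [hPw x hx]; exact ⟨by omega, dvd_rfl⟩)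
  rw [h2]
  refine list_sum_mem ?_
  intro x hx
  obtain ⟨A, hA, rfl⟩ := List.mem_map.1 hx
  by_cases hl : n < A.length
  · simp only [monQ_eq_zero n A n 0 hl, Ideal.zero_mem]
  · simp only [monQ_eq_tailSum n A n 0 (by simp), tailSum_zero]
    exact Ideal.subset_span ⟨A, h1 A hA, by omega, rfl⟩

end CoQuasi

namespace CoQuasi

/-- The product, over the columns `j < p`, of the letters of `w j` in column `j`. -/
def wordMon (n : ℕ) {ℓ : ℕ} (p : ℕ) (w : ℕ → List (Fin ℓ → ℕ)) : PolyR ℓ n :=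
  ∏ j ∈ Finset.range p, ((w j).map (colMon n · j)).prod

/-- All letters have total degree `r`. -/
def IsWord (r : ℕ) {ℓ : ℕ} (w : ℕ → List (Fin ℓ → ℕ)) : Prop :=
  ∀ j, ∀ V ∈ w j, ∑ i, V i = r

/-- The number of letters in the columns `j < p`. -/
def wlen {ℓ : ℕ} (p : ℕ) (w : ℕ → List (Fin ℓ → ℕ)) : ℕ :=
  ∑ j ∈ Finset.range p, (w j).length

/-- Span of the monomials with `N` letters satisfying a given condition. -/
def monSpan (r n : ℕ) {ℓ : ℕ} (N : ℕ) (P : (ℕ → List (Fin ℓ → ℕ)) → Prop) :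
    Submodule ℚ (PolyR ℓ n) :=
  Submodule.span ℚ {f | ∃ w, IsWord r w ∧ wlen n w = N ∧ P w ∧ f = wordMon n n w}

/-- The letter counts of `w'` in the columns `< p` are lexicographically below those of `w`. -/
def LexBelow {ℓ : ℕ} (p : ℕ) (w w' : ℕ → List (Fin ℓ → ℕ)) : Prop :=
  ∃ j < p, (∀ i < j, (w' i).length = (w i).length) ∧ (w' j).length < (w j).length

lemma monSpan_mono (r n : ℕ) {ℓ : ℕ} (N : ℕ) {P Q : (ℕ → List (Fin ℓ → ℕ)) → Prop}
    (h : ∀ w, P w → Q w) : monSpan r n N P ≤ monSpan r n N Q :=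
  Submodule.span_mono fun _ ⟨w, h1, h2, h3, h4⟩ => ⟨w, h1, h2, h w h3, h4⟩

lemma wordMon_update_of_le (n : ℕ) {ℓ : ℕ} (p q : ℕ) (h : p ≤ q) (w : ℕ → List (Fin ℓ → ℕ))
    (a : List (Fin ℓ → ℕ)) : wordMon n p (Function.update w q a) = wordMon n p w :=
  Finset.prod_congr rfl fun j hj => by
    rw [Function.update_of_ne (by have := Finset.mem_range.1 hj; omega)]

lemma wlen_update_of_le {ℓ : ℕ} (p q : ℕ) (h : p ≤ q) (w : ℕ → List (Fin ℓ → ℕ))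
    (a : List (Fin ℓ → ℕ)) : wlen p (Function.update w q a) = wlen p w :=
  Finset.sum_congr rfl fun j hj => by
    rw [Function.update_of_ne (by have := Finset.mem_range.1 hj; omega)]

lemma wordMon_succ (n : ℕ) {ℓ : ℕ} (p : ℕ) (w : ℕ → List (Fin ℓ → ℕ)) :
    wordMon n (p + 1) w = wordMon n p w * ((w p).map (colMon n · p)).prod :=
  Finset.prod_range_succ _ _

lemma wlen_succ {ℓ : ℕ} (p : ℕ) (w : ℕ → List (Fin ℓ → ℕ)) :
    wlen (p + 1) w = wlen p w + (w p).length :=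
  Finset.sum_range_succ _ _

lemma IsWord.update {r ℓ : ℕ} {w : ℕ → List (Fin ℓ → ℕ)} (hw : IsWord r w) (q : ℕ)
    {a : List (Fin ℓ → ℕ)} (ha : ∀ V ∈ a, ∑ i, V i = r) : IsWord r (Function.update w q a) := by
  intro j V hV
  by_cases h : j = q
  · subst h; rw [Function.update_self] at hV; exact ha V hV
  · rw [Function.update_of_ne h] at hV; exact hw j V hV

lemma wordMon_update_cons (n : ℕ) {ℓ : ℕ} (p q : ℕ) (h : q < p) (w : ℕ → List (Fin ℓ → ℕ))
    (V : Fin ℓ → ℕ) :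
    wordMon n p (Function.update w q (V :: w q)) = colMon n V q * wordMon n p w := by
  unfold wordMon
  rw [← Finset.mul_prod_erase _ _ (Finset.mem_range.2 h),
    ← Finset.mul_prod_erase _ (fun j => ((w j).map (colMon n · j)).prod) (Finset.mem_range.2 h),
    ← mul_assoc]
  congr 1
  · simp
  · refine Finset.prod_congr rfl fun j hj => ?_
    rw [Function.update_of_ne (Finset.mem_erase.1 hj).1]

lemma wlen_update_cons {ℓ : ℕ} (p q : ℕ) (h : q < p) (w : ℕ → List (Fin ℓ → ℕ))
    (V : Fin ℓ → ℕ) : wlen p (Function.update w q (V :: w q)) = wlen p w + 1 := by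
  unfold wlen
  rw [← Finset.add_sum_erase _ _ (Finset.mem_range.2 h),
    ← Finset.add_sum_erase _ (fun j => (w j).length) (Finset.mem_range.2 h)]
  have : ∑ j ∈ (Finset.range p).erase q, (Function.update w q (V :: w q) j).length =
      ∑ j ∈ (Finset.range p).erase q, (w j).length :=
    Finset.sum_congr rfl fun j hj => by rw [Function.update_of_ne (Finset.mem_erase.1 hj).1]
  rw [this, Function.update_self, List.length_cons]
  omega

lemma mul_mem_monSpan (r n : ℕ) {ℓ : ℕ} {N : ℕ} {P Q : (ℕ → List (Fin ℓ → ℕ)) → Prop} {q : ℕ}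
    (hq : q < n) {V : Fin ℓ → ℕ} (hV : ∑ i, V i = r)
    (h : ∀ w, P w → Q (Function.update w q (V :: w q))) {f : PolyR ℓ n}
    (hf : f ∈ monSpan r n N P) : colMon n V q * f ∈ monSpan r n (N + 1) Q := by
  have : monSpan r n N P ≤ (monSpan r n (N + 1) Q).comap (LinearMap.mulLeft ℚ (colMon n V q)) := by
    refine Submodule.span_le.2 ?_
    rintro _ ⟨w, h1, h2, h3, rfl⟩
    refine Submodule.subset_span ⟨_, h1.update q (a := V :: w q) ?_, ?_, h w h3, ?_⟩
    · simpa [hV] using h1 q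
    · rw [wlen_update_cons n q hq, h2]
    · rw [wordMon_update_cons n n q hq, LinearMap.mulLeft_apply]
  exact this hf

/-- Agreement of words on the columns `< q`. -/
def AgreeBelow {ℓ : ℕ} (q : ℕ) (w w' : ℕ → List (Fin ℓ → ℕ)) : Prop := ∀ i < q, w' i = w i

lemma wordMon_mul_fund_mem (r n : ℕ) {ℓ : ℕ} (ν : List ((Fin ℓ → ℕ) × Bool)) (k q : ℕ)
    (hkq : q + k = n) (w : ℕ → List (Fin ℓ → ℕ)) (hw : IsWord r w)
    (hν : ∀ x ∈ ν, ∑ i, x.1 i = r) :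
    wordMon n q w * fund n ν k q ∈ monSpan r n (wlen q w + ν.length) (AgreeBelow q w) := by
  match ν, k with
  | [], k =>
    rw [fund, mul_one]
    have key : ∀ k q, q + k = n → ∀ w : ℕ → List (Fin ℓ → ℕ), (∀ i, q ≤ i → w i = []) →
        wordMon n q w = wordMon n n w ∧ wlen q w = wlen n w := by
      intro k q hk w hw
      constructor
      · refine Finset.prod_subset (by simp; omega) fun j _ hj => ?_
        rw [hw j (by simpa using hj)]; simp
      · refine Finset.sum_subset (by simp; omega) fun j _ hj => ?_
        rw [hw j (by simpa using hj)]; simp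
    set w' : ℕ → List (Fin ℓ → ℕ) := fun i => if i < q then w i else [] with hw'
    have h1 : wordMon n q w = wordMon n q w' := Finset.prod_congr rfl fun j hj => by
      rw [hw']; simp only [if_pos (Finset.mem_range.1 hj)]
    have h2 : wlen q w = wlen q w' := Finset.sum_congr rfl fun j hj => by
      rw [hw']; simp only [if_pos (Finset.mem_range.1 hj)]
    obtain ⟨h3, h4⟩ := key k q hkq w' (fun i hi => by simp [hw']; omega)
    refine Submodule.subset_span ⟨w', ?_, ?_, ?_, ?_⟩
    · intro j V hV
      simp only [hw'] at hV
      split_ifs at hV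
      · exact hw j V hV
      · simp at hV
    · rw [← h4, ← h2]; simp
    · intro i hi; simp [hw', hi]
    · rw [h1, h3]
  | x :: ν, 0 => rw [fund, mul_zero]; exact Submodule.zero_mem _
  | x :: ν, k + 1 =>
    have hx : ∑ i, x.1 i = r := hν x (by simp)
    have hν' : ∀ y ∈ ν, ∑ i, y.1 i = r := fun y hy => hν y (List.mem_cons_of_mem _ hy)
    rw [fund_succ, mul_add]
    refine Submodule.add_mem _ ?_ ?_
    · have := wordMon_mul_fund_mem r n (x :: ν) k (q + 1) (by omega) (Function.update w q [])
        (hw.update q (by simp)) hν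
      rw [wordMon_succ, wordMon_update_of_le n q q le_rfl, wlen_succ,
        wlen_update_of_le q q le_rfl] at this
      simp only [Function.update_self, List.map_nil, List.prod_nil, mul_one, List.length_nil,
        add_zero] at this
      refine monSpan_mono r n _ (fun w' hw' i hi => ?_) this
      rw [hw' i (by omega), Function.update_of_ne (by omega)]
    · split_ifs with hs
      · have := wordMon_mul_fund_mem r n ν k (q + 1) (by omega) (Function.update w q [x.1])
          (hw.update q (by simpa using hx)) hν'
        rw [wordMon_succ, wordMon_update_of_le n q q le_rfl, wlen_succ,
          wlen_update_of_le q q le_rfl] at this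
        simp only [Function.update_self, List.map_cons, List.map_nil, List.prod_cons,
          List.prod_nil, mul_one, List.length_cons, List.length_nil, mul_assoc] at this
        rw [List.length_cons,
          show wlen q w + (ν.length + 1) = wlen q w + (0 + 1) + ν.length by ring]
        refine monSpan_mono r n _ (fun w' hw' i hi => ?_) this
        rw [hw' i (by omega), Function.update_of_ne (by omega)]
      · have := wordMon_mul_fund_mem r n ν (k + 1) q hkq w hw hν'
        rw [mul_left_comm, List.length_cons, ← add_assoc]
        refine mul_mem_monSpan r n (by omega) hx (fun w' hw' i hi => ?_) this
        rw [Function.update_of_ne (by omega), hw' i hi]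
termination_by ν.length + k

/-- The word of one block: all flags are `false` except the last. -/
def blockWord {ℓ : ℕ} : List (Fin ℓ → ℕ) → List ((Fin ℓ → ℕ) × Bool)
  | [] => []
  | [V] => [(V, true)]
  | V :: W :: b => (V, false) :: blockWord (W :: b)

lemma length_blockWord {ℓ : ℕ} (b : List (Fin ℓ → ℕ)) : (blockWord b).length = b.length := by
  fun_induction blockWord b <;> simp_all

lemma mem_blockWord {ℓ : ℕ} (b : List (Fin ℓ → ℕ)) {x : (Fin ℓ → ℕ) × Bool}
    (hx : x ∈ blockWord b) : x.1 ∈ b := by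
  fun_induction blockWord b <;> simp_all
  rcases hx with rfl | hx <;> simp_all

lemma block_expand (r n : ℕ) {ℓ : ℕ} (ν : List ((Fin ℓ → ℕ) × Bool)) (k p : ℕ)
    (hkp : p + (k + 1) = n) (hν : ∀ x ∈ ν, ∑ i, x.1 i = r) (b : List (Fin ℓ → ℕ)) (hb : b ≠ [])
    (hbr : ∀ V ∈ b, ∑ i, V i = r)
    (w : ℕ → List (Fin ℓ → ℕ)) (hw : IsWord r w) :
    wordMon n (p + 1) w * (fund n (blockWord b ++ ν) (k + 1) p -
        (b.map (colMon n · p)).prod * fund n ν k (p + 1)) ∈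
      monSpan r n (wlen (p + 1) w + b.length + ν.length)
        (fun w' => (∀ i < p, w' i = w i) ∧ (w' p).length < (w p).length + b.length) := by
  have hfund : wordMon n (p + 1) w * fund n (blockWord b ++ ν) k (p + 1) ∈
      monSpan r n (wlen (p + 1) w + b.length + ν.length)
        (fun w' => (∀ i < p, w' i = w i) ∧ (w' p).length < (w p).length + b.length) := by
    have := wordMon_mul_fund_mem r n (blockWord b ++ ν) k (p + 1) (by omega) w hw (by
      intro x hx
      rcases List.mem_append.1 hx with h | h
      exacts [hbr _ (mem_blockWord b h), hν x h])
    rw [List.length_append, length_blockWord, ← add_assoc] at this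
    refine monSpan_mono r n _ (fun w' hw' => ⟨fun i hi => hw' i (by omega), ?_⟩) this
    rw [hw' p (by omega)]
    have := List.length_pos_iff.2 hb
    omega
  match b, hb with
  | [V], _ =>
    convert hfund using 1
    simp only [blockWord, List.cons_append, List.nil_append, fund_succ, if_true, List.map_cons,
      List.map_nil, List.prod_cons, List.prod_nil]
    ring
  | V :: W :: b, _ =>
    have ih := block_expand r n ν k p hkp hν (W :: b) (by simp)
      (fun U hU => hbr U (List.mem_cons_of_mem _ hU)) (Function.update w p (V :: w p))
      (hw.update p (by simpa [hbr V (by simp)] using hw p))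
    rw [wordMon_update_cons n _ p (by omega), wlen_update_cons _ p (by omega)] at ih
    have e : wordMon n (p + 1) w * (fund n (blockWord (V :: W :: b) ++ ν) (k + 1) p -
        ((V :: W :: b).map (colMon n · p)).prod * fund n ν k (p + 1)) =
        wordMon n (p + 1) w * fund n (blockWord (V :: W :: b) ++ ν) k (p + 1) +
        colMon n V p * wordMon n (p + 1) w * (fund n (blockWord (W :: b) ++ ν) (k + 1) p -
        ((W :: b).map (colMon n · p)).prod * fund n ν k (p + 1)) := by
      rw [blockWord, List.cons_append, fund_succ, List.map_cons, List.prod_cons]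
      simp only [Bool.false_eq_true, if_false]
      ring
    rw [e]
    refine Submodule.add_mem _ hfund ?_
    have hl : wlen (p + 1) w + (V :: W :: b).length + ν.length =
        wlen (p + 1) w + 1 + (W :: b).length + ν.length := by simp; ring
    rw [hl]
    refine monSpan_mono r n _ (fun w' hw' => ⟨fun i hi => ?_, ?_⟩) ih
    · rw [hw'.1 i hi, Function.update_of_ne (by omega)]
    · have := hw'.2
      rw [Function.update_self] at this
      simp only [List.length_cons] at this ⊢
      omega
termination_by b.length

end CoQuasi

namespace CoQuasi

/-- The number of letters with flag `false`. -/
def numFalse {ℓ : ℕ} (ν : List ((Fin ℓ → ℕ) × Bool)) : ℕ := (ν.filter (fun x => !x.2)).length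

lemma numFalse_append {ℓ : ℕ} (ν ν' : List ((Fin ℓ → ℕ) × Bool)) :
    numFalse (ν ++ ν') = numFalse ν + numFalse ν' := by
  simp [numFalse]

lemma numFalse_blockWord {ℓ : ℕ} (b : List (Fin ℓ → ℕ)) :
    numFalse (blockWord b) = b.length - 1 := by
  fun_induction blockWord b <;> simp_all [numFalse]

lemma getLast_blockWord {ℓ : ℕ} (b : List (Fin ℓ → ℕ)) :
    ∀ x ∈ (blockWord b).getLast?, x.2 = true := by
  fun_induction blockWord b with
  | case1 => simp
  | case2 V => simp
  | case3 V W b ih =>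
    intro x hx
    apply ih
    have : blockWord (W :: b) ≠ [] := by
      rw [← List.length_pos_iff, length_blockWord]; simp
    obtain ⟨y, l, hl⟩ := List.exists_cons_of_ne_nil this
    rw [hl] at hx ⊢
    simpa [List.getLast?_cons] using hx

/-- The reduction of the monomial of a word to lexicographically smaller ones, modulo `J`. -/
lemma reduction (r n : ℕ) {ℓ : ℕ} (hr : 1 ≤ r) (p k : ℕ) (hk : p + k = n)
    (w : ℕ → List (Fin ℓ → ℕ)) (hw : IsWord r w) (ν : List ((Fin ℓ → ℕ) × Bool))
    (hν : ∀ x ∈ ν, ∑ i, x.1 i = r) (hlast : ∀ x ∈ ν.getLast?, x.2 = true)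
    (htd : (∃ q, 1 ≤ q ∧ q ≤ p ∧ q ≤ wlen q w) ∨
      (p ≤ wlen p w + numFalse ν ∧ (1 ≤ p ∨ ν ≠ []))) :
    wordMon n p w * fund n ν k p ∈ (Jdeal r n ℓ).restrictScalars ℚ ⊔
      monSpan r n (wlen p w + ν.length) (LexBelow p w) := by
  have hsup : ∀ {N} {P Q : (ℕ → List (Fin ℓ → ℕ)) → Prop}, (∀ w, P w → Q w) →
      (Jdeal r n ℓ).restrictScalars ℚ ⊔ monSpan r n N P ≤
      (Jdeal r n ℓ).restrictScalars ℚ ⊔ monSpan r n N Q :=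
    fun h => sup_le_sup_left (monSpan_mono r n _ h) _
  have hlex : ∀ p w', LexBelow p w w' → LexBelow (p + 1) w w' :=
    fun p w' ⟨j, h1, h2⟩ => ⟨j, by omega, h2⟩
  induction p generalizing k ν with
  | zero =>
    rw [zero_add] at hk
    subst hk
    have hne : ν ≠ [] := by
      rcases htd with ⟨q, h1, h2, -⟩ | ⟨-, h | h⟩
      · omega
      · omega
      · exact h
    refine Submodule.mem_sup_left ?_
    simpa [wordMon] using fund_mem_Jdeal r k hr ν hne hν
  | succ p ih =>
    by_cases hb : w p = []
    · have hwl : wlen (p + 1) w = wlen p w := by rw [wlen_succ, hb]; simp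
      have hwm : wordMon n (p + 1) w = wordMon n p w := by rw [wordMon_succ, hb]; simp
      have hlex' : ∀ w', LexBelow (p + 1) w w' → LexBelow p w w' := by
        rintro w' ⟨j, h1, h2, h3⟩
        rcases Nat.lt_succ_iff_lt_or_eq.1 h1 with h | rfl
        · exact ⟨j, h, h2, h3⟩
        · simp [hb] at h3
      induction ν with
      | nil =>
        have := ih (k + 1) (by omega) [] (by simp) (by simp) (by
          rcases htd with ⟨q, h1, h2, h3⟩ | ⟨h, -⟩
          · by_cases hq : q = p + 1
            · subst hq
              left; refine ⟨p, ?_, le_rfl, by omega⟩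
              by_contra h0
              have : p = 0 := by omega
              subst this
              simp [wlen, hb] at h3
            · exact Or.inl ⟨q, h1, by omega, h3⟩
          · left; refine ⟨p, ?_, le_rfl, by simp [numFalse] at h; omega⟩
            by_contra h0
            have : p = 0 := by omega
            subst this
            simp [wlen, hb, numFalse] at h)
        rw [hwl, hwm]
        refine hsup (hlex p) ?_
        simpa [fund] using this
      | cons x ν ihν =>
        have hx : ∑ i, x.1 i = r := hν x (by simp)
        have hν' : ∀ y ∈ ν, ∑ i, y.1 i = r := fun y hy => hν y (List.mem_cons_of_mem _ hy)
        have hlast' : ∀ y ∈ ν.getLast?, y.2 = true := by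
          intro y hy
          refine hlast y ?_
          cases ν with
          | nil => simp at hy
          | cons a l => simpa [List.getLast?_cons] using hy
        have h1 := ih (k + 1) (by omega) (x :: ν) hν hlast (by
          rcases htd with ⟨q, h1, h2, h3⟩ | ⟨h, -⟩
          · by_cases hq : q = p + 1
            · right; subst hq; exact ⟨by omega, by simp⟩
            · exact Or.inl ⟨q, h1, by omega, h3⟩
          · right; exact ⟨by omega, by simp⟩)
        have h2 : colMon n x.1 p * (wordMon n p w *
            (if x.2 then fund n ν k (p + 1) else fund n ν (k + 1) p)) ∈
            (Jdeal r n ℓ).restrictScalars ℚ ⊔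
              monSpan r n (wlen p w + (x :: ν).length) (LexBelow p w) := by
          have h3 : wordMon n p w *
            (if x.2 then fund n ν k (p + 1) else fund n ν (k + 1) p) ∈
              (Jdeal r n ℓ).restrictScalars ℚ ⊔
                monSpan r n (wlen p w + ν.length) (LexBelow p w) := by
            split_ifs with hs
            · have := ihν hν' hlast' (by
                rcases htd with h | ⟨h, -⟩
                · exact Or.inl h
                · right
                  refine ⟨?_, by omega⟩
                  simpa [numFalse, hs] using h)
              rw [hwm, hwl] at this
              exact hsup hlex' this
            · have hne : ν ≠ [] := by
                rintro rfl
                exact hs (hlast x (by simp))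
              refine ih (k + 1) (by omega) ν hν' hlast' ?_
              rcases htd with ⟨q, h1, h2, h3⟩ | ⟨h, -⟩
              · by_cases hq : q = p + 1
                · right; subst hq; exact ⟨by omega, Or.inr hne⟩
                · exact Or.inl ⟨q, h1, by omega, h3⟩
              · right
                refine ⟨?_, Or.inr hne⟩
                simp [numFalse, hs, hwl] at h ⊢
                omega
          obtain ⟨a, ha, b, hb', hab⟩ := Submodule.mem_sup.1 h3
          rw [← hab, mul_add]
          refine Submodule.add_mem _ (Submodule.mem_sup_left ?_) (Submodule.mem_sup_right ?_)
          · exact Ideal.mul_mem_left _ _ ha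
          · rw [List.length_cons, ← add_assoc]
            refine mul_mem_monSpan r n (by omega) hx ?_ hb'
            rintro w' ⟨j, h4, h5, h6⟩
            refine ⟨j, h4, fun i hi => ?_, ?_⟩
            · rw [Function.update_of_ne (by omega), h5 i hi]
            · rwa [Function.update_of_ne (by omega)]
        have h4 := Submodule.sub_mem _ h1 h2
        rw [hwm, hwl]
        refine hsup (hlex p) ?_
        convert h4 using 1
        rw [fund_succ]
        ring
    · have hwl : wlen (p + 1) w = wlen p w + (w p).length := wlen_succ p w
      have hpos := List.length_pos_iff.2 hb
      have h1 := ih (k + 1) (by omega) (blockWord (w p) ++ ν) (by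
          intro x hx
          rcases List.mem_append.1 hx with h | h
          exacts [hw p _ (mem_blockWord _ h), hν x h]) (by
          intro x hx
          rw [List.getLast?_append] at hx
          cases hν : ν.getLast? with
          | none =>
            rw [hν] at hx
            exact getLast_blockWord (w p) x (by simpa using hx)
          | some y =>
            rw [hν] at hx
            exact hlast x (by simpa [hν] using hx)) (by
          have hne : blockWord (w p) ++ ν ≠ [] := by
            rw [← List.length_pos_iff, List.length_append, length_blockWord]; omega
          rcases htd with ⟨q, h1, h2, h3⟩ | ⟨h, -⟩
          · by_cases hq : q = p + 1
            · right; subst hq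
              refine ⟨?_, Or.inr hne⟩
              rw [numFalse_append, numFalse_blockWord]
              omega
            · exact Or.inl ⟨q, h1, by omega, h3⟩
          · right
            refine ⟨?_, Or.inr hne⟩
            rw [numFalse_append, numFalse_blockWord]
            omega)
      have h2 := block_expand r n ν k p (by omega) hν (w p) hb (hw p) (Function.update w p [])
        (hw.update p (by simp))
      rw [wordMon_succ, wordMon_update_of_le n p p le_rfl, wlen_succ,
        wlen_update_of_le p p le_rfl] at h2
      simp only [Function.update_self, List.map_nil, List.prod_nil, mul_one, List.length_nil,
        add_zero, zero_add] at h2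
      have h3 : wordMon n p w * (fund n (blockWord (w p) ++ ν) (k + 1) p -
          ((w p).map (colMon n · p)).prod * fund n ν k (p + 1)) ∈
          (Jdeal r n ℓ).restrictScalars ℚ ⊔
            monSpan r n (wlen (p + 1) w + ν.length) (LexBelow (p + 1) w) := by
        refine Submodule.mem_sup_right ?_
        rw [hwl]
        refine monSpan_mono r n _ (fun w' hw' => ⟨p, by omega, fun i hi => ?_, hw'.2⟩) h2
        rw [hw'.1 i hi, Function.update_of_ne (by omega)]
      rw [List.length_append, length_blockWord, ← add_assoc, ← hwl] at h1
      have h4 := Submodule.sub_mem _ (hsup (hlex p) h1) h3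
      convert h4 using 1
      rw [wordMon_succ]
      ring

lemma wordMon_mem_Jdeal (r n : ℕ) {ℓ : ℕ} (hr : 1 ≤ r) (hn : 1 ≤ n)
    (w : ℕ → List (Fin ℓ → ℕ)) (hw : IsWord r w) (hl : n ≤ wlen n w) :
    wordMon n n w ∈ Jdeal r n ℓ := by
  have wf : WellFounded (InvImage (· < ·)
      fun w : ℕ → List (Fin ℓ → ℕ) => toLex fun i : Fin n => (w i).length) :=
    InvImage.wf _ wellFounded_lt
  induction w using wf.induction with
  | _ w ih =>
  have h := reduction r n hr n 0 rfl w hw [] (by simp) (by simp) (Or.inl ⟨n, hn, le_rfl, hl⟩)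
  rw [fund, mul_one] at h
  refine (sup_le le_rfl (Submodule.span_le.2 ?_) : _ ≤ (Jdeal r n ℓ).restrictScalars ℚ) h
  rintro _ ⟨w', h1, h2, ⟨j, hj, h3, h4⟩, rfl⟩
  refine ih w' ⟨⟨j, hj⟩, fun i hi => h3 i hi, h4⟩ h1 ?_
  rw [h2]; simpa using hl

/-- A vector of total degree at least `k * r` dominates a sum of `k` vectors of degree `r`. -/
lemma exists_letters (r : ℕ) {ℓ : ℕ} (k : ℕ) (V : Fin ℓ → ℕ) (h : k * r ≤ ∑ i, V i) :
    ∃ b : List (Fin ℓ → ℕ), b.length = k ∧ (∀ U ∈ b, ∑ i, U i = r) ∧ b.sum ≤ V := by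
  induction k generalizing V with
  | zero => exact ⟨[], by simp⟩
  | succ k ih =>
    obtain ⟨U, hU, hUr⟩ : ∃ U ≤ V, ∑ i, U i = r := by
      have : ∀ r ≤ ∑ i, V i, ∃ U ≤ V, ∑ i, U i = r := by
        intro r
        induction r with
        | zero => exact fun _ => ⟨0, by simp⟩
        | succ r ih =>
          intro hr
          obtain ⟨U, hU, hUr⟩ := ih (by omega)
          obtain ⟨i, hi⟩ : ∃ i, U i < V i := by
            by_contra! hcon
            have := Finset.sum_le_sum fun i (_ : i ∈ Finset.univ) => hcon i
            omega
          refine ⟨U + Pi.single i 1, fun j => ?_, ?_⟩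
          · by_cases hj : j = i
            · subst hj; simp; omega
            · simpa [hj] using hU j
          · simp [Finset.sum_add_distrib, hUr]
      exact this r (by nlinarith)
    have hsum : ∑ i, (V - U) i + r = ∑ i, V i := by
      rw [← hUr, ← Finset.sum_add_distrib]
      exact Finset.sum_congr rfl fun i _ => Nat.sub_add_cancel (hU i)
    obtain ⟨b, hb, hbr, hbV⟩ := ih (V - U) (by rw [add_mul] at h; omega)
    refine ⟨U :: b, by simp [hb], by simpa [hUr] using hbr, ?_⟩
    rw [List.sum_cons]
    exact fun i => by have := hbV i; have := hU i; simp at *; omega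

lemma colMon_sum (n : ℕ) {ℓ : ℕ} (b : List (Fin ℓ → ℕ)) {j : ℕ} (hj : j < n) :
    (b.map (colMon n · j)).prod = colMon n b.sum j := by
  induction b with
  | nil => simp [colMon, hj]
  | cons V b ih => rw [List.map_cons, List.prod_cons, ih, List.sum_cons, colMon_add]

lemma monomial_eq_prod_colMon (n : ℕ) {ℓ : ℕ} (s : Fin ℓ × Fin n →₀ ℕ) :
    MvPolynomial.monomial s (1 : ℚ) = ∏ j : Fin n, colMon n (fun i => s (i, j)) j := by
  simp only [colMon, Fin.is_lt, dite_true, Fin.eta]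
  rw [Finset.prod_comm, ← Fintype.prod_prod_type' (f := fun i j =>
    (MvPolynomial.X (i, j) : PolyR ℓ n) ^ s (i, j)), MvPolynomial.monomial_eq]
  simp [Finsupp.prod_fintype]

lemma monomial_mem_Jdeal (r n : ℕ) {ℓ : ℕ} (hr : 1 ≤ r) (hn : 1 ≤ n) (s : Fin ℓ × Fin n →₀ ℕ)
    (hs : 2 * r * n - r - n < ∑ i, ∑ j, s (i, j)) :
    MvPolynomial.monomial s (1 : ℚ) ∈ Jdeal r n ℓ := by
  have hb : ∀ j : ℕ, ∃ b : List (Fin ℓ → ℕ), (∀ U ∈ b, ∑ i, U i = r) ∧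
      ∀ h : j < n, b.length = (∑ i, s (i, ⟨j, h⟩)) / r ∧ b.sum ≤ fun i => s (i, ⟨j, h⟩) := by
    intro j
    by_cases h : j < n
    · obtain ⟨b, h1, h2, h3⟩ := exists_letters r ((∑ i, s (i, ⟨j, h⟩)) / r)
        (fun i => s (i, ⟨j, h⟩)) (Nat.div_mul_le_self _ _)
      exact ⟨b, h2, fun _ => ⟨h1, h3⟩⟩
    · exact ⟨[], by simp, fun h' => absurd h' h⟩
  choose w hw hw' using hb
  have hlen : n ≤ wlen n w := by
    have h1 : wlen n w = ∑ j : Fin n, (∑ i, s (i, j)) / r := by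
      unfold wlen
      rw [Finset.sum_range]
      exact Finset.sum_congr rfl fun j _ => (hw' j j.2).1
    have h2 : ∑ j : Fin n, ∑ i, s (i, j) ≤ ∑ j : Fin n, ((∑ i, s (i, j)) / r * r + (r - 1)) := by
      refine Finset.sum_le_sum fun j _ => ?_
      have := Nat.div_add_mod (∑ i, s (i, j)) r
      have := Nat.mod_lt (∑ i, s (i, j)) hr
      rw [mul_comm]
      omega
    rw [Finset.sum_add_distrib, ← Finset.sum_mul, ← h1] at h2
    rw [Finset.sum_comm] at hs
    simp only [Finset.sum_const, Finset.card_univ, Fintype.card_fin, smul_eq_mul] at h2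
    by_contra hlt
    obtain ⟨r, rfl⟩ := Nat.exists_eq_add_of_le hr
    obtain ⟨m, rfl⟩ := Nat.exists_eq_add_of_le hn
    have h3 : wlen (1 + m) w ≤ m := by omega
    have h4 : wlen (1 + m) w * (1 + r) ≤ m * (1 + r) := Nat.mul_le_mul_right _ h3
    have h5 : 2 * (1 + r) * (1 + m) = m * (1 + r) + (1 + m) * r + (1 + r) + (1 + m) := by ring
    have h6 : 1 + r - 1 = r := by omega
    rw [h6] at h2
    omega
  have hmem := wordMon_mem_Jdeal r n hr hn w (fun j V hV => hw j V hV) hlen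
  refine Ideal.mem_of_dvd _ ?_ hmem
  rw [monomial_eq_prod_colMon, wordMon, Finset.prod_range]
  refine Finset.prod_dvd_prod_of_dvd _ _ fun j _ => ?_
  rw [colMon_sum n _ j.2]
  have : (fun i => s (i, j)) = (w j).sum + ((fun i => s (i, j)) - (w j).sum) :=
    (add_tsub_cancel_of_le (hw' j j.2).2).symm
  rw [this, colMon_add]
  exact dvd_mul_right _ _

end CoQuasi

/-! ### Alternants and Schur polynomials -/

namespace CoQuasi

section Alternant

variable {A : Type*} [CommRing A]

/-- The alternant `det (x_i ^ l_j)`. -/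
def alt (x : ℕ → A) (ℓ : ℕ) (l : Fin ℓ → ℕ) : A :=
  (Matrix.of fun i j : Fin ℓ => x i ^ l j).det

/-- The exponent vectors of `ℓ` variables interlacing the exponent vector `l`. -/
def interlace {ℓ : ℕ} (l : Fin (ℓ + 1) → ℕ) : Finset (Fin ℓ → ℕ) :=
  Fintype.piFinset fun j => Finset.Ico (l j.castSucc) (l j.succ)

lemma alt_succ (x : ℕ → A) (ℓ : ℕ) (l : Fin (ℓ + 1) → ℕ) (hl : Monotone l) :
    alt x (ℓ + 1) l = (∏ i : Fin ℓ, (x ℓ - x i)) *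
      ∑ k ∈ interlace l, x ℓ ^ (l 0 + ∑ j, (l j.succ - 1 - k j)) * alt x ℓ k := by
  set B : Matrix (Fin (ℓ + 1)) (Fin (ℓ + 1)) A := Matrix.of fun i j =>
    Fin.cases (x i ^ l 0) (fun j => x i ^ l j.succ -
      x ℓ ^ (l j.succ - l j.castSucc) * x i ^ l j.castSucc) j with hB
  have h1 : alt x (ℓ + 1) l = B.det := by
    refine Matrix.det_eq_of_forall_col_eq_smul_add_pred
      (fun j => x ℓ ^ (l j.succ - l j.castSucc)) ?_ ?_
    · intro i; simp [hB]
    · intro i j; simp [hB]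
  have hlast : ∀ j : Fin ℓ, B (Fin.last ℓ) j.succ = 0 := by
    intro j
    simp only [hB, Matrix.of_apply, Fin.cases_succ, Fin.val_last]
    rw [← pow_add, Nat.sub_add_cancel (hl (Fin.castSucc_le_succ j)), sub_self]
  rw [h1, Matrix.det_succ_row B (Fin.last ℓ), Fin.sum_univ_succ]
  simp only [hlast, mul_zero, zero_mul, Finset.sum_const_zero, add_zero]
  have hminor : B.submatrix (Fin.last ℓ).succAbove (0 : Fin (ℓ + 1)).succAbove =
      Matrix.of fun i j : Fin ℓ => (x i - x ℓ) *
        (Matrix.of fun i j : Fin ℓ => ∑ k ∈ Finset.Ico (l j.castSucc) (l j.succ),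
          x ℓ ^ (l j.succ - 1 - k) * x i ^ k) i j := by
    ext i j
    simp only [hB, Matrix.submatrix_apply, Matrix.of_apply, Fin.succAbove_last,
      Fin.zero_succAbove, Fin.cases_succ, Fin.val_castSucc]
    have := mul_geom_sum₂_Ico (x i) (x ℓ) (hl (Fin.castSucc_le_succ j))
    rw [mul_comm (x ℓ ^ _), ← this]
    simp only [mul_comm]
  rw [hminor, Matrix.det_mul_column]
  have hdet : (Matrix.of fun i j : Fin ℓ => ∑ k ∈ Finset.Ico (l j.castSucc) (l j.succ),
      x ℓ ^ (l j.succ - 1 - k) * x i ^ k).det =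
      ∑ k ∈ interlace l, x ℓ ^ (∑ j, (l j.succ - 1 - k j)) * alt x ℓ k := by
    rw [← Matrix.det_transpose]
    have e : (Matrix.of fun i j : Fin ℓ => ∑ k ∈ Finset.Ico (l j.castSucc) (l j.succ),
        x ℓ ^ (l j.succ - 1 - k) * x i ^ k).transpose =
        fun j => ∑ k ∈ Finset.Ico (l j.castSucc) (l j.succ),
          x ℓ ^ (l j.succ - 1 - k) • fun i : Fin ℓ => x i ^ k := by
      ext j i
      simp [Finset.sum_apply]
    rw [e]
    refine (MultilinearMap.map_sum_finset
      (Matrix.detRowAlternating (n := Fin ℓ) (R := A)).toMultilinearMap _ _).trans ?_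
    refine Finset.sum_congr rfl fun k _ => ?_
    rw [MultilinearMap.map_smul_univ, Finset.prod_pow_eq_pow_sum, smul_eq_mul]
    congr 1
    exact Matrix.det_transpose (Matrix.of fun i j : Fin ℓ => x i ^ k j)
  rw [hdet]
  have hsign : ∏ i : Fin ℓ, (x ℓ - x i) = (-1) ^ ℓ * ∏ i : Fin ℓ, (x i - x ℓ) := by
    have : ∀ i : Fin ℓ, x ℓ - x i = (-1) * (x i - x ℓ) := fun i => by ring
    rw [Finset.prod_congr rfl fun i _ => this i, Finset.prod_mul_distrib]
    simp
  rw [hsign, Finset.mul_sum, Finset.mul_sum, Finset.mul_sum]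
  refine Finset.sum_congr rfl fun k _ => ?_
  simp only [hB, Matrix.of_apply, Fin.cases_zero, Fin.val_last, Fin.val_zero, add_zero, pow_add]
  ring

lemma alt_staircase_succ (x : ℕ → A) (ℓ : ℕ) :
    alt x (ℓ + 1) (fun j => j) = (∏ i : Fin ℓ, (x ℓ - x i)) * alt x ℓ fun j => j := by
  rw [alt_succ x ℓ _ fun _ _ h => h]
  have : interlace (fun j : Fin (ℓ + 1) => (j : ℕ)) = {fun j : Fin ℓ => (j : ℕ)} := by
    ext k
    simp only [interlace, Fintype.mem_piFinset, Finset.mem_Ico, Fin.val_castSucc, Fin.val_succ,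
      Finset.mem_singleton, funext_iff]
    exact forall_congr' fun j => by omega
  rw [this]
  simp

lemma strictMono_of_mem_interlace {ℓ : ℕ} {l : Fin (ℓ + 1) → ℕ} {k : Fin ℓ → ℕ}
    (hl : StrictMono l) (hk : k ∈ interlace l) : StrictMono k := by
  simp only [interlace, Fintype.mem_piFinset, Finset.mem_Ico] at hk
  intro i j hij
  have h1 := (hk i).2
  have h2 := (hk j).1
  have h3 : l i.succ ≤ l j.castSucc := hl.monotone (by
    rw [Fin.le_def]; simpa using hij)
  omega

end Alternant

end CoQuasi

namespace CoQuasi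

/-- The Young diagram with at most `ℓ` rows whose row lengths are the `l a - a` in reverse order,
for a strictly monotone `l`. -/
def yd (ℓ : ℕ) (l : Fin ℓ → ℕ) : YoungDiagram where
  cells := (Finset.range ℓ ×ˢ Finset.range (∑ a, l a)).filter
    fun c => ∃ a : Fin ℓ, c.1 + a < ℓ ∧ c.2 + a < l a
  isLowerSet := by
    rintro ⟨i, j⟩ ⟨i', j'⟩ ⟨hi, hj⟩ h
    simp only [Finset.coe_filter, Finset.mem_product, Finset.mem_range, Set.mem_ofPred_eq] at h ⊢
    simp only at hi hj
    obtain ⟨⟨h1, h2⟩, a, h3, h4⟩ := h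
    exact ⟨⟨by omega, by omega⟩, a, by omega, by omega⟩

lemma mem_yd {ℓ : ℕ} {l : Fin ℓ → ℕ} {i j : ℕ} :
    (i, j) ∈ yd ℓ l ↔ ∃ a : Fin ℓ, i + a < ℓ ∧ j + a < l a := by
  rw [← YoungDiagram.mem_cells]
  simp only [yd, Finset.mem_filter, Finset.mem_product, Finset.mem_range, and_iff_right_iff_imp]
  rintro ⟨a, h1, h2⟩
  have := Finset.single_le_sum (f := l) (fun _ _ => Nat.zero_le _) (Finset.mem_univ a)
  omega

lemma StrictMono.sub_le {ℓ : ℕ} {l : Fin ℓ → ℕ} (hl : StrictMono l) {a b : Fin ℓ} (h : a ≤ b) :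
    l a + b ≤ l b + a := by
  obtain ⟨a, ha⟩ := a
  obtain ⟨b, hb⟩ := b
  simp only [Fin.mk_le_mk] at h
  induction b, h using Nat.le_induction with
  | base => simp
  | succ b h ih =>
    have h1 := ih (by omega)
    have h2 : l ⟨b, by omega⟩ < l ⟨b + 1, hb⟩ := hl (by simp)
    simp only at h1 ⊢
    omega

lemma mem_yd_iff {ℓ : ℕ} {l : Fin ℓ → ℕ} (hl : StrictMono l) {i j : ℕ} :
    (i, j) ∈ yd ℓ l ↔ ∃ a : Fin ℓ, i + a + 1 = ℓ ∧ j + a < l a := by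
  rw [mem_yd]
  refine ⟨fun ⟨a, h1, h2⟩ => ⟨⟨ℓ - 1 - i, by omega⟩, by simp only; omega, ?_⟩,
    fun ⟨a, h1, h2⟩ => ⟨a, by omega, h2⟩⟩
  have := StrictMono.sub_le hl (a := a) (b := ⟨ℓ - 1 - i, by omega⟩) (by
    rw [Fin.le_def]; simp only; omega)
  simp only at this ⊢
  omega

/-- The exponent vector of a Young diagram in `ℓ` variables. -/
def expo (ℓ : ℕ) (μ : YoungDiagram) (a : Fin ℓ) : ℕ := μ.rowLen (ℓ - 1 - a) + a

lemma strictMono_expo (ℓ : ℕ) (μ : YoungDiagram) : StrictMono (expo ℓ μ) := by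
  intro a b h
  have : μ.rowLen (ℓ - 1 - a) ≤ μ.rowLen (ℓ - 1 - b) := μ.rowLen_anti _ _ (by omega)
  simp only [expo]
  have : (a : ℕ) < b := h
  omega

lemma yd_expo (ℓ : ℕ) (μ : YoungDiagram) (h : μ.colLen 0 ≤ ℓ) : yd ℓ (expo ℓ μ) = μ := by
  ext ⟨i, j⟩
  rw [YoungDiagram.mem_cells, YoungDiagram.mem_cells, mem_yd_iff (strictMono_expo ℓ μ)]
  constructor
  · rintro ⟨a, h1, h2⟩
    rw [YoungDiagram.mem_iff_lt_rowLen]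
    have : ℓ - 1 - a = i := by omega
    rw [expo, this] at h2
    omega
  · intro hm
    have h1 : (i, 0) ∈ μ := μ.up_left_mem le_rfl (Nat.zero_le j) hm
    rw [YoungDiagram.mem_iff_lt_colLen] at h1
    rw [YoungDiagram.mem_iff_lt_rowLen] at hm
    refine ⟨⟨ℓ - 1 - i, by omega⟩, by simp only; omega, ?_⟩
    have : ℓ - 1 - (ℓ - 1 - i) = i := by omega
    simp only [expo, this]
    omega

lemma StrictMono.le_val {ℓ : ℕ} {l : Fin ℓ → ℕ} (hl : StrictMono l) (a : Fin ℓ) :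
    (a : ℕ) ≤ l a := by
  have h0 : 0 < ℓ := by have := a.2; omega
  have := StrictMono.sub_le hl (a := ⟨0, h0⟩) (b := a) (by rw [Fin.le_def]; simp)
  simp only at this
  omega

lemma expo_yd {ℓ : ℕ} {l : Fin ℓ → ℕ} (hl : StrictMono l) : expo ℓ (yd ℓ l) = l := by
  ext a
  have h : (yd ℓ l).rowLen (ℓ - 1 - a) = l a - a := by
    refine eq_of_forall_lt_iff fun j => ?_
    rw [← YoungDiagram.mem_iff_lt_rowLen, mem_yd_iff hl]
    constructor
    · rintro ⟨b, h1, h2⟩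
      have : b = a := by ext; omega
      subst this; omega
    · exact fun h => ⟨a, by omega, by omega⟩
  have := StrictMono.le_val hl a
  rw [expo, h]; omega

lemma colLen_yd_le {ℓ : ℕ} (l : Fin ℓ → ℕ) : (yd ℓ l).colLen 0 ≤ ℓ := by
  by_contra! h
  have := YoungDiagram.mem_iff_lt_colLen.2 h
  rw [mem_yd] at this
  obtain ⟨a, h, -⟩ := this
  omega

lemma card_yd {ℓ : ℕ} {l : Fin ℓ → ℕ} (hl : StrictMono l) :
    (yd ℓ l).card + ∑ a : Fin ℓ, (a : ℕ) = ∑ a, l a := by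
  have h1 : (yd ℓ l).card = ∑ a : Fin ℓ, (l a - a) := by
    rw [← Finset.sum_congr rfl fun a _ => Finset.card_range (l a - a), ← Finset.card_sigma]
    refine (Finset.card_bij (fun c _ => (ℓ - 1 - c.1, c.2)) ?_ ?_ ?_).symm
    · rintro ⟨a, j⟩ h
      simp only [Finset.mem_sigma, Finset.mem_univ, true_and,
        Finset.mem_range] at h
      exact (mem_yd_iff hl).2 ⟨a, by simp only; omega, by simp only; omega⟩
    · rintro ⟨a, j⟩ - ⟨b, j'⟩ - h
      simp only [Prod.mk.injEq] at h
      obtain rfl : a = b := Fin.ext (by omega)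
      rw [h.2]
    · rintro ⟨i, j⟩ h
      obtain ⟨a, h1, h2⟩ := (mem_yd_iff hl).1 h
      refine ⟨⟨a, j⟩, ?_, ?_⟩
      · simp only [Finset.mem_sigma, Finset.mem_univ, true_and,
          Finset.mem_range]
        omega
      · simp only [Prod.mk.injEq, and_true]
        omega
  rw [h1, ← Finset.sum_add_distrib]
  exact Finset.sum_congr rfl fun a _ => Nat.sub_add_cancel (StrictMono.le_val hl a)

/-- The semistandard tableaux with entries `< ℓ`. -/
abbrev BddSSYT (μ : YoungDiagram) (ℓ : ℕ) : Type :=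
  {T : SemistandardYoungTableau μ // ∀ c ∈ μ.cells, T c.1 c.2 < ℓ}

instance (μ : YoungDiagram) (ℓ : ℕ) : Finite (BddSSYT μ ℓ) := by
  refine Finite.of_injective (β := μ.cells → Fin ℓ) (fun T c => ⟨T.1 c.1.1 c.1.2, T.2 c.1 c.2⟩) ?_
  intro T T' h
  ext i j
  by_cases hc : (i, j) ∈ μ
  · simpa using congr_fun h ⟨(i, j), hc⟩
  · rw [T.1.zeros hc, T'.1.zeros hc]

instance (μ : YoungDiagram) (ℓ : ℕ) : Fintype (BddSSYT μ ℓ) := Fintype.ofFinite _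

lemma SSYT_le_entry {μ : YoungDiagram} (T : SemistandardYoungTableau μ) {i j : ℕ}
    (h : (i, j) ∈ μ) : i ≤ T i j := by
  induction i with
  | zero => exact Nat.zero_le _
  | succ i ih =>
    have h' : (i, j) ∈ μ := μ.up_left_mem (Nat.le_succ i) le_rfl h
    exact (ih h').trans_lt (T.col_strict (Nat.lt_succ_self i) h)

/-- The Schur polynomial of shape `μ` in `ℓ` variables. -/
def schur {A : Type*} [CommRing A] (x : ℕ → A) (μ : YoungDiagram) (ℓ : ℕ) : A :=
  ∑ T : BddSSYT μ ℓ, ∏ c ∈ μ.cells, x (T.1 c.1 c.2)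

/-- The shape formed by the entries `< ℓ` of a tableau. -/
def lowShape {μ : YoungDiagram} (T : SemistandardYoungTableau μ) (ℓ : ℕ) : YoungDiagram where
  cells := μ.cells.filter fun c => T c.1 c.2 < ℓ
  isLowerSet := by
    rintro ⟨i, j⟩ ⟨i', j'⟩ ⟨hi, hj⟩ h
    simp only [Finset.coe_filter, YoungDiagram.mem_cells, Set.mem_ofPred_eq] at h ⊢
    simp only at hi hj
    exact ⟨μ.up_left_mem hi hj h.1, ((T.row_weak_of_le hj (μ.up_left_mem hi le_rfl h.1)).trans
      (T.col_weak hi h.1)).trans_lt h.2⟩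

lemma mem_lowShape {μ : YoungDiagram} {T : SemistandardYoungTableau μ} {ℓ i j : ℕ} :
    (i, j) ∈ lowShape T ℓ ↔ (i, j) ∈ μ ∧ T i j < ℓ := by
  rw [← YoungDiagram.mem_cells]
  simp [lowShape]

lemma colLen_lowShape_le {μ : YoungDiagram} (T : SemistandardYoungTableau μ) (ℓ : ℕ) :
    (lowShape T ℓ).colLen 0 ≤ ℓ := by
  by_contra! h
  have := mem_lowShape.1 (YoungDiagram.mem_iff_lt_colLen.2 h)
  have h2 := SSYT_le_entry T this.1
  omega

/-- Restriction of a tableau to a smaller shape. -/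
def restrictSSYT {μ ν : YoungDiagram} (h : ν ≤ μ) (T : SemistandardYoungTableau μ) :
    SemistandardYoungTableau ν where
  entry i j := if (i, j) ∈ ν then T i j else 0
  row_weak' hj hc := by
    rw [if_pos (ν.up_left_mem le_rfl hj.le hc), if_pos hc]
    exact T.row_weak hj (h hc)
  col_strict' hi hc := by
    rw [if_pos (ν.up_left_mem hi.le le_rfl hc), if_pos hc]
    exact T.col_strict hi (h hc)
  zeros' hc := if_neg hc

/-- Extension of a tableau with entries `< ℓ` by a horizontal strip of entries `ℓ`. -/
def extendSSYT {μ ν : YoungDiagram} {ℓ : ℕ} (hν : ν ≤ μ)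
    (hs : ∀ i j, (i + 1, j) ∈ μ → (i, j) ∈ ν)
    (T : BddSSYT ν ℓ) : SemistandardYoungTableau μ where
  entry i j := if (i, j) ∈ ν then T.1 i j else if (i, j) ∈ μ then ℓ else 0
  row_weak' {i j1 j2} hj hc := by
    by_cases h2 : (i, j2) ∈ ν
    · rw [if_pos (ν.up_left_mem le_rfl hj.le h2), if_pos h2]
      exact T.1.row_weak hj h2
    · rw [if_neg h2, if_pos hc]
      split_ifs with h3 h4
      · exact (T.2 _ h3).le
      · exact le_rfl
      · exact Nat.zero_le _
  col_strict' {i1 i2 j} hi hc := by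
    have h1 : (i1, j) ∈ ν := hs _ _ (μ.up_left_mem hi le_rfl hc)
    rw [if_pos h1]
    split_ifs with h2
    · exact T.1.col_strict hi h2
    · exact T.2 _ h1
  zeros' hc := by
    rw [if_neg hc, if_neg fun h => hc (hν h)]

lemma restrictSSYT_apply {μ ν : YoungDiagram} (h : ν ≤ μ) (T : SemistandardYoungTableau μ)
    (i j : ℕ) : restrictSSYT h T i j = if (i, j) ∈ ν then T i j else 0 := rfl

lemma extendSSYT_apply {μ ν : YoungDiagram} {ℓ : ℕ} (hν : ν ≤ μ)
    (hs : ∀ i j, (i + 1, j) ∈ μ → (i, j) ∈ ν) (T : BddSSYT ν ℓ) (i j : ℕ) :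
    extendSSYT hν hs T i j = if (i, j) ∈ ν then T.1 i j else if (i, j) ∈ μ then ℓ else 0 := rfl

lemma expo_lowShape_mem {ℓ : ℕ} {l : Fin (ℓ + 1) → ℕ} (hl : StrictMono l)
    (T : BddSSYT (yd (ℓ + 1) l) (ℓ + 1)) : expo ℓ (lowShape T.1 ℓ) ∈ interlace l := by
  simp only [interlace, Fintype.mem_piFinset, Finset.mem_Ico, expo]
  intro a
  constructor
  · by_contra! h
    set m := (lowShape T.1 ℓ).rowLen (ℓ - 1 - a) with hm
    have h1 : (ℓ - 1 - a + 1, m) ∈ yd (ℓ + 1) l :=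
      (mem_yd_iff hl).2 ⟨a.castSucc, by simp; omega, by simpa using h⟩
    have h2 : (ℓ - 1 - a, m) ∈ lowShape T.1 ℓ := by
      refine mem_lowShape.2 ⟨(yd _ l).up_left_mem (Nat.le_succ _) le_rfl h1, ?_⟩
      have h3 := T.1.col_strict (Nat.lt_add_one (ℓ - 1 - a)) h1
      have h4 := T.2 _ h1
      simp only at h4
      omega
    rw [YoungDiagram.mem_iff_lt_rowLen] at h2
    omega
  · by_contra! h
    have h0 := StrictMono.le_val hl a.succ
    simp only [Fin.val_succ] at h0
    have h1 : (ℓ - 1 - a, l a.succ - (a + 1)) ∈ lowShape T.1 ℓ := by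
      rw [YoungDiagram.mem_iff_lt_rowLen]; omega
    obtain ⟨b, h2, h3⟩ := (mem_yd_iff hl).1 (mem_lowShape.1 h1).1
    obtain rfl : b = a.succ := Fin.ext (by simp; omega)
    simp only [Fin.val_succ] at h3
    omega

lemma schur_succ {A : Type*} [CommRing A] (x : ℕ → A) {ℓ : ℕ} {l : Fin (ℓ + 1) → ℕ}
    (hl : StrictMono l) :
    schur x (yd (ℓ + 1) l) (ℓ + 1) = ∑ k ∈ interlace l,
      x ℓ ^ (l 0 + ∑ j, (l j.succ - 1 - k j)) * schur x (yd ℓ k) ℓ := by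
  unfold schur
  rw [← Finset.sum_fiberwise_of_maps_to (g := fun T : BddSSYT (yd (ℓ + 1) l) (ℓ + 1) =>
    expo ℓ (lowShape T.1 ℓ)) fun T _ => expo_lowShape_mem hl T]
  refine Finset.sum_congr rfl fun k hk => ?_
  have hkm := strictMono_of_mem_interlace hl hk
  have hk' := hk
  simp only [interlace, Fintype.mem_piFinset, Finset.mem_Ico] at hk'
  have hν : yd ℓ k ≤ yd (ℓ + 1) l := by
    rintro ⟨i, j⟩ h
    obtain ⟨a, h1, h2⟩ := (mem_yd_iff hkm).1 h
    have := (hk' a).2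
    exact (mem_yd_iff hl).2 ⟨a.succ, by simp; omega, by simp; omega⟩
  have hs : ∀ i j, (i + 1, j) ∈ yd (ℓ + 1) l → (i, j) ∈ yd ℓ k := by
    intro i j h
    obtain ⟨b, h1, h2⟩ := (mem_yd_iff hl).1 h
    have := (hk' ⟨b, by omega⟩).1
    exact (mem_yd_iff hkm).2 ⟨⟨b, by omega⟩, by simp only; omega, lt_of_lt_of_le h2 this⟩
  have hlow : ∀ T : BddSSYT (yd (ℓ + 1) l) (ℓ + 1), expo ℓ (lowShape T.1 ℓ) = k →
      lowShape T.1 ℓ = yd ℓ k := by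
    rintro T rfl
    rw [yd_expo _ _ (colLen_lowShape_le _ _)]
  have hexp : l 0 + ∑ j, (l j.succ - 1 - k j) = ((yd (ℓ + 1) l).cells \ (yd ℓ k).cells).card := by
    rw [Finset.card_sdiff_of_subset (YoungDiagram.cells_subset_iff.2 hν)]
    have h1 := card_yd hl
    have h2 := card_yd hkm
    rw [Fin.sum_univ_succ, Fin.sum_univ_succ (f := l)] at h1
    simp only [Fin.val_zero, Fin.val_succ, Finset.sum_add_distrib, zero_add] at h1
    have h3 : ∑ j, (l j.succ - 1 - k j) + ∑ j, k j + ∑ j : Fin ℓ, 1 = ∑ j : Fin ℓ, l j.succ := by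
      rw [← Finset.sum_add_distrib, ← Finset.sum_add_distrib]
      exact Finset.sum_congr rfl fun j _ => by have := (hk' j).2; omega
    change _ = (yd (ℓ + 1) l).card - (yd ℓ k).card
    omega
  rw [Finset.mul_sum]
  symm
  refine Finset.sum_bij (fun T _ => (⟨extendSSYT hν hs T, ?_⟩ : BddSSYT (yd (ℓ + 1) l) (ℓ + 1)))
    ?_ ?_ ?_ ?_
  · rintro ⟨i, j⟩ hc
    simp only [extendSSYT_apply]
    split_ifs with h1
    · exact (T.2 _ h1).trans (Nat.lt_succ_self ℓ)
    · exact Nat.lt_succ_self ℓ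
    · exact Nat.succ_pos ℓ
  · intro T _
    simp only [Finset.mem_filter, Finset.mem_univ, true_and]
    have : lowShape (extendSSYT hν hs T) ℓ = yd ℓ k := by
      ext ⟨i, j⟩
      rw [YoungDiagram.mem_cells, YoungDiagram.mem_cells, mem_lowShape]
      simp only [extendSSYT_apply]
      constructor
      · rintro ⟨h1, h2⟩
        by_contra h3
        simp [h1, h3] at h2
      · intro h
        rw [if_pos h]
        exact ⟨hν h, T.2 _ h⟩
    rw [this, expo_yd hkm]
  · intro T _ T' _ h
    ext i j
    by_cases hc : (i, j) ∈ yd ℓ k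
    · have := congr_arg (fun S : BddSSYT (yd (ℓ + 1) l) (ℓ + 1) => S.1 i j) h
      simpa [extendSSYT_apply, hc] using this
    · rw [T.1.zeros hc, T'.1.zeros hc]
  · intro T hT
    have hT' := hlow T (by simpa using hT)
    have hmem : ∀ i j, (i, j) ∈ yd ℓ k ↔ (i, j) ∈ yd (ℓ + 1) l ∧ T.1 i j < ℓ := by
      intro i j; rw [← hT', mem_lowShape]
    refine ⟨⟨restrictSSYT hν T.1, ?_⟩, Finset.mem_univ _, ?_⟩
    · rintro ⟨i, j⟩ hc
      have hc' : (i, j) ∈ yd ℓ k := hc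
      simp only [restrictSSYT_apply, if_pos hc']
      exact ((hmem i j).1 hc).2
    · ext i j
      by_cases hc : (i, j) ∈ yd ℓ k
      · simp [restrictSSYT_apply, extendSSYT_apply, hc]
      · by_cases hc' : (i, j) ∈ yd (ℓ + 1) l
        · have h1 : T.1 i j < ℓ + 1 := T.2 _ hc'
          have h2 : ¬ T.1 i j < ℓ := fun h => hc ((hmem i j).2 ⟨hc', h⟩)
          simp only [restrictSSYT_apply, extendSSYT_apply, if_neg hc, if_pos hc']
          omega
        · rw [SemistandardYoungTableau.zeros _ hc', T.1.zeros hc']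
  · intro T _
    have hsub : (yd ℓ k).cells ⊆ (yd (ℓ + 1) l).cells := YoungDiagram.cells_subset_iff.2 hν
    rw [← Finset.prod_sdiff hsub, hexp]
    congr 1
    · rw [← Finset.prod_const]
      refine (Finset.prod_congr rfl fun c hc => ?_).symm
      rw [Finset.mem_sdiff] at hc
      have h1 : (c.1, c.2) ∉ yd ℓ k := hc.2
      have h2 : (c.1, c.2) ∈ yd (ℓ + 1) l := hc.1
      simp only [extendSSYT_apply, if_neg h1, if_pos h2]
    · refine (Finset.prod_congr rfl fun c hc => ?_).symm
      have h1 : (c.1, c.2) ∈ yd ℓ k := hc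
      simp only [extendSSYT_apply, if_pos h1]

/-- The bialternant formula. -/
lemma alt_eq_mul_schur {A : Type*} [CommRing A] (x : ℕ → A) {ℓ : ℕ} {l : Fin ℓ → ℕ}
    (hl : StrictMono l) : alt x ℓ l = alt x ℓ (fun j => j) * schur x (yd ℓ l) ℓ := by
  induction ℓ with
  | zero =>
    have hcells : (yd 0 l).cells = ∅ := by
      ext ⟨i, j⟩
      rw [YoungDiagram.mem_cells, mem_yd]
      simp
    have hsub : ∀ T T' : BddSSYT (yd 0 l) 0, T = T' := by
      intro T T'
      ext i j
      have : (i, j) ∉ yd 0 l := by rw [mem_yd]; simp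
      rw [T.1.zeros this, T'.1.zeros this]
    have : Unique (BddSSYT (yd 0 l) 0) :=
      ⟨⟨⟨SemistandardYoungTableau.highestWeight _, by simp [hcells]⟩⟩, fun T => hsub _ _⟩
    have h1 : schur x (yd 0 l) 0 = 1 := by
      unfold schur
      simp [hcells]
    rw [h1, mul_one, Subsingleton.elim l]
  | succ ℓ ih =>
    rw [alt_succ x ℓ l hl.monotone, alt_staircase_succ, schur_succ x hl, mul_assoc]
    congr 1
    rw [Finset.mul_sum]
    refine Finset.sum_congr rfl fun k hk => ?_
    rw [ih (strictMono_of_mem_interlace hl hk)]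
    ring

end CoQuasi

/-! ### Schur expansions of symmetric polynomials -/

namespace CoQuasi

open MvPolynomial

/-- A function on `Fin ℓ` as an exponent. -/
abbrev ex {ℓ : ℕ} (d : Fin ℓ → ℕ) : Fin ℓ →₀ ℕ := Finsupp.equivFunOnFinite.symm d

lemma ex_injective {ℓ : ℕ} : Function.Injective (ex (ℓ := ℓ)) :=
  Finsupp.equivFunOnFinite.symm.injective

lemma monomial_ex {ℓ : ℕ} (d : Fin ℓ → ℕ) :
    monomial (ex d) (1 : ℚ) = ∏ i, (X i : MvPolynomial (Fin ℓ) ℚ) ^ d i := by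
  rw [monomial_eq]
  simp [Finsupp.prod_fintype]

/-- The variables of `MvPolynomial (Fin ℓ) ℚ`, extended by zero. -/
def xv (ℓ : ℕ) (i : ℕ) : MvPolynomial (Fin ℓ) ℚ := if h : i < ℓ then X ⟨i, h⟩ else 0

lemma xv_val {ℓ : ℕ} (i : Fin ℓ) : xv ℓ i = X i := by simp [xv]

lemma coeff_schur {ℓ : ℕ} (μ : YoungDiagram) (d : Fin ℓ → ℕ) :
    coeff (ex d) (schur (xv ℓ) μ ℓ) = ssytCount μ ℓ d := by
  have h1 : ∀ T : BddSSYT μ ℓ, ∏ c ∈ μ.cells, xv ℓ (T.1 c.1 c.2) =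
      monomial (ex fun v : Fin ℓ => (μ.cells.filter fun c => T.1 c.1 c.2 = (v : ℕ)).card) 1 := by
    intro T
    rw [monomial_ex, ← Finset.prod_fiberwise_of_maps_to (t := Finset.range ℓ)
      (g := fun c => T.1 c.1 c.2) fun c hc => Finset.mem_range.2 (T.2 c hc), Finset.prod_range]
    refine Finset.prod_congr rfl fun v _ => ?_
    rw [Finset.prod_congr rfl (g := fun _ => X v), Finset.prod_const]
    intro c hc
    rw [(Finset.mem_filter.1 hc).2, xv_val]
  unfold schur ssytCount
  simp only [h1, coeff_sum, coeff_monomial]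
  rw [Finset.sum_boole, Nat.cast_inj, ← Fintype.card_subtype, ← Nat.card_eq_fintype_card]
  refine Nat.card_congr ((Equiv.subtypeEquivRight fun T => ?_).trans
    (Equiv.subtypeSubtypeEquivSubtypeInter _ _))
  rw [ex_injective.eq_iff, funext_iff]

lemma alt_eq_sum {ℓ : ℕ} (l : Fin ℓ → ℕ) :
    alt (xv ℓ) ℓ l = ∑ σ : Equiv.Perm (Fin ℓ),
      monomial (ex (l ∘ σ)) ((Equiv.Perm.sign σ : ℤ) : ℚ) := by
  unfold alt
  rw [← Matrix.det_transpose, Matrix.det_apply]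
  refine Finset.sum_congr rfl fun σ _ => ?_
  simp only [Matrix.transpose_apply, Matrix.of_apply, xv_val, Function.comp_def]
  rw [← mul_one ((Equiv.Perm.sign σ : ℤ) : ℚ), ← smul_eq_mul, ← smul_monomial, monomial_ex,
    Units.smul_def, Int.cast_smul_eq_zsmul]

lemma strictMono_comp_perm {ℓ : ℕ} {l l' : Fin ℓ → ℕ} (hl : StrictMono l) (hl' : StrictMono l')
    {σ : Equiv.Perm (Fin ℓ)} (h : l ∘ σ = l') : σ = 1 ∧ l = l' := by
  have hσ : StrictMono σ := fun i j hij => by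
    have := hl' hij
    rw [← h] at this
    exact hl.lt_iff_lt.1 this
  have : σ = 1 := by
    have := Subsingleton.elim (hσ.orderIsoOfSurjective σ σ.surjective) (OrderIso.refl _)
    ext i
    exact congr_arg (fun f : Fin ℓ ≃o Fin ℓ => (f i : ℕ)) this
  subst this
  exact ⟨rfl, by simpa using h⟩

lemma coeff_alt {ℓ : ℕ} {l l' : Fin ℓ → ℕ} (hl : StrictMono l) (hl' : StrictMono l') :
    coeff (ex l') (alt (xv ℓ) ℓ l) = if l = l' then 1 else 0 := by
  rw [alt_eq_sum, coeff_sum]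
  simp only [coeff_monomial, ex_injective.eq_iff]
  split_ifs with h
  · subst h
    rw [Finset.sum_eq_single 1]
    · simp
    · intro σ _ hσ
      rw [if_neg fun h => hσ (strictMono_comp_perm hl hl' h).1]
    · simp
  · exact Finset.sum_eq_zero fun σ _ => if_neg fun h' => h (strictMono_comp_perm hl hl' h').2

lemma alt_staircase_ne_zero (ℓ : ℕ) : alt (xv ℓ) ℓ (fun j => j) ≠ 0 := by
  intro h
  have := coeff_alt (ℓ := ℓ) (l := fun j => j) (l' := fun j => j) (fun _ _ h => h) (fun _ _ h => h)
  rw [h] at this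
  simp at this

/-- Symmetric polynomials, by coefficients. -/
def IsSymm {ℓ : ℕ} (χ : MvPolynomial (Fin ℓ) ℚ) : Prop :=
  ∀ σ : Equiv.Perm (Fin ℓ), rename σ χ = χ

/-- Antisymmetric polynomials. -/
def IsAnti {ℓ : ℕ} (f : MvPolynomial (Fin ℓ) ℚ) : Prop :=
  ∀ σ : Equiv.Perm (Fin ℓ), rename σ f = C ((Equiv.Perm.sign σ : ℤ) : ℚ) * f

lemma coeff_rename_perm {ℓ : ℕ} (σ : Equiv.Perm (Fin ℓ)) (f : MvPolynomial (Fin ℓ) ℚ)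
    (d : Fin ℓ → ℕ) : coeff (ex d) (rename σ f) = coeff (ex (d ∘ σ)) f := by
  rw [← coeff_rename_mapDomain σ σ.injective f (ex (d ∘ σ))]
  congr 1
  ext i
  obtain ⟨j, rfl⟩ := σ.surjective i
  rw [Finsupp.mapDomain_apply σ.injective]
  simp

lemma isAnti_alt {ℓ : ℕ} (l : Fin ℓ → ℕ) : IsAnti (alt (xv ℓ) ℓ l) := by
  intro σ
  unfold alt
  rw [AlgHom.map_det]
  have := Matrix.det_permute σ (Matrix.of fun i j : Fin ℓ => xv ℓ i ^ l j)
  rw [show (C ((Equiv.Perm.sign σ : ℤ) : ℚ) : MvPolynomial (Fin ℓ) ℚ) =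
    ((Equiv.Perm.sign σ : ℤ) : MvPolynomial (Fin ℓ) ℚ) by simp, ← this]
  congr 1
  ext1 i j
  simp [AlgHom.mapMatrix_apply, xv_val]

lemma IsAnti.sub {ℓ : ℕ} {f g : MvPolynomial (Fin ℓ) ℚ} (hf : IsAnti f) (hg : IsAnti g) :
    IsAnti (f - g) := fun σ => by rw [map_sub, hf, hg, mul_sub]

lemma IsAnti.eq_zero {ℓ : ℕ} {f : MvPolynomial (Fin ℓ) ℚ} (hf : IsAnti f)
    (h : ∀ l : Fin ℓ → ℕ, StrictMono l → coeff (ex l) f = 0) : f = 0 := by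
  ext d
  obtain ⟨e, rfl⟩ := Finsupp.equivFunOnFinite.symm.surjective d
  change coeff (ex e) f = 0
  have key : ∀ σ : Equiv.Perm (Fin ℓ), coeff (ex (e ∘ σ)) f =
      ((Equiv.Perm.sign σ : ℤ) : ℚ) * coeff (ex e) f := fun σ => by
    rw [← coeff_rename_perm, hf, coeff_C_mul]
  by_cases he : Function.Injective e
  · have h1 := key (Tuple.sort e)
    rw [h _ ((Tuple.monotone_sort e).strictMono_of_injective
      (he.comp (Tuple.sort e).injective))] at h1
    rcases Int.units_eq_one_or (Equiv.Perm.sign (Tuple.sort e)) with h2 | h2 <;> rw [h2] at h1 <;>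
      simpa using h1.symm
  · simp only [Function.Injective, not_forall] at he
    obtain ⟨i, j, hij, hne⟩ := he
    have h1 := key (Equiv.swap i j)
    have h2 : e ∘ Equiv.swap i j = e := by
      rw [Equiv.comp_swap_eq_update]
      simp [hij]
    rw [h2, Equiv.Perm.sign_swap hne] at h1
    simp at h1
    linarith

/-- The coefficient of the Schur polynomial with exponent vector `l` in `χ`. -/
def schurCoeff {ℓ : ℕ} (χ : MvPolynomial (Fin ℓ) ℚ) (l : Fin ℓ → ℕ) : ℚ :=
  coeff (ex l) (alt (xv ℓ) ℓ (fun j => j) * χ)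

/-- The exponent vectors contributing to the Schur expansion of `χ`. -/
def schurSupport {ℓ : ℕ} (χ : MvPolynomial (Fin ℓ) ℚ) : Finset (Fin ℓ → ℕ) :=
  Finset.filter StrictMono
    (Finset.image (fun s : Fin ℓ →₀ ℕ => (⇑s : Fin ℓ → ℕ)) (alt (xv ℓ) ℓ (fun j => j) * χ).support)

lemma mem_schurSupport {ℓ : ℕ} {χ : MvPolynomial (Fin ℓ) ℚ} {l : Fin ℓ → ℕ} :
    l ∈ schurSupport χ ↔ StrictMono l ∧ schurCoeff χ l ≠ 0 := by
  simp only [schurSupport, Finset.mem_filter, Finset.mem_image, mem_support_iff, schurCoeff]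
  rw [and_comm]
  refine and_congr_right fun _ => ⟨?_, fun h => ⟨ex l, h, rfl⟩⟩
  rintro ⟨s, hs, rfl⟩
  rwa [show ex (s : Fin ℓ → ℕ) = s from Finsupp.equivFunOnFinite.symm_apply_apply s]

lemma schur_expansion {ℓ : ℕ} {χ : MvPolynomial (Fin ℓ) ℚ} (hχ : IsSymm χ) :
    χ = ∑ l ∈ schurSupport χ, C (schurCoeff χ l) * schur (xv ℓ) (yd ℓ l) ℓ := by
  refine mul_left_cancel₀ (alt_staircase_ne_zero ℓ) ?_
  rw [← sub_eq_zero]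
  have h1 : alt (xv ℓ) ℓ (fun j => j) *
      ∑ l ∈ schurSupport χ, C (schurCoeff χ l) * schur (xv ℓ) (yd ℓ l) ℓ =
      ∑ l ∈ schurSupport χ, C (schurCoeff χ l) * alt (xv ℓ) ℓ l := by
    rw [Finset.mul_sum]
    refine Finset.sum_congr rfl fun l hl => ?_
    rw [alt_eq_mul_schur _ (mem_schurSupport.1 hl).1]
    ring
  rw [h1]
  refine IsAnti.eq_zero (IsAnti.sub ?_ ?_) ?_
  · intro σ
    rw [map_mul, isAnti_alt, hχ, mul_assoc]
  · intro σ
    rw [map_sum, Finset.mul_sum]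
    refine Finset.sum_congr rfl fun l _ => ?_
    rw [map_mul, isAnti_alt, rename_C]
    ring
  · intro l hl
    rw [coeff_sub, coeff_sum]
    change schurCoeff χ l - _ = 0
    have : ∀ l' ∈ schurSupport χ, coeff (ex l) (C (schurCoeff χ l') * alt (xv ℓ) ℓ l') =
        if l' = l then schurCoeff χ l' else 0 := by
      intro l' hl'
      rw [coeff_C_mul, coeff_alt (mem_schurSupport.1 hl').1 hl]
      simp
    rw [Finset.sum_congr rfl this, Finset.sum_ite_eq']
    split_ifs with h
    · simp
    · rw [mem_schurSupport, not_and_not_right] at h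
      rw [h hl, sub_zero]

lemma schurCoeff_sum {ℓ : ℕ} (s : Finset (Fin ℓ → ℕ)) (hs : ∀ l ∈ s, StrictMono l)
    (c : (Fin ℓ → ℕ) → ℚ) {l : Fin ℓ → ℕ} (hl : StrictMono l) :
    schurCoeff (∑ l ∈ s, C (c l) * schur (xv ℓ) (yd ℓ l) ℓ) l = if l ∈ s then c l else 0 := by
  unfold schurCoeff
  rw [Finset.mul_sum, coeff_sum]
  have : ∀ l' ∈ s, coeff (ex l) (alt (xv ℓ) ℓ (fun j => j) *
      (C (c l') * schur (xv ℓ) (yd ℓ l') ℓ)) = if l' = l then c l' else 0 := by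
    intro l' hl'
    rw [mul_left_comm, ← alt_eq_mul_schur _ (hs l' hl'), coeff_C_mul, coeff_alt (hs l' hl') hl]
    simp
  rw [Finset.sum_congr rfl this, Finset.sum_ite_eq']

lemma coeff_eq_sum_schurCoeff {ℓ : ℕ} {χ : MvPolynomial (Fin ℓ) ℚ} (hχ : IsSymm χ)
    (d : Fin ℓ → ℕ) :
    coeff (ex d) χ = ∑ l ∈ schurSupport χ, schurCoeff χ l * ssytCount (yd ℓ l) ℓ d := by
  conv_lhs => rw [schur_expansion hχ]
  rw [coeff_sum]
  exact Finset.sum_congr rfl fun l _ => by rw [coeff_C_mul, coeff_schur]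

end CoQuasi

namespace CoQuasi

open MvPolynomial

lemma sum_rowLen_eq (μ : YoungDiagram) (k : ℕ) :
    ∑ i ∈ Finset.range k, μ.rowLen i = (μ.cells.filter fun c => c.1 < k).card := by
  rw [Finset.card_eq_sum_card_fiberwise (f := Prod.fst) (t := Finset.range k)
    fun c hc => Finset.mem_range.2 (Finset.mem_filter.1 hc).2]
  refine Finset.sum_congr rfl fun i hi => ?_
  rw [YoungDiagram.rowLen_eq_card, YoungDiagram.row, Finset.filter_filter]
  congr 1
  ext c
  simp only [Finset.mem_filter, Finset.mem_range] at hi ⊢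
  constructor
  · rintro ⟨h1, rfl⟩; exact ⟨h1, hi, rfl⟩
  · rintro ⟨h1, -, h2⟩; exact ⟨h1, h2⟩

lemma sum_content_eq {μ : YoungDiagram} {ℓ : ℕ} {d : Fin ℓ → ℕ}
    (T : SemistandardYoungTableau μ)
    (hc : ∀ v : Fin ℓ, (μ.cells.filter (fun c => T c.1 c.2 = (v : ℕ))).card = d v)
    {e : ℕ → ℕ} (he : ∀ v : Fin ℓ, d v = e v) (k : ℕ) (hk : k ≤ ℓ) :
    ∑ i ∈ Finset.range k, e i = (μ.cells.filter fun c => T c.1 c.2 < k).card := by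
  rw [Finset.card_eq_sum_card_fiberwise (f := fun c => T c.1 c.2) (t := Finset.range k)
    (s := μ.cells.filter fun c => T c.1 c.2 < k)
    fun c hc => Finset.mem_range.2 (Finset.mem_filter.1 hc).2]
  refine Finset.sum_congr rfl fun i hi => ?_
  have hi' := Finset.mem_range.1 hi
  rw [← he ⟨i, by omega⟩, ← hc, Finset.filter_filter]
  congr 1
  ext c
  simp only [Finset.mem_filter]
  constructor
  · rintro ⟨h1, h2⟩; exact ⟨h1, by omega, h2⟩
  · rintro ⟨h1, -, h2⟩; exact ⟨h1, h2⟩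

lemma abel_nonneg (a e : ℕ → ℤ) (ha : Antitone a) (ℓ : ℕ)
    (he : ∀ k ≤ ℓ, 0 ≤ ∑ i ∈ Finset.range k, e i) :
    a ℓ * ∑ i ∈ Finset.range ℓ, e i ≤ ∑ i ∈ Finset.range ℓ, a i * e i := by
  induction ℓ with
  | zero => simp
  | succ k ih =>
    have h1 := ih fun j hj => he j (by omega)
    have h2 := he (k + 1) le_rfl
    have h3 := ha (Nat.le_succ k)
    rw [Finset.sum_range_succ (fun i => a i * e i)]
    rw [Finset.sum_range_succ] at h2 ⊢
    simp only [Nat.succ_eq_add_one] at h3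
    nlinarith

lemma sum_expo_sq (ℓ : ℕ) (μ : YoungDiagram) :
    ∑ j, (expo ℓ μ j : ℤ) ^ 2 =
      ∑ i ∈ Finset.range ℓ, ((μ.rowLen i : ℤ) + ℓ - 1 - i) ^ 2 := by
  rw [← Finset.sum_range_reflect, Finset.sum_range]
  refine Finset.sum_congr rfl fun j _ => ?_
  have := j.2
  rw [expo]
  push_cast
  congr 1
  omega

lemma yd_eq_of_ssytCount {ℓ : ℕ} {l l' : Fin ℓ → ℕ} (hl : StrictMono l) (hl' : StrictMono l')
    (hnorm : ∑ j, l j ^ 2 = ∑ j, l' j ^ 2)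
    (hK : ssytCount (yd ℓ l') ℓ (fun i => (yd ℓ l).rowLen i) ≠ 0) : l' = l := by
  set μ := yd ℓ l with hμ
  set μ' := yd ℓ l' with hμ'
  obtain ⟨⟨T, hT, hc⟩⟩ := (Nat.card_ne_zero.1 hK).1
  have hdom : ∀ k ≤ ℓ, ∑ i ∈ Finset.range k, μ.rowLen i ≤ ∑ i ∈ Finset.range k, μ'.rowLen i := by
    intro k hk
    rw [sum_content_eq T hc (e := μ.rowLen) (fun _ => rfl) k hk, sum_rowLen_eq]
    refine Finset.card_le_card fun c hc => ?_
    rw [Finset.mem_filter] at hc ⊢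
    exact ⟨hc.1, (SSYT_le_entry T hc.1).trans_lt hc.2⟩
  have htot : ∑ i ∈ Finset.range ℓ, μ.rowLen i = ∑ i ∈ Finset.range ℓ, μ'.rowLen i := by
    rw [sum_content_eq T hc (e := μ.rowLen) (fun _ => rfl) ℓ le_rfl, sum_rowLen_eq]
    congr 1
    refine Finset.filter_congr fun c hc => ?_
    exact iff_of_true (hT c hc) ((SSYT_le_entry T hc).trans_lt (hT c hc))
  have hn : ∑ i ∈ Finset.range ℓ, ((μ.rowLen i : ℤ) + ℓ - 1 - i) ^ 2 =
      ∑ i ∈ Finset.range ℓ, ((μ'.rowLen i : ℤ) + ℓ - 1 - i) ^ 2 := by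
    rw [← sum_expo_sq, ← sum_expo_sq, expo_yd hl, expo_yd hl']
    exact_mod_cast hnorm
  have h1 := abel_nonneg (fun i => (μ.rowLen i : ℤ) + ℓ - 1 - i)
    (fun i => (μ'.rowLen i : ℤ) - μ.rowLen i) (fun i j hij => by
      have := μ.rowLen_anti i j hij
      simp only
      omega) ℓ fun k hk => by
        have := hdom k hk
        rw [Finset.sum_sub_distrib]
        have h : ((∑ i ∈ Finset.range k, μ.rowLen i : ℕ) : ℤ) ≤
          (∑ i ∈ Finset.range k, μ'.rowLen i : ℕ) := by exact_mod_cast this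
        push_cast at h
        linarith
  have h2 : ∑ i ∈ Finset.range ℓ, ((μ'.rowLen i : ℤ) - μ.rowLen i) = 0 := by
    rw [Finset.sum_sub_distrib]
    have h : ((∑ i ∈ Finset.range ℓ, μ.rowLen i : ℕ) : ℤ) =
      (∑ i ∈ Finset.range ℓ, μ'.rowLen i : ℕ) := by exact_mod_cast htot
    push_cast at h
    linarith
  rw [h2, mul_zero] at h1
  have h3 : ∑ i ∈ Finset.range ℓ, ((μ'.rowLen i : ℤ) - μ.rowLen i) ^ 2 ≤ 0 := by
    have : ∑ i ∈ Finset.range ℓ, ((μ'.rowLen i : ℤ) - μ.rowLen i) ^ 2 =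
        ∑ i ∈ Finset.range ℓ, ((μ'.rowLen i : ℤ) + ℓ - 1 - i) ^ 2 -
        ∑ i ∈ Finset.range ℓ, ((μ.rowLen i : ℤ) + ℓ - 1 - i) ^ 2 -
        2 * ∑ i ∈ Finset.range ℓ, ((μ.rowLen i : ℤ) + ℓ - 1 - i) *
          ((μ'.rowLen i : ℤ) - μ.rowLen i) := by
      rw [Finset.mul_sum, ← Finset.sum_sub_distrib, ← Finset.sum_sub_distrib]
      exact Finset.sum_congr rfl fun i _ => by ring
    rw [this, hn]
    linarith
  have h4 := (Finset.sum_eq_zero_iff_of_nonneg fun i _ => sq_nonneg _).1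
    (le_antisymm h3 (Finset.sum_nonneg fun i _ => sq_nonneg _))
  rw [← expo_yd hl, ← expo_yd hl', ← hμ, ← hμ']
  ext j
  have h5 := h4 (ℓ - 1 - j) (Finset.mem_range.2 (by omega))
  have h6 : ((μ'.rowLen (ℓ - 1 - j) : ℤ) - μ.rowLen (ℓ - 1 - j)) = 0 := by simpa using h5
  simp only [expo]
  omega

lemma ssytCount_rowLen_pos (μ : YoungDiagram) (ℓ : ℕ) (h : μ.colLen 0 ≤ ℓ) :
    0 < ssytCount μ ℓ (fun i => μ.rowLen i) := by
  have : Finite {T : SemistandardYoungTableau μ // (∀ c ∈ μ.cells, T c.1 c.2 < ℓ) ∧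
      ∀ v : Fin ℓ, (μ.cells.filter (fun c => T c.1 c.2 = (v : ℕ))).card = μ.rowLen v} :=
    Finite.of_injective (β := BddSSYT μ ℓ) (fun T => ⟨T.1, T.2.1⟩) fun T T' h => by
      have := congr_arg Subtype.val h
      exact Subtype.ext this
  have h1 : ∀ c ∈ μ.cells, SemistandardYoungTableau.highestWeight μ c.1 c.2 = c.1 := by
    intro c hc
    rw [SemistandardYoungTableau.highestWeight_apply]
    exact if_pos hc
  refine Nat.card_pos_iff.2 ⟨⟨SemistandardYoungTableau.highestWeight μ, fun c hc => ?_,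
    fun v => ?_⟩, this⟩
  · rw [h1 c hc]
    have : (c.1, 0) ∈ μ := μ.up_left_mem le_rfl (Nat.zero_le c.2) hc
    exact (YoungDiagram.mem_iff_lt_colLen.1 this).trans_le h
  · change _ = μ.rowLen v
    rw [YoungDiagram.rowLen_eq_card, YoungDiagram.row]
    congr 1
    exact Finset.filter_congr fun c hc => by rw [h1 c hc]

/-- If only exponent vectors of a fixed norm contribute, a symmetric polynomial with nonnegative
coefficients is Schur-positive. -/
lemma schurCoeff_nonneg_of_norm {ℓ : ℕ} {χ : MvPolynomial (Fin ℓ) ℚ} (hχ : IsSymm χ)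
    (hpos : ∀ d : Fin ℓ → ℕ, 0 ≤ coeff (ex d) χ) (N : ℚ)
    (hN : ∀ l, StrictMono l → schurCoeff χ l ≠ 0 → ∑ j, (l j : ℚ) ^ 2 = N)
    {l : Fin ℓ → ℕ} (hl : StrictMono l) : 0 ≤ schurCoeff χ l := by
  by_cases h0 : schurCoeff χ l = 0
  · exact h0.ge
  have h1 := coeff_eq_sum_schurCoeff hχ fun i => (yd ℓ l).rowLen i
  rw [Finset.sum_eq_single l] at h1
  · have h2 := ssytCount_rowLen_pos (yd ℓ l) ℓ (colLen_yd_le l)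
    have h3 := hpos fun i => (yd ℓ l).rowLen i
    rw [h1] at h3
    exact nonneg_of_mul_nonneg_left h3 (by exact_mod_cast h2)
  · intro l' hl' hne
    rw [mem_schurSupport] at hl'
    have : ssytCount (yd ℓ l') ℓ (fun i => (yd ℓ l).rowLen i) = 0 := by
      by_contra hK
      refine hne (yd_eq_of_ssytCount hl hl'.1 ?_ hK)
      have := (hN l hl h0).trans (hN l' hl'.1 hl'.2).symm
      exact_mod_cast this
    rw [this, Nat.cast_zero, mul_zero]
  · intro h
    exact absurd (mem_schurSupport.2 ⟨hl, h0⟩) h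

end CoQuasi

/-! ### The Casimir eigenvalue equation for weight generating functions -/

namespace CoQuasi

open MvPolynomial

/-- The Euler derivation `x_i ∂/∂x_i`. -/
def euler {ℓ : ℕ} (i : Fin ℓ) : Derivation ℚ (MvPolynomial (Fin ℓ) ℚ) (MvPolynomial (Fin ℓ) ℚ) :=
  (X i : MvPolynomial (Fin ℓ) ℚ) • pderiv i

lemma coeff_X_mul_pderiv {κ : Type*} (i : κ) (f : MvPolynomial κ ℚ) (d : κ →₀ ℕ) :
    coeff d (X i * pderiv i f) = d i * coeff d f := by
  induction f using MvPolynomial.monomial_add_induction_on with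
  | C a => simp [coeff_C]; grind
  | monomial_add s c f _ _ ih =>
    rw [map_add, mul_add, coeff_add, ih, coeff_add, mul_add]
    congr 1
    simp only [X_mul_pderiv_monomial, coeff_smul, coeff_monomial]
    split_ifs with h
    · rw [h, nsmul_eq_mul]
    · simp

lemma coeff_euler {ℓ : ℕ} (i : Fin ℓ) (f : MvPolynomial (Fin ℓ) ℚ) (d : Fin ℓ →₀ ℕ) :
    coeff d (euler i f) = d i * coeff d f := coeff_X_mul_pderiv i f d

lemma euler_X {ℓ : ℕ} (i j : Fin ℓ) :
    euler i (X j : MvPolynomial (Fin ℓ) ℚ) = if i = j then X j else 0 := by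
  by_cases h : i = j
  · subst h
    simp [euler]
  · simp [euler, pderiv_X_of_ne (Ne.symm h), h]

lemma derivation_prod {R B : Type*} [CommRing R] [CommRing B] [Algebra R B]
    (D : Derivation R B B) {κ : Type*} [DecidableEq κ] (s : Finset κ) (f : κ → B) :
    D (∏ q ∈ s, f q) = ∑ q ∈ s, (∏ q' ∈ s.erase q, f q') * D (f q) := by
  induction s using Finset.induction_on with
  | empty => simp
  | insert a s ha ih =>
    rw [Finset.prod_insert ha, Derivation.leibniz, ih, Finset.sum_insert ha,
      Finset.erase_insert ha, add_comm, smul_eq_mul, smul_eq_mul, Finset.mul_sum]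
    congr 1
    refine Finset.sum_congr rfl fun q hq => ?_
    have hqa : q ≠ a := fun h => ha (h ▸ hq)
    rw [Finset.erase_insert_of_ne hqa.symm,
      Finset.prod_insert fun h => ha (Finset.mem_of_mem_erase h),
      mul_assoc]

/-- The pairs `i < j`. -/
def ltPairs (ℓ : ℕ) : Finset (Fin ℓ × Fin ℓ) := {q | q.1 < q.2}

lemma sum_ltPairs {ℓ : ℕ} {M : Type*} [AddCommMonoid M] (F : Fin ℓ → Fin ℓ → M) :
    ∑ q ∈ ltPairs ℓ, (F q.1 q.2 + F q.2 q.1) = ∑ i, ∑ j ∈ Finset.univ.erase i, F i j := by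
  have h1 : ∑ q ∈ ltPairs ℓ, F q.2 q.1 = ∑ q : Fin ℓ × Fin ℓ with q.2 < q.1, F q.1 q.2 :=
    Finset.sum_equiv (Equiv.prodComm _ _) (by simp [ltPairs]) (by simp)
  have h2 : ∀ i, ∑ j ∈ Finset.univ.erase i, F i j = ∑ j, if i ≠ j then F i j else 0 := by
    intro i
    rw [← Finset.sum_filter]
    congr 1
    ext j
    simp [eq_comm]
  simp only [h2]
  rw [Finset.sum_add_distrib, h1, ← Fintype.sum_prod_type', ← Finset.sum_filter, ltPairs,
    ← Finset.sum_union]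
  · congr 1
    ext q
    simp
  · rw [Finset.disjoint_filter]
    exact fun q _ h => h.not_gt

lemma alt_staircase_eq_prod (ℓ : ℕ) :
    alt (xv ℓ) ℓ (fun j => j) = ∏ q ∈ ltPairs ℓ, (X q.2 - X q.1) := by
  have : alt (xv ℓ) ℓ (fun j => j) = (Matrix.vandermonde fun i : Fin ℓ => xv ℓ i).det := rfl
  rw [this, Matrix.det_vandermonde, ltPairs, Finset.prod_filter, Fintype.prod_prod_type]
  refine Finset.prod_congr rfl fun i _ => ?_
  rw [← Finset.prod_filter]
  refine Finset.prod_congr (by ext; simp) fun j _ => by rw [xv_val, xv_val]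

lemma coeff_sum_euler_sq {ℓ : ℕ} (f : MvPolynomial (Fin ℓ) ℚ) (d : Fin ℓ →₀ ℕ) :
    coeff d (∑ i, euler i (euler i f)) = (∑ i, (d i : ℚ) ^ 2) * coeff d f := by
  simp only [coeff_sum, coeff_euler, Finset.sum_mul]
  exact Finset.sum_congr rfl fun i _ => by ring

lemma sum_euler_sq_alt (ℓ : ℕ) :
    ∑ i, euler i (euler i (alt (xv ℓ) ℓ (fun j => j))) =
      C (∑ i : Fin ℓ, (i : ℚ) ^ 2) * alt (xv ℓ) ℓ (fun j => j) := by
  ext d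
  rw [coeff_sum_euler_sq, coeff_C_mul]
  by_cases h : coeff d (alt (xv ℓ) ℓ (fun j => j)) = 0
  · rw [h, mul_zero, mul_zero]
  congr 1
  rw [alt_eq_sum, coeff_sum] at h
  obtain ⟨σ, -, hσ⟩ := Finset.exists_ne_zero_of_sum_ne_zero h
  rw [coeff_monomial] at hσ
  split_ifs at hσ with h1
  · rw [← h1]
    exact Equiv.sum_comp σ fun i => (i : ℚ) ^ 2
  · exact absurd rfl hσ

lemma sum_euler_alt_mul {ℓ : ℕ} (χ : MvPolynomial (Fin ℓ) ℚ)
    (T : Fin ℓ → Fin ℓ → MvPolynomial (Fin ℓ) ℚ)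
    (hT : ∀ i j, i ≠ j → (X i - X j) * (T i j + T j i) = (X i + X j) * (euler i χ - euler j χ)) :
    2 * ∑ k, euler k (alt (xv ℓ) ℓ (fun j => j)) * euler k χ = alt (xv ℓ) ℓ (fun j => j) *
      (∑ i, ∑ j ∈ Finset.univ.erase i, T i j + (ℓ - 1) * ∑ i, euler i χ) := by
  have h1 : ∀ q ∈ ltPairs ℓ, ∑ k, euler k (X q.2 - X q.1 : MvPolynomial (Fin ℓ) ℚ) * euler k χ =
      X q.2 * euler q.2 χ - X q.1 * euler q.1 χ := by
    intro q _
    simp [euler_X, sub_mul, Finset.sum_sub_distrib]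
  have h2 : ∑ i, ∑ j ∈ Finset.univ.erase i, T i j + (ℓ - 1) * ∑ i, euler i χ =
      ∑ q ∈ ltPairs ℓ, ((T q.1 q.2 + euler q.1 χ) + (T q.2 q.1 + euler q.2 χ)) := by
    rw [sum_ltPairs fun i j => T i j + euler i χ, Finset.mul_sum, ← Finset.sum_add_distrib]
    refine Finset.sum_congr rfl fun i _ => ?_
    have : 1 ≤ ℓ := i.pos
    simp [Finset.sum_add_distrib, Finset.card_erase_of_mem, Nat.cast_sub this]
  rw [h2, alt_staircase_eq_prod]
  simp only [derivation_prod, Finset.sum_mul]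
  rw [Finset.sum_comm, Finset.mul_sum, Finset.mul_sum]
  refine Finset.sum_congr rfl fun q hq => ?_
  simp only [mul_assoc]
  rw [← Finset.mul_sum, h1 q hq, ← Finset.mul_prod_erase _ _ hq]
  have := hT q.2 q.1 (Finset.mem_filter.1 hq).2.ne'
  linear_combination (∏ q' ∈ (ltPairs ℓ).erase q, (X q'.2 - X q'.1)) * -this

lemma sum_sq_eq_of_casimir {ℓ : ℕ} (χ : MvPolynomial (Fin ℓ) ℚ)
    (T : Fin ℓ → Fin ℓ → MvPolynomial (Fin ℓ) ℚ)
    (hT : ∀ i j, i ≠ j → (X i - X j) * (T i j + T j i) = (X i + X j) * (euler i χ - euler j χ))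
    {m c : ℚ} (hm : ∑ i, euler i χ = C m * χ)
    (hc : ∑ i, ∑ j ∈ Finset.univ.erase i, T i j + ∑ i, euler i (euler i χ) = C c * χ)
    {l : Fin ℓ → ℕ} (hl : schurCoeff χ l ≠ 0) :
    ∑ j, (l j : ℚ) ^ 2 = ∑ i : Fin ℓ, (i : ℚ) ^ 2 + c + (ℓ - 1) * m := by
  have h1 := sum_euler_alt_mul χ T hT
  have h2 := sum_euler_sq_alt ℓ
  have h3 := coeff_sum_euler_sq (alt (xv ℓ) ℓ (fun j => j) * χ) (ex l)
  set a := alt (xv ℓ) ℓ (fun j => j)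
  have h4 : ∑ i, euler i (euler i (a * χ)) =
      C (∑ i : Fin ℓ, (i : ℚ) ^ 2 + c + (ℓ - 1) * m) * (a * χ) := by
    have : ∀ i, euler i (euler i (a * χ)) = euler i (euler i a) * χ +
        2 * (euler i a * euler i χ) + a * euler i (euler i χ) := by
      intro i
      simp only [Derivation.leibniz, map_add, smul_eq_mul]
      ring
    simp only [this, Finset.sum_add_distrib, ← Finset.mul_sum, ← Finset.sum_mul]
    rw [h1, h2, hm]
    simp only [map_add, map_mul, map_sub, map_natCast, map_one]
    linear_combination a * hc
  rw [h4, coeff_C_mul] at h3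
  exact (mul_right_cancel₀ hl h3).symm

end CoQuasi

/-! ### Positivity of characters -/

namespace CoQuasi

open MvPolynomial

/-- Elements `e i j` of an algebra satisfying the relations of the matrix units of `gl_ℓ` with
semisimple weight projections `p d`, permuted by units `τ σ`, and with central Casimir element. -/
structure WeightData (ℓ : ℕ) (A : Type*) [Ring A] [Algebra ℚ A] where
  /-- the matrix units -/
  e : Fin ℓ → Fin ℓ → A
  /-- the weight projections -/
  p : (Fin ℓ → ℕ) → A
  /-- the permutations -/
  τ : Equiv.Perm (Fin ℓ) → Aˣ
  e_comm : ∀ i j, e i j * e j i - e j i * e i j = e i i - e j j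
  e_diag : ∀ i (d : Fin ℓ → ℕ), e i i * p d = (d i : ℚ) • p d
  p_mul : ∀ d d' : Fin ℓ → ℕ, p d * p d' = if d = d' then p d else 0
  e_p : ∀ i j (d : Fin ℓ → ℕ), i ≠ j → e i j * p (d + Pi.single j 1) = p (d + Pi.single i 1) * e i j
  e_p_zero : ∀ i j (d : Fin ℓ → ℕ), i ≠ j → d j = 0 → e i j * p d = 0
  casimir_comm : ∀ a, (∑ i, ∑ j, e i j * e j i) * a = a * ∑ i, ∑ j, e i j * e j i
  τ_p : ∀ σ (d : Fin ℓ → ℕ), (τ σ : A) * p d = p (d ∘ σ.symm) * τ σ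

/-- The polynomial with coefficients `g d` in degree `m`. -/
def gen {ℓ : ℕ} (m : ℕ) (g : (Fin ℓ → ℕ) → ℚ) : MvPolynomial (Fin ℓ) ℚ :=
  ∑ d ∈ Finset.piAntidiag Finset.univ m, monomial (ex d) (g d)

lemma coeff_gen {ℓ : ℕ} {m : ℕ} {g : (Fin ℓ → ℕ) → ℚ} (hg : ∀ d, ∑ i, d i ≠ m → g d = 0)
    (d : Fin ℓ → ℕ) : coeff (ex d) (gen m g) = g d := by
  simp only [gen, coeff_sum, coeff_monomial, ex_injective.eq_iff]
  rw [Finset.sum_ite_eq']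
  split_ifs with h
  · rfl
  · exact (hg d fun h' => h (by simpa using h')).symm

lemma exists_ex {ℓ : ℕ} (d : Fin ℓ →₀ ℕ) : ∃ e : Fin ℓ → ℕ, d = ex e :=
  ⟨d, (Finsupp.equivFunOnFinite.symm_apply_apply d).symm⟩

lemma coeff_X_mul_ex {ℓ : ℕ} (i : Fin ℓ) (d : Fin ℓ → ℕ) (f : MvPolynomial (Fin ℓ) ℚ) :
    coeff (ex (d + Pi.single i 1)) (X i * f) = coeff (ex d) f := by
  rw [← coeff_X_mul (ex d) i f]
  congr 1
  ext j
  simp [Pi.single_apply, Finsupp.single_apply, add_comm, eq_comm]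

lemma coeff_X_mul_ex_of_eq_zero {ℓ : ℕ} (i : Fin ℓ) (d : Fin ℓ → ℕ) (hd : d i = 0)
    (f : MvPolynomial (Fin ℓ) ℚ) : coeff (ex d) (X i * f) = 0 := by
  rw [coeff_X_mul', if_neg]
  simp [hd]

lemma exists_add_single {ℓ : ℕ} {d : Fin ℓ → ℕ} {i : Fin ℓ} (h : d i ≠ 0) :
    ∃ d' : Fin ℓ → ℕ, d = d' + Pi.single i 1 := by
  refine ⟨d - Pi.single i 1, (tsub_add_cancel_of_le ?_).symm⟩
  intro j
  by_cases hj : j = i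
  · subst hj
    simpa using Nat.one_le_iff_ne_zero.2 h
  · simp [hj]

namespace WeightData

variable {ℓ : ℕ} {A : Type*} [Ring A] [Algebra ℚ A] (D : WeightData ℓ A)
  (W : Type*) [AddCommGroup W] [Module ℚ W] [Module A W] [IsScalarTower ℚ A W]

/-- The Casimir element. -/
def casimir : A := ∑ i, ∑ j, D.e i j * D.e j i

/-- The `d`-weight space. -/
def wtSpace (d : Fin ℓ → ℕ) : Submodule ℚ W := LinearMap.range (Algebra.lsmul ℚ ℚ W (D.p d))

/-- The weight multiplicity. -/
def mult (d : Fin ℓ → ℕ) : ℕ := Module.finrank ℚ (D.wtSpace W d)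

/-- The degree-`m` weight generating function. -/
def char (m : ℕ) : MvPolynomial (Fin ℓ) ℚ := gen m fun d => D.mult W d

/-- `W` has only weights of degree `m`. -/
def HasDegree (m : ℕ) : Prop := ∀ d, ∑ i, d i ≠ m → ∀ w : W, D.p d • w = 0

/-- The trace of an element of the algebra on `W`. -/
def tr (a : A) : ℚ := LinearMap.trace ℚ W (Algebra.lsmul ℚ ℚ W a)

variable {W}

lemma mem_wtSpace {d : Fin ℓ → ℕ} {w : W} : w ∈ D.wtSpace W d ↔ D.p d • w = w := by
  constructor
  · rintro ⟨v, rfl⟩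
    simp [smul_smul, D.p_mul]
  · exact fun h => ⟨w, h⟩

variable (W)

lemma tr_mul_comm (a b : A) : tr W (a * b) = tr W (b * a) := by
  simp only [tr, map_mul]
  exact LinearMap.trace_mul_comm _ _ _

lemma tr_add (a b : A) : tr W (a + b) = tr W a + tr W b := by simp [tr]

lemma tr_sub (a b : A) : tr W (a - b) = tr W a - tr W b := by simp [tr]

lemma tr_smul (c : ℚ) (a : A) : tr W (c • a) = c * tr W a := by simp [tr]

lemma tr_zero : tr W (0 : A) = 0 := by simp [tr]

lemma tr_sum {κ : Type*} (s : Finset κ) (f : κ → A) :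
    tr W (∑ i ∈ s, f i) = ∑ i ∈ s, tr W (f i) := by
  simp [tr]

lemma tr_eq_zero_of_mul_p {m : ℕ} (hW : D.HasDegree W m) {d : Fin ℓ → ℕ} (hd : ∑ i, d i ≠ m)
    (a : A) : tr W (a * D.p d) = 0 := by
  have : Algebra.lsmul ℚ ℚ W (D.p d) = 0 := by
    ext w
    exact hW d hd w
  simp [tr, this]

lemma tr_p [Module.Finite ℚ W] (d : Fin ℓ → ℕ) : tr W (D.p d) = D.mult W d :=
  LinearMap.IsProj.trace ⟨fun w => ⟨w, rfl⟩, fun _ hw => D.mem_wtSpace.1 hw⟩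

lemma mult_eq_zero {m : ℕ} (hW : D.HasDegree W m) {d : Fin ℓ → ℕ} (hd : ∑ i, d i ≠ m) :
    D.mult W d = 0 := by
  have : Algebra.lsmul ℚ ℚ W (D.p d) = 0 := by
    ext w
    exact hW d hd w
  rw [mult, wtSpace, this, LinearMap.range_zero, finrank_bot]

lemma coeff_char {m : ℕ} (hW : D.HasDegree W m) (d : Fin ℓ → ℕ) :
    coeff (ex d) (D.char W m) = D.mult W d :=
  coeff_gen (fun d hd => by simp [D.mult_eq_zero W hW hd]) d

lemma isSymm_char [Module.Finite ℚ W] {m : ℕ} (hW : D.HasDegree W m) : IsSymm (D.char W m) := by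
  intro σ
  ext d
  obtain ⟨d, rfl⟩ := exists_ex d
  rw [coeff_rename_perm, D.coeff_char W hW, D.coeff_char W hW, ← D.tr_p, ← D.tr_p]
  have h1 := D.τ_p σ (d ∘ σ)
  rw [show (d ∘ σ) ∘ σ.symm = d by ext; simp] at h1
  rw [← one_mul (D.p (d ∘ σ)), ← (D.τ σ).inv_mul, mul_assoc, h1, tr_mul_comm, mul_assoc,
    (D.τ σ).mul_inv, mul_one]

lemma X_mul_gen_tr {m : ℕ} (hW : D.HasDegree W m) {i j : Fin ℓ} (hij : i ≠ j) :
    X j * gen m (fun d => tr W (D.e i j * D.e j i * D.p d)) =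
      X i * gen m (fun d => tr W (D.e j i * D.e i j * D.p d)) := by
  have h0 : ∀ i j d, i ≠ j → d i = 0 → tr W (D.e i j * D.e j i * D.p d) = 0 := by
    intro i j d hij hd
    rw [mul_assoc, D.e_p_zero j i d hij.symm hd, mul_zero, tr_zero]
  have hc : ∀ i j d, coeff (ex d) (gen m (fun d => tr W (D.e i j * D.e j i * D.p d))) =
      tr W (D.e i j * D.e j i * D.p d) := fun i j d =>
    coeff_gen (fun d hd => D.tr_eq_zero_of_mul_p W hW hd _) d
  have h1 : ∀ i j d, i ≠ j → d j = 0 →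
      coeff (ex d) (X i * gen m (fun d => tr W (D.e j i * D.e i j * D.p d))) = 0 := by
    intro i j d hij hd
    by_cases hi : d i = 0
    · exact coeff_X_mul_ex_of_eq_zero i d hi _
    · obtain ⟨d, rfl⟩ := exists_add_single hi
      rw [coeff_X_mul_ex, hc, h0 _ _ _ hij.symm]
      simpa [hij.symm] using hd
  ext d
  obtain ⟨d, rfl⟩ := exists_ex d
  by_cases hi : d i = 0
  · rw [h1 j i d hij.symm hi, coeff_X_mul_ex_of_eq_zero i d hi]
  by_cases hj : d j = 0
  · rw [h1 i j d hij hj, coeff_X_mul_ex_of_eq_zero j d hj]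
  obtain ⟨d, rfl⟩ := exists_add_single hi
  obtain ⟨d, rfl⟩ := exists_add_single (d := d) (i := j) (by simpa [hij.symm] using hj)
  rw [coeff_X_mul_ex, add_right_comm, coeff_X_mul_ex, hc, hc, mul_assoc, D.e_p j i d hij.symm,
    ← mul_assoc, tr_mul_comm, ← mul_assoc]

lemma casimir_mul_p (d : Fin ℓ → ℕ) : D.casimir * D.p d =
    ∑ i, ∑ j ∈ Finset.univ.erase i, D.e i j * D.e j i * D.p d +
      (∑ i, (d i : ℚ) ^ 2) • D.p d := by
  rw [casimir, Finset.sum_mul, Finset.sum_smul, ← Finset.sum_add_distrib]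
  refine Finset.sum_congr rfl fun i _ => ?_
  rw [Finset.sum_mul, ← Finset.sum_erase_add _ _ (Finset.mem_univ i), mul_assoc (D.e i i), D.e_diag,
    mul_smul_comm, D.e_diag, smul_smul, sq]

lemma schurCoeff_char_nonneg_of_casimir [Module.Finite ℚ W] {m : ℕ} (hW : D.HasDegree W m) {c : ℚ}
    (hc : ∀ w : W, D.casimir • w = c • w) {l : Fin ℓ → ℕ} (hl : StrictMono l) :
    0 ≤ schurCoeff (D.char W m) l := by
  have hg : ∀ i j d, coeff (ex d) (gen m (fun d => tr W (D.e i j * D.e j i * D.p d))) =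
      tr W (D.e i j * D.e j i * D.p d) := fun i j d =>
    coeff_gen (fun d hd => D.tr_eq_zero_of_mul_p W hW hd _) d
  refine schurCoeff_nonneg_of_norm (D.isSymm_char W hW)
    (fun d => by rw [D.coeff_char W hW]; positivity)
    (∑ i : Fin ℓ, (i : ℚ) ^ 2 + c + (ℓ - 1) * m) (fun l _ h => ?_) hl
  refine sum_sq_eq_of_casimir (D.char W m)
    (fun i j => gen m (fun d => tr W (D.e i j * D.e j i * D.p d))) ?_ (m := m) (c := c) ?_ ?_ h
  · intro i j hij
    have h1 := D.X_mul_gen_tr W hW hij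
    have h2 : gen m (fun d => tr W (D.e i j * D.e j i * D.p d)) -
        gen m (fun d => tr W (D.e j i * D.e i j * D.p d)) =
        euler i (D.char W m) - euler j (D.char W m) := by
      ext d
      obtain ⟨d, rfl⟩ := exists_ex d
      rw [coeff_sub, coeff_sub, hg, hg, coeff_euler, coeff_euler, D.coeff_char W hW, ← tr_sub,
        ← sub_mul, D.e_comm, sub_mul, D.e_diag, D.e_diag, tr_sub, tr_smul, tr_smul, D.tr_p]
      rfl
    rw [← h2]
    linear_combination (-2) * h1
  · ext d
    obtain ⟨d, rfl⟩ := exists_ex d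
    simp only [coeff_sum, coeff_euler, coeff_C_mul, ← Finset.sum_mul, D.coeff_char W hW]
    by_cases hd : ∑ i, d i = m
    · congr 1
      rw [← hd]
      simp
    · simp [D.mult_eq_zero W hW hd]
  · ext d
    obtain ⟨d, rfl⟩ := exists_ex d
    rw [coeff_add, coeff_sum_euler_sq, coeff_C_mul, D.coeff_char W hW, ← D.tr_p]
    simp only [coeff_sum, hg]
    have h3 : D.casimir * D.p d = (∑ i, ∑ j ∈ Finset.univ.erase i, D.e i j * D.e j i * D.p d +
      (∑ i, (d i : ℚ) ^ 2) • D.p d) := D.casimir_mul_p d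
    have h4 : tr W (D.casimir * D.p d) = c * tr W (D.p d) := by
      rw [← tr_smul]
      unfold tr
      congr 1
      ext w
      simp [hc]
    rw [← h4, h3, tr_add, tr_smul, tr_sum]
    simp only [tr_sum]
    rfl

end WeightData

end CoQuasi

namespace CoQuasi

open MvPolynomial

lemma schurCoeff_add {ℓ : ℕ} (f g : MvPolynomial (Fin ℓ) ℚ) (l : Fin ℓ → ℕ) :
    schurCoeff (f + g) l = schurCoeff f l + schurCoeff g l := by
  simp [schurCoeff, mul_add]

lemma finrank_map_add_finrank_inf_ker {K V V' : Type*} [Field K] [AddCommGroup V] [Module K V]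
    [AddCommGroup V'] [Module K V'] (f : V →ₗ[K] V') (P : Submodule K V) [Module.Finite K P] :
    Module.finrank K (P.map f) + Module.finrank K ↥(P ⊓ LinearMap.ker f) = Module.finrank K P := by
  have h := (f.domRestrict P).finrank_range_add_finrank_ker
  rwa [LinearMap.range_domRestrict, LinearMap.ker_domRestrict,
    ← Submodule.finrank_map_subtype_eq, Submodule.map_comap_subtype] at h

namespace WeightData

variable {ℓ : ℕ} {A : Type*} [Ring A] [Algebra ℚ A] (D : WeightData ℓ A)

section Submodule

variable {W : Type*} [AddCommGroup W] [Module A W] (N : Submodule A W)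

lemma hasDegree_submodule {m : ℕ} (hW : D.HasDegree W m) : D.HasDegree N m :=
  fun d hd w => Subtype.ext (hW d hd w)

lemma hasDegree_quotient {m : ℕ} (hW : D.HasDegree W m) : D.HasDegree (W ⧸ N) m := by
  intro d hd w
  obtain ⟨w, rfl⟩ := N.mkQ_surjective w
  rw [← map_smul, hW d hd, map_zero]

variable [Module ℚ W] [IsScalarTower ℚ A W]

lemma mult_submodule (d : Fin ℓ → ℕ) :
    D.mult N d = Module.finrank ℚ ↥(D.wtSpace W d ⊓ N.restrictScalars ℚ) := by
  have : D.wtSpace W d ⊓ N.restrictScalars ℚ =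
      (D.wtSpace N d).map (N.subtype.restrictScalars ℚ) := by
    ext w
    simp only [Submodule.mem_inf, Submodule.mem_map, mem_wtSpace]
    constructor
    · rintro ⟨h1, h2⟩
      exact ⟨⟨w, h2⟩, Subtype.ext h1, rfl⟩
    · rintro ⟨v, h, rfl⟩
      exact ⟨congr_arg Subtype.val h, v.2⟩
  rw [this, mult]
  exact (Submodule.equivMapOfInjective (N.subtype.restrictScalars ℚ)
    Subtype.val_injective _).finrank_eq

lemma mult_add [Module.Finite ℚ W] (d : Fin ℓ → ℕ) :
    D.mult N d + D.mult (W ⧸ N) d = D.mult W d := by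
  have h1 := finrank_map_add_finrank_inf_ker (N.mkQ.restrictScalars ℚ) (D.wtSpace W d)
  have h2 : (D.wtSpace W d).map (N.mkQ.restrictScalars ℚ) = D.wtSpace (W ⧸ N) d := by
    ext w
    simp only [Submodule.mem_map, mem_wtSpace]
    constructor
    · rintro ⟨v, h, rfl⟩
      change D.p d • N.mkQ v = N.mkQ v
      rw [← map_smul, h]
    · intro h
      obtain ⟨v, rfl⟩ := N.mkQ_surjective w
      refine ⟨D.p d • v, ?_, ?_⟩
      · simp [smul_smul, D.p_mul]
      · change N.mkQ (D.p d • v) = N.mkQ v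
        rw [map_smul, h]
  rw [h2, show LinearMap.ker (N.mkQ.restrictScalars ℚ) = N.restrictScalars ℚ by ext; simp] at h1
  rw [mult_submodule, add_comm]
  exact h1

lemma char_add [Module.Finite ℚ W] {m : ℕ} (hW : D.HasDegree W m) :
    D.char W m = D.char N m + D.char (W ⧸ N) m := by
  ext d
  obtain ⟨d, rfl⟩ := exists_ex d
  rw [coeff_add, D.coeff_char W hW, D.coeff_char _ (D.hasDegree_submodule N hW),
    D.coeff_char _ (D.hasDegree_quotient N hW), ← D.mult_add N]
  simp

end Submodule

lemma exists_casimir_eigenvector {W : Type*} [AddCommGroup W] [Module ℚ W] [Module A W]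
    [IsScalarTower ℚ A W] {m : ℕ} (hW : D.HasDegree W m) (h : ∃ d, D.wtSpace W d ≠ ⊥) :
    ∃ w : W, w ≠ 0 ∧ ∃ c : ℚ, D.casimir • w = c • w := by
  obtain ⟨d₀, hd₀⟩ := h
  have hdeg : ∀ d, D.wtSpace W d ≠ ⊥ → ∑ i, d i = m := by
    intro d hd
    by_contra hne
    obtain ⟨w, hw, hw0⟩ := Submodule.exists_mem_ne_zero_of_ne_bot hd
    exact hw0 ((D.mem_wtSpace.1 hw).symm.trans (hW d hne w))
  obtain ⟨d, hd, hmax⟩ := Finset.exists_max_image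
    {d ∈ Finset.piAntidiag (Finset.univ : Finset (Fin ℓ)) m | D.wtSpace W d ≠ ⊥}
    (fun d => ∑ i : Fin ℓ, (ℓ - (i : ℕ)) * d i)
    ⟨d₀, by simp [hdeg d₀ hd₀, hd₀]⟩
  simp only [Finset.mem_filter] at hd hmax
  obtain ⟨w, hw, hw0⟩ := Submodule.exists_mem_ne_zero_of_ne_bot hd.2
  rw [mem_wtSpace] at hw
  have hdiag : ∀ i, D.e i i • w = (d i : ℚ) • w := by
    intro i
    conv_lhs => rw [← hw, smul_smul, D.e_diag, smul_assoc, hw]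
  have hraise : ∀ i j, i < j → D.e i j • w = 0 := by
    intro i j hij
    rw [← hw, smul_smul]
    by_cases hj : d j = 0
    · rw [D.e_p_zero i j d hij.ne hj, zero_smul]
    obtain ⟨d, rfl⟩ := exists_add_single hj
    rw [D.e_p i j d hij.ne, mul_smul]
    have h0 : D.wtSpace W (d + Pi.single i 1) = ⊥ := by
      by_contra hne
      have := hmax _ ⟨by simpa using hdeg _ hne, hne⟩
      simp only [Pi.add_apply, mul_add, Finset.sum_add_distrib, Pi.single_apply, mul_ite, mul_one,
        mul_zero, Finset.sum_ite_eq', Finset.mem_univ, if_true] at this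
      have := Fin.lt_def.1 hij
      omega
    exact (Submodule.mem_bot ℚ).1 (h0 ▸ ⟨D.e i j • w, rfl⟩)
  have hterm : ∀ i j, ∃ c : ℚ, (D.e i j * D.e j i) • w = c • w := by
    intro i j
    rcases lt_trichotomy i j with hij | rfl | hij
    · refine ⟨d i - d j, ?_⟩
      rw [← sub_add_cancel (D.e i j * D.e j i) (D.e j i * D.e i j), D.e_comm, add_smul, sub_smul,
        mul_smul, hraise i j hij, smul_zero, add_zero, hdiag, hdiag, sub_smul]
    · exact ⟨d i * d i, by rw [mul_smul, hdiag, smul_comm, hdiag, mul_smul]⟩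
    · exact ⟨0, by rw [mul_smul, hraise j i hij, smul_zero, zero_smul]⟩
  choose c hc using hterm
  refine ⟨w, hw0, ∑ i, ∑ j, c i j, ?_⟩
  simp only [casimir, Finset.sum_smul, hc]

theorem schurCoeff_char_nonneg {m : ℕ} {l : Fin ℓ → ℕ} (hl : StrictMono l) (k : ℕ) :
    ∀ (W : Type*) [AddCommGroup W] [Module ℚ W] [Module A W] [IsScalarTower ℚ A W]
      [Module.Finite ℚ W], D.HasDegree W m → Module.finrank ℚ W = k →
      0 ≤ schurCoeff (D.char W m) l := by
  induction k using Nat.strong_induction_on with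
  | _ k ih =>
  intro W _ _ _ _ _ hW hk
  by_cases h : ∃ d, D.wtSpace W d ≠ ⊥
  · obtain ⟨w, hw0, c, hw⟩ := D.exists_casimir_eigenvector hW h
    let N : Submodule A W :=
      { carrier := {v | D.casimir • v = c • v}
        add_mem' := fun {a b} ha hb => by
          simp only [Set.mem_ofPred_eq] at *
          rw [smul_add, smul_add, ha, hb]
        zero_mem' := by simp
        smul_mem' := fun a v hv => by
          simp only [Set.mem_ofPred_eq] at *
          rw [smul_smul, casimir, D.casimir_comm, mul_smul]
          change a • D.casimir • v = _
          rw [hv, smul_comm] }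
    have hN : ∀ v : N, D.casimir • v = c • v := fun v => Subtype.ext v.2
    have : Module.Finite ℚ N := inferInstanceAs (Module.Finite ℚ (N.restrictScalars ℚ))
    have hQ : Module.finrank ℚ (W ⧸ N) < k := by
      have h1 := Submodule.finrank_quotient_add_finrank (N.restrictScalars ℚ)
      have h2 : 0 < Module.finrank ℚ (N.restrictScalars ℚ) :=
        Module.finrank_pos_iff_exists_ne_zero.2 ⟨⟨w, hw⟩, fun h => hw0 (congr_arg Subtype.val h)⟩
      have h3 : Module.finrank ℚ (W ⧸ N) = Module.finrank ℚ (W ⧸ N.restrictScalars ℚ) := rfl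
      omega
    rw [D.char_add N hW, schurCoeff_add]
    exact add_nonneg
      (D.schurCoeff_char_nonneg_of_casimir N (D.hasDegree_submodule N hW) hN hl)
      (ih _ hQ (W ⧸ N) (D.hasDegree_quotient N hW) rfl)
  · push Not at h
    have : D.char W m = 0 := by
      ext d
      obtain ⟨d, rfl⟩ := exists_ex d
      rw [D.coeff_char W hW, mult, h, finrank_bot]
      simp
    rw [this]
    simp [schurCoeff]

end WeightData

end CoQuasi

/-! ### The polarization operators on the polynomial ring -/

namespace CoQuasi

open MvPolynomial

variable {ℓ n : ℕ}

/-- The multidegrees of the variables. -/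
abbrev rowWt (ℓ n : ℕ) : Fin ℓ × Fin n → Fin ℓ → ℕ := fun q => Pi.single q.1 1

lemma weight_rowWt (s : Fin ℓ × Fin n →₀ ℕ) (k : Fin ℓ) :
    Finsupp.weight (rowWt ℓ n) s k = ∑ b, s (k, b) := by
  rw [Finsupp.weight_apply, Finsupp.sum_fintype _ _ (by simp), Finset.sum_apply,
    Fintype.sum_prod_type]
  simp only [Pi.smul_apply, rowWt, Pi.single_apply, smul_eq_mul, mul_ite, mul_one, mul_zero]
  rw [Finset.sum_comm]
  simp

/-- The polarization operator `∑_b x_{ib} ∂/∂x_{jb}`. -/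
def pol (i j : Fin ℓ) : Derivation ℚ (PolyR ℓ n) (PolyR ℓ n) :=
  ∑ b, (X (i, b) : PolyR ℓ n) • pderiv (j, b)

lemma pol_apply (i j : Fin ℓ) (f : PolyR ℓ n) :
    pol i j f = ∑ b, X (i, b) * pderiv (j, b) f := by
  rw [pol, ← Derivation.coeFnAddMonoidHom_apply, map_sum, Finset.sum_apply]
  rfl

lemma pol_X (i j a : Fin ℓ) (b : Fin n) :
    pol i j (X (a, b)) = if a = j then X (i, b) else 0 := by
  rw [pol_apply]
  split_ifs with h
  · subst h
    rw [Finset.sum_eq_single b]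
    · simp
    · intro c _ hc
      rw [pderiv_X_of_ne (by simpa using hc.symm), mul_zero]
    · simp
  · refine Finset.sum_eq_zero fun c _ => ?_
    rw [pderiv_X_of_ne (by simp [h]), mul_zero]

lemma coeff_pol_self (i : Fin ℓ) (f : PolyR ℓ n) (s : Fin ℓ × Fin n →₀ ℕ) :
    coeff s (pol i i f) = Finsupp.weight (rowWt ℓ n) s i * coeff s f := by
  rw [pol_apply, coeff_sum, weight_rowWt, Nat.cast_sum, Finset.sum_mul]
  exact Finset.sum_congr rfl fun b _ => coeff_X_mul_pderiv _ _ _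

lemma pol_lie (i j k l : Fin ℓ) (f : PolyR ℓ n) :
    pol i j (pol k l f) - pol k l (pol i j f) =
      (if j = k then pol i l f else 0) - if l = i then pol k j f else 0 := by
  have : ⁅(pol i j : Derivation ℚ (PolyR ℓ n) (PolyR ℓ n)),
      (pol k l : Derivation ℚ (PolyR ℓ n) (PolyR ℓ n))⁆ =
      (if j = k then pol i l else 0) - if l = i then pol k j else 0 := by
    refine MvPolynomial.derivation_ext fun q => ?_
    obtain ⟨a, b⟩ := q
    have hite : ∀ (P : Prop) [Decidable P] (D : Derivation ℚ (PolyR ℓ n) (PolyR ℓ n))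
        (f : PolyR ℓ n),
        (if P then D else 0) f = if P then D f else 0 := by
      intro P _ D f
      split_ifs <;> rfl
    rw [Derivation.commutator_apply, Derivation.sub_apply, hite, hite]
    simp only [pol_X, apply_ite (pol _ _), map_zero]
    grind
  have h := congr_arg (fun D => D f) this
  simp only [Derivation.commutator_apply, Derivation.sub_apply] at h
  rw [h]
  split_ifs <;> rfl

/-- The projection to a multidegree. -/
abbrev proj (d : Fin ℓ → ℕ) : PolyR ℓ n →ₗ[ℚ] PolyR ℓ n :=
  weightedHomogeneousComponent (rowWt ℓ n) d

lemma coeff_proj (d : Fin ℓ → ℕ) (f : PolyR ℓ n) (s : Fin ℓ × Fin n →₀ ℕ) :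
    coeff s (proj d f) = if Finsupp.weight (rowWt ℓ n) s = d then coeff s f else 0 :=
  coeff_weightedHomogeneousComponent _ _ _

lemma weight_eq_of_pol_eq {f : PolyR ℓ n} {i : Fin ℓ} {c : ℚ} (h : pol i i f = c • f)
    {s : Fin ℓ × Fin n →₀ ℕ} (hs : coeff s f ≠ 0) : (Finsupp.weight (rowWt ℓ n) s i : ℚ) = c := by
  have := congr_arg (coeff s) h
  rw [coeff_pol_self, coeff_smul, smul_eq_mul] at this
  exact mul_right_cancel₀ hs this

lemma proj_of_pol_eq {f : PolyR ℓ n} {c : Fin ℓ → ℚ} (h : ∀ i, pol i i f = c i • f)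
    (d : Fin ℓ → ℕ) : proj d f = if ∀ i, c i = d i then f else 0 := by
  ext s
  rw [coeff_proj]
  by_cases hs : coeff s f = 0
  · split_ifs <;> simp [hs]
  · have h1 : (Finsupp.weight (rowWt ℓ n) s = d) ↔ ∀ i, c i = d i := by
      rw [funext_iff]
      refine forall_congr' fun i => ?_
      rw [← weight_eq_of_pol_eq (h i) hs, Nat.cast_inj]
    rw [if_congr h1 rfl rfl]
    split_ifs <;> simp

lemma pol_proj (i : Fin ℓ) (d : Fin ℓ → ℕ) (f : PolyR ℓ n) :
    pol i i (proj d f) = (d i : ℚ) • proj d f := by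
  ext s
  rw [coeff_pol_self, coeff_smul, coeff_proj]
  split_ifs with h
  · rw [h, smul_eq_mul]
  · simp

lemma pol_monomial (i : Fin ℓ) (s : Fin ℓ × Fin n →₀ ℕ) (c : ℚ) :
    pol i i (monomial s c) = (Finsupp.weight (rowWt ℓ n) s i : ℚ) • monomial s c := by
  ext t
  rw [coeff_pol_self, coeff_smul, coeff_monomial]
  split_ifs with h
  · rw [h, smul_eq_mul]
  · simp

/-- A linear operator shifting the eigenvalues of the row degree operators by `x`. -/
lemma proj_comp_of_shift {F : PolyR ℓ n →ₗ[ℚ] PolyR ℓ n} {x : Fin ℓ → ℚ}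
    (hF : ∀ i f, pol i i (F f) = F (pol i i f) + x i • F f) {d d' : Fin ℓ → ℕ}
    (hd : ∀ i, (d i : ℚ) + x i = d' i) : F ∘ₗ proj d = proj d' ∘ₗ F := by
  refine MvPolynomial.linearMap_ext fun s => LinearMap.ext fun c => ?_
  simp only [LinearMap.comp_apply]
  have h1 : ∀ i, pol i i (F (monomial s c)) =
      ((Finsupp.weight (rowWt ℓ n) s i : ℚ) + x i) • F (monomial s c) := by
    intro i
    rw [hF, pol_monomial, map_smul, add_smul]
  rw [proj_of_pol_eq h1, proj_of_pol_eq (c := fun i => (Finsupp.weight (rowWt ℓ n) s i : ℚ))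
    (fun i => pol_monomial i s c)]
  simp only [← hd, add_left_inj]
  split_ifs <;> simp

/-- Permuting the rows of variables. -/
def permRows (σ : Equiv.Perm (Fin ℓ)) : PolyR ℓ n ≃ₐ[ℚ] PolyR ℓ n :=
  renameEquiv ℚ (σ.prodCongr (Equiv.refl (Fin n)))

lemma permRows_X (σ : Equiv.Perm (Fin ℓ)) (i : Fin ℓ) (b : Fin n) :
    permRows σ (X (i, b)) = X (σ i, b) := by simp [permRows]

lemma permRows_pol (σ : Equiv.Perm (Fin ℓ)) (i j : Fin ℓ) (f : PolyR ℓ n) :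
    permRows σ (pol i j f) = pol (σ i) (σ j) (permRows σ f) := by
  induction f using MvPolynomial.induction_on with
  | C a => simp [permRows]
  | add f g hf hg => simp [hf, hg]
  | mul_X f q hf =>
    obtain ⟨a, b⟩ := q
    simp only [Derivation.leibniz, map_add, smul_eq_mul, map_mul, hf, permRows_X, pol_X,
      σ.injective.eq_iff]
    split_ifs <;> simp [permRows_X]

lemma permRows_proj (σ : Equiv.Perm (Fin ℓ)) (d : Fin ℓ → ℕ) (f : PolyR ℓ n) :
    permRows σ (proj d f) = proj (d ∘ σ.symm) (permRows σ f) := by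
  induction f using MvPolynomial.induction_on' with
  | add f g hf hg => simp only [map_add, hf, hg]
  | monomial s c =>
    have h1 : ∀ i, pol i i (permRows σ (monomial s c : PolyR ℓ n)) =
        (Finsupp.weight (rowWt ℓ n) s (σ.symm i) : ℚ) • permRows σ (monomial s c) := by
      intro i
      have := permRows_pol σ (σ.symm i) (σ.symm i) (monomial s c : PolyR ℓ n)
      rw [pol_monomial, map_smul, Equiv.apply_symm_apply] at this
      exact this.symm
    rw [proj_of_pol_eq h1, proj_of_pol_eq (c := fun i => (Finsupp.weight (rowWt ℓ n) s i : ℚ))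
      (fun i => pol_monomial i s c)]
    simp only [Function.comp_apply, ← σ.symm.forall_congr_right (q := fun i =>
      (Finsupp.weight (rowWt ℓ n) s i : ℚ) = d i)]
    split_ifs <;> simp

/-- The total degree operator. -/
def degOp : PolyR ℓ n →ₗ[ℚ] PolyR ℓ n := ∑ i, (pol i i).toLinearMap

lemma degOp_apply (f : PolyR ℓ n) : degOp f = ∑ i, pol i i f := by
  simp [degOp, LinearMap.sum_apply]

/-- The Casimir operator. -/
def casOp : PolyR ℓ n →ₗ[ℚ] PolyR ℓ n :=
  ∑ i, ∑ j, (pol i j).toLinearMap ∘ₗ (pol j i).toLinearMap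

lemma casOp_apply (f : PolyR ℓ n) : casOp f = ∑ i, ∑ j, pol i j (pol j i f) := by
  simp [casOp, LinearMap.sum_apply]

lemma degOp_pol (i j : Fin ℓ) (f : PolyR ℓ n) : degOp (pol i j f) = pol i j (degOp f) := by
  rw [degOp_apply, degOp_apply, map_sum, ← sub_eq_zero, ← Finset.sum_sub_distrib]
  simp only [pol_lie]
  simp

lemma casOp_pol (k l : Fin ℓ) (f : PolyR ℓ n) : casOp (pol k l f) = pol k l (casOp f) := by
  rw [casOp_apply, casOp_apply, map_sum, ← sub_eq_zero, ← Finset.sum_sub_distrib]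
  simp only [map_sum, ← Finset.sum_sub_distrib]
  have h : ∀ i j, pol i j (pol j i (pol k l f)) - pol k l (pol i j (pol j i f)) =
      pol i j (if i = k then pol j l f else 0) - pol i j (if l = j then pol k i f else 0) +
        ((if j = k then pol i l (pol j i f) else 0) -
          if l = i then pol k j (pol j i f) else 0) := by
    intro i j
    rw [← pol_lie i j k l, ← map_sub, ← pol_lie j i k l, map_sub]
    abel
  simp only [h, Finset.sum_add_distrib, Finset.sum_sub_distrib]
  simp only [apply_ite (pol _ _), map_zero]
  simp [Finset.sum_ite_eq, Finset.sum_ite_irrel]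

end CoQuasi

/-! ### Stability of the ideal of quasi-invariants -/

namespace CoQuasi

open MvPolynomial

variable {ℓ n : ℕ}

/-- The monomial `X_b^V`. -/
def colPow (V : Fin ℓ → ℕ) (b : Fin n) : PolyR ℓ n := ∏ i, X (i, b) ^ V i

/-- The monomial quasi-invariant with columns `B`. -/
def quasiMon (n : ℕ) {k : ℕ} (B : Fin k → Fin ℓ → ℕ) : PolyR ℓ n :=
  ∑ s : Fin k → Fin n with StrictMono s, ∏ c, colPow (B c) (s c)

lemma Mlist_ofFn {k : ℕ} (B : Fin k → Fin ℓ → ℕ) : Mlist n (List.ofFn B) = quasiMon n B := by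
  have h : ∀ (A : List (Fin ℓ → ℕ)) (hA : A.length = k),
      (∀ c, A.get (Fin.cast hA.symm c) = B c) → Mlist n A = quasiMon n B := by
    rintro A rfl hB
    simp only [Fin.cast_refl, id_eq] at hB
    simp only [Mlist, quasiMon, colPow, hB]
  exact h _ List.length_ofFn fun c => by simp

lemma quasiMon_mem {r k : ℕ} {B : Fin k → Fin ℓ → ℕ} (hk : k ≠ 0) (hkn : k ≤ n)
    (hB : ∀ c, ∑ i, B c i ≠ 0 ∧ r ∣ ∑ i, B c i) : quasiMon n B ∈ Jdeal r n ℓ := by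
  refine Ideal.subset_span ⟨List.ofFn B, ⟨by simpa using hk, ?_⟩, by simpa using hkn,
    (Mlist_ofFn B).symm⟩
  intro V hV
  obtain ⟨c, rfl⟩ := List.mem_ofFn.1 hV
  exact hB c

lemma Jdeal_eq_span (r n ℓ : ℕ) : Jdeal r n ℓ = Ideal.span {f | ∃ (k : ℕ) (B : Fin k → Fin ℓ → ℕ),
    k ≠ 0 ∧ k ≤ n ∧ (∀ c, ∑ i, B c i ≠ 0 ∧ r ∣ ∑ i, B c i) ∧ f = quasiMon n B} := by
  refine le_antisymm (Ideal.span_mono ?_) (Ideal.span_le.2 ?_)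
  · rintro f ⟨A, ⟨h1, h2⟩, h3, rfl⟩
    refine ⟨A.length, A.get, by simpa using h1, h3, fun c => h2 _ (A.get_mem c), ?_⟩
    rw [← Mlist_ofFn, List.ofFn_get]
  · rintro f ⟨k, B, h1, h2, h3, rfl⟩
    exact quasiMon_mem h1 h2 h3

lemma pol_colPow (i j : Fin ℓ) (V : Fin ℓ → ℕ) (b : Fin n) :
    pol i j (colPow V b) =
      (V j : ℚ) • colPow (V - Pi.single j 1 + Pi.single i 1) b := by
  have h1 : colPow (V - Pi.single j 1 + Pi.single i 1) b =
      colPow (V - Pi.single j 1) b * X (i, b) := by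
    simp only [colPow, Pi.add_apply, pow_add, Finset.prod_mul_distrib]
    congr 1
    rw [Finset.prod_eq_single i]
    · simp
    · intro a _ ha
      simp [ha]
    · simp
  rw [h1, colPow, derivation_prod, Finset.sum_eq_single j, colPow,
    ← Finset.mul_prod_erase _ _ (Finset.mem_univ j), Derivation.leibniz_pow, pol_X, if_pos rfl]
  · have h2 : ∏ a ∈ Finset.univ.erase j,
        (X (a, b) : PolyR ℓ n) ^ (V - Pi.single j 1 : Fin ℓ → ℕ) a =
        ∏ a ∈ Finset.univ.erase j, X (a, b) ^ V a :=
      Finset.prod_congr rfl fun a ha => by simp [Finset.ne_of_mem_erase ha]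
    rw [h2]
    simp only [Pi.sub_apply, Pi.single_eq_same, nsmul_eq_mul, smul_eq_mul, smul_eq_C_mul,
      map_natCast]
    ring
  · intro a _ ha
    rw [Derivation.leibniz_pow, pol_X, if_neg ha]
    simp
  · simp

lemma pol_quasiMon (i j : Fin ℓ) {k : ℕ} (B : Fin k → Fin ℓ → ℕ) :
    pol i j (quasiMon n B) = ∑ c, (B c j : ℚ) •
      quasiMon n (Function.update B c (B c - Pi.single j 1 + Pi.single i 1)) := by
  simp only [quasiMon, map_sum, derivation_prod, pol_colPow]
  simp only [Finset.smul_sum]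
  rw [Finset.sum_comm]
  refine Finset.sum_congr rfl fun c _ => Finset.sum_congr rfl fun s _ => ?_
  rw [mul_smul_comm]
  refine congrArg _ (Eq.trans ?_ (Finset.prod_erase_mul _ _ (Finset.mem_univ c)))
  rw [Function.update_self]
  refine congrArg (· * _) (Finset.prod_congr rfl fun a ha => ?_)
  rw [Function.update_of_ne (Finset.ne_of_mem_erase ha)]

lemma pol_mem_Jdeal {r : ℕ} (i j : Fin ℓ) {f : PolyR ℓ n} (hf : f ∈ Jdeal r n ℓ) :
    pol i j f ∈ Jdeal r n ℓ := by
  rw [Jdeal_eq_span] at hf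
  induction hf using Submodule.span_induction with
  | zero => simp
  | add f g _ _ hf hg => rw [map_add]; exact add_mem hf hg
  | smul a f hf ih =>
    rw [smul_eq_mul, Derivation.leibniz]
    refine add_mem (Ideal.mul_mem_left _ _ ih) (Ideal.mul_mem_right _ _ ?_)
    rwa [Jdeal_eq_span]
  | mem f hf =>
    obtain ⟨k, B, hk, hkn, hB, rfl⟩ := hf
    rw [pol_quasiMon]
    refine Submodule.sum_mem _ fun c _ => ?_
    by_cases hj : B c j = 0
    · simp [hj]
    rw [smul_eq_C_mul]
    refine Ideal.mul_mem_left _ _ (quasiMon_mem hk hkn fun a => ?_)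
    by_cases ha : a = c
    · subst ha
      obtain ⟨V, hV⟩ := exists_add_single hj
      have h1 : ∑ i', (B a - Pi.single j 1 + Pi.single i 1 : Fin ℓ → ℕ) i' = ∑ i', B a i' := by
        rw [hV]
        simp [Finset.sum_add_distrib]
      rw [Function.update_self, h1]
      exact hB a
    · rw [Function.update_of_ne ha]
      exact hB a

lemma permRows_mem_Jdeal {r : ℕ} (σ : Equiv.Perm (Fin ℓ)) {f : PolyR ℓ n} (hf : f ∈ Jdeal r n ℓ) :
    permRows σ f ∈ Jdeal r n ℓ := by
  rw [Jdeal_eq_span] at hf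
  induction hf using Submodule.span_induction with
  | zero => simp
  | add f g _ _ hf hg => rw [map_add]; exact add_mem hf hg
  | smul a f hf ih =>
    rw [smul_eq_mul, map_mul]
    exact Ideal.mul_mem_left _ _ ih
  | mem f hf =>
    obtain ⟨k, B, hk, hkn, hB, rfl⟩ := hf
    have h1 : permRows σ (quasiMon n B) = quasiMon n fun c => B c ∘ σ.symm := by
      simp only [quasiMon, map_sum, map_prod, colPow, map_pow, permRows_X, Function.comp_apply]
      refine Finset.sum_congr rfl fun s _ => Finset.prod_congr rfl fun c _ => ?_
      exact Fintype.prod_equiv σ _ _ fun i => by simp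
    rw [h1]
    refine quasiMon_mem hk hkn fun c => ?_
    have := Equiv.sum_comp σ.symm (B c)
    simp only [Function.comp_apply, this]
    exact hB c

lemma isWeightedHomogeneous_quasiMon {k : ℕ} (B : Fin k → Fin ℓ → ℕ) :
    IsWeightedHomogeneous (rowWt ℓ n) (quasiMon n B) (∑ c, B c) := by
  refine IsWeightedHomogeneous.sum _ _ _ fun s _ => IsWeightedHomogeneous.prod _ _ _ fun c _ => ?_
  have h1 : B c = ∑ i, B c i • rowWt ℓ n (i, s c) := by
    ext i
    simp [Finset.sum_apply, Pi.single_apply]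
  have h2 := IsWeightedHomogeneous.prod Finset.univ (fun i => (X (i, s c) : PolyR ℓ n) ^ B c i) _
    fun i _ => (isWeightedHomogeneous_X ℚ (rowWt ℓ n) (i, s c)).pow (B c i)
  rwa [← h1] at h2

lemma proj_mem_Jdeal {r : ℕ} (d : Fin ℓ → ℕ) {f : PolyR ℓ n} (hf : f ∈ Jdeal r n ℓ) :
    proj d f ∈ Jdeal r n ℓ := by
  let := weightedGradedAlgebra ℚ (rowWt ℓ n)
  refine weightedHomogeneousComponent_mem_of_mem ℚ (rowWt ℓ n) ?_ hf d
  rw [Jdeal_eq_span]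
  refine Ideal.homogeneous_span _ _ ?_
  rintro f ⟨k, B, -, -, -, rfl⟩
  exact ⟨_, isWeightedHomogeneous_quasiMon B⟩

end CoQuasi

/-! ### The characters of the polynomial ring and its quotient -/

namespace CoQuasi

open MvPolynomial

variable {ℓ n : ℕ}

lemma degOp_proj (d : Fin ℓ → ℕ) (f : PolyR ℓ n) : degOp (proj d f) = proj d (degOp f) :=
  LinearMap.congr_fun (proj_comp_of_shift (x := fun _ => 0)
    (fun i f => by rw [degOp_pol, zero_smul, add_zero]) fun _ => add_zero _) f

lemma casOp_proj (d : Fin ℓ → ℕ) (f : PolyR ℓ n) : casOp (proj d f) = proj d (casOp f) :=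
  LinearMap.congr_fun (proj_comp_of_shift (x := fun _ => 0)
    (fun i f => by rw [casOp_pol, zero_smul, add_zero]) fun _ => add_zero _) f

lemma degOp_permRows (σ : Equiv.Perm (Fin ℓ)) (f : PolyR ℓ n) :
    degOp (permRows σ f) = permRows σ (degOp f) := by
  simp only [degOp_apply, map_sum, permRows_pol]
  exact (Equiv.sum_comp σ fun i => pol i i (permRows σ f)).symm

lemma casOp_permRows (σ : Equiv.Perm (Fin ℓ)) (f : PolyR ℓ n) :
    casOp (permRows σ f) = permRows σ (casOp f) := by
  simp only [casOp_apply, map_sum, permRows_pol]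
  rw [← Equiv.sum_comp σ]
  exact Finset.sum_congr rfl fun i _ =>
    (Equiv.sum_comp σ fun j => pol (σ i) j (pol j (σ i) (permRows σ f))).symm

lemma pol_proj_shift (i j : Fin ℓ) (d : Fin ℓ → ℕ) (f : PolyR ℓ n) :
    pol i j (proj (d + Pi.single j 1) f) = proj (d + Pi.single i 1) (pol i j f) := by
  refine LinearMap.congr_fun (proj_comp_of_shift (F := (pol i j).toLinearMap)
    (x := fun k => (if k = i then 1 else 0) - if j = k then 1 else 0) (fun k f => ?_) fun k => ?_) f
  · have := pol_lie k k i j f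
    rw [sub_eq_iff_eq_add'] at this
    simp only [Derivation.coeFn_coe, this, sub_smul, ite_smul,
      one_smul, zero_smul]
    congr 2 <;> split_ifs with h <;> simp [h]
  · simp only [Pi.add_apply, Pi.single_apply, eq_comm (a := k) (b := j)]
    push_cast
    ring

lemma pol_proj_eq_zero (i : Fin ℓ) {j : Fin ℓ} (hij : i ≠ j) {d : Fin ℓ → ℕ} (hd : d j = 0)
    (f : PolyR ℓ n) : pol i j (proj d f) = 0 := by
  have h1 : pol j j (pol i j (proj d f)) = (-1 : ℚ) • pol i j (proj d f) := by
    have := pol_lie j j i j (proj d f)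
    rw [pol_proj, hd] at this
    simpa [hij.symm] using this
  ext s
  by_contra hs
  have := weight_eq_of_pol_eq h1 hs
  have h2 : (0 : ℚ) ≤ Finsupp.weight (rowWt ℓ n) s j := Nat.cast_nonneg _
  linarith

/-- The algebra of operators on the polynomial ring preserving the ideal `J` and commuting with the
degree and Casimir operators. -/
def opAlg (r n ℓ : ℕ) : Subalgebra ℚ (Module.End ℚ (PolyR ℓ n)) where
  carrier := {a | (∀ f, degOp (a f) = a (degOp f)) ∧ (∀ f, casOp (a f) = a (casOp f)) ∧
    ∀ f ∈ Jdeal r n ℓ, a f ∈ Jdeal r n ℓ}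
  mul_mem' := fun ha hb => ⟨fun f => by simp [ha.1, hb.1], fun f => by simp [ha.2.1, hb.2.1],
    fun f hf => ha.2.2 _ (hb.2.2 _ hf)⟩
  add_mem' := fun ha hb => ⟨fun f => by simp [ha.1, hb.1], fun f => by simp [ha.2.1, hb.2.1],
    fun f hf => add_mem (ha.2.2 _ hf) (hb.2.2 _ hf)⟩
  algebraMap_mem' := fun c => ⟨fun f => by simp, fun f => by simp,
    fun f hf => by
      rw [Module.algebraMap_end_apply, smul_eq_C_mul]
      exact Ideal.mul_mem_left _ _ hf⟩

/-- The permutations of rows as elements of `opAlg`. -/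
def permOp (r n : ℕ) {ℓ : ℕ} (σ : Equiv.Perm (Fin ℓ)) : opAlg r n ℓ :=
  ⟨(permRows σ).toLinearMap, degOp_permRows σ, casOp_permRows σ, fun _ => permRows_mem_Jdeal σ⟩

lemma permOp_mul_permOp (r n : ℕ) {σ τ : Equiv.Perm (Fin ℓ)} (h : σ * τ = 1) :
    permOp r n σ * permOp r n τ = 1 := by
  refine Subtype.ext (LinearMap.ext fun f => ?_)
  have h1 : ∀ i, σ (τ i) = i := Equiv.ext_iff.1 h
  change permRows σ (permRows τ f) = f
  have : (permRows (n := n) σ).toAlgHom.comp (permRows τ).toAlgHom =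
      AlgHom.id ℚ _ := by
    ext q
    obtain ⟨a, b⟩ := q
    simp [permRows_X, h1]
  exact DFunLike.congr_fun this f

/-- The action of `gl_ℓ` on the polynomial ring by polarization operators. -/
def polData (r n ℓ : ℕ) : WeightData ℓ (opAlg r n ℓ) where
  e i j := ⟨(pol i j).toLinearMap, degOp_pol i j, casOp_pol i j, fun _ => pol_mem_Jdeal i j⟩
  p d := ⟨proj d, degOp_proj d, casOp_proj d, fun _ => proj_mem_Jdeal d⟩
  τ σ := ⟨permOp r n σ, permOp r n σ⁻¹, permOp_mul_permOp r n (mul_inv_cancel σ),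
    permOp_mul_permOp r n (inv_mul_cancel σ)⟩
  e_comm i j := Subtype.ext (LinearMap.ext fun f => by simpa using pol_lie i j j i f)
  e_diag i d := Subtype.ext (LinearMap.ext fun f => pol_proj i d f)
  p_mul d d' := by
    refine Subtype.ext (LinearMap.ext fun f => ?_)
    change proj d (proj d' f) = _
    ext s
    rw [coeff_proj, coeff_proj]
    by_cases h : d = d'
    · subst h
      rw [if_pos rfl]
      change _ = coeff s (proj d f)
      rw [coeff_proj]
      split_ifs <;> rfl
    · rw [if_neg h]
      change _ = coeff s 0
      rw [coeff_zero]
      split_ifs with h1 h2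
      · exact (h (h1.symm.trans h2)).elim
      · rfl
      · rfl
  e_p i j d _ := Subtype.ext (LinearMap.ext fun f => pol_proj_shift i j d f)
  e_p_zero i j d hij hd := Subtype.ext (LinearMap.ext fun f => pol_proj_eq_zero i hij hd f)
  casimir_comm a := by
    have h : ((∑ i, ∑ j, (⟨(pol i j).toLinearMap, degOp_pol i j, casOp_pol i j,
        fun _ => pol_mem_Jdeal i j⟩ : opAlg r n ℓ) * ⟨(pol j i).toLinearMap, degOp_pol j i,
          casOp_pol j i, fun _ => pol_mem_Jdeal j i⟩ : opAlg r n ℓ) :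
            Module.End ℚ (PolyR ℓ n)) = casOp := by
      simp only [AddSubmonoidClass.coe_finsetSum, MulMemClass.coe_mul]
      rfl
    refine Subtype.ext (LinearMap.ext fun f => ?_)
    rw [MulMemClass.coe_mul, MulMemClass.coe_mul, h]
    exact a.2.2.1 f
  τ_p σ d := Subtype.ext (LinearMap.ext fun f => permRows_proj σ d f)

end CoQuasi

namespace CoQuasi

open MvPolynomial

variable {ℓ n : ℕ}

/-- The algebra `opAlg` as a type of its own. -/
def Op (r n ℓ : ℕ) : Type := opAlg r n ℓ

instance (r n ℓ : ℕ) : Ring (Op r n ℓ) := inferInstanceAs (Ring (opAlg r n ℓ))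

instance (r n ℓ : ℕ) : Algebra ℚ (Op r n ℓ) := inferInstanceAs (Algebra ℚ (opAlg r n ℓ))

instance (r n ℓ : ℕ) : Module (Op r n ℓ) (PolyR ℓ n) :=
  inferInstanceAs (Module (opAlg r n ℓ) (PolyR ℓ n))

instance (r n ℓ : ℕ) : IsScalarTower ℚ (Op r n ℓ) (PolyR ℓ n) :=
  inferInstanceAs (IsScalarTower ℚ (opAlg r n ℓ) (PolyR ℓ n))

/-- The action of `gl_ℓ` on the polynomial ring, through the algebra `Op`. -/
def opData (r n ℓ : ℕ) : WeightData ℓ (Op r n ℓ) := polData r n ℓ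

/-- The homogeneous polynomials of degree `m`. -/
def degSpace (r n ℓ m : ℕ) : Submodule (Op r n ℓ) (PolyR ℓ n) where
  carrier := {f | degOp f = (m : ℚ) • f}
  add_mem' := fun {f g} hf hg => by
    rw [Set.mem_ofPred_eq] at *
    rw [map_add, hf, hg, smul_add]
  zero_mem' := by simp
  smul_mem' := fun a f hf => by
    rw [Set.mem_ofPred_eq] at *
    change degOp (a.1 f) = (m : ℚ) • a.1 f
    rw [a.2.1, hf, map_smul]

lemma mem_degSpace {r m : ℕ} {f : PolyR ℓ n} : f ∈ degSpace r n ℓ m ↔ degOp f = (m : ℚ) • f :=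
  Iff.rfl

/-- The homogeneous elements of degree `m` in the ideal `J`. -/
def idealSpace (r n ℓ m : ℕ) : Submodule (Op r n ℓ) (degSpace r n ℓ m) where
  carrier := {f | (f : PolyR ℓ n) ∈ Jdeal r n ℓ}
  add_mem' := fun hf hg => (Jdeal r n ℓ).add_mem hf hg
  zero_mem' := zero_mem (Jdeal r n ℓ)
  smul_mem' := fun a _ hf => a.2.2.2 _ hf

instance (r n ℓ m : ℕ) : Module.Finite ℚ (degSpace r n ℓ m) := by
  have h : ∀ f : degSpace r n ℓ m, (f : PolyR ℓ n) ∈ homogeneousSubmodule (Fin ℓ × Fin n) ℚ m := by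
    intro f s hs
    have h1 := congr_arg (coeff s) (mem_degSpace.1 f.2)
    rw [degOp_apply, coeff_sum, coeff_smul, smul_eq_mul] at h1
    simp only [coeff_pol_self, ← Finset.sum_mul, weight_rowWt] at h1
    have h2 := mul_right_cancel₀ hs h1
    rw [Finsupp.weight_apply, Finsupp.sum_fintype _ _ (by simp), Fintype.sum_prod_type]
    simpa using mod_cast h2
  have := Module.Finite.iff_fg.2 (homogeneousSubmodule_fg (R := ℚ) (σ := Fin ℓ × Fin n) m)
  let g : degSpace r n ℓ m →ₗ[ℚ] homogeneousSubmodule (Fin ℓ × Fin n) ℚ m :=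
    ((degSpace r n ℓ m).subtype.restrictScalars ℚ).codRestrict _ h
  exact Module.Finite.of_injective g fun a b hab =>
    Subtype.ext (congr_arg
      (fun x : homogeneousSubmodule (Fin ℓ × Fin n) ℚ m => (x : PolyR ℓ n)) hab)

lemma hasDegree_degSpace (r n ℓ m : ℕ) : (opData r n ℓ).HasDegree (degSpace r n ℓ m) m := by
  intro d hd f
  refine Subtype.ext ?_
  have h1 : degOp (proj d (f : PolyR ℓ n)) = (m : ℚ) • proj d (f : PolyR ℓ n) := by
    rw [degOp_proj, mem_degSpace.1 f.2, map_smul]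
  rw [degOp_apply] at h1
  simp only [pol_proj, ← Finset.sum_smul] at h1
  rw [← sub_eq_zero, ← sub_smul, smul_eq_zero] at h1
  refine h1.resolve_left fun h => hd ?_
  rw [sub_eq_zero] at h
  exact_mod_cast h

lemma proj_eq_self_iff {d : Fin ℓ → ℕ} {f : PolyR ℓ n} : proj d f = f ↔ f ∈ homogComp ℓ n d := by
  refine ⟨fun h => ?_, fun h => ?_⟩
  · rw [← h]
    exact weightedHomogeneousComponent_mem _ _ _
  · exact (weightedHomogeneousComponent_of_mem h).trans (if_pos rfl)

lemma homogComp_le_degSpace (r : ℕ) {d : Fin ℓ → ℕ} {f : PolyR ℓ n} (hf : f ∈ homogComp ℓ n d) :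
    f ∈ degSpace r n ℓ (∑ i, d i) := by
  rw [← proj_eq_self_iff] at hf
  rw [mem_degSpace, ← hf, degOp_apply]
  simp only [pol_proj, ← Finset.sum_smul, Nat.cast_sum]

lemma map_wtSpace_degSpace (r : ℕ) (d : Fin ℓ → ℕ) :
    ((opData r n ℓ).wtSpace (degSpace r n ℓ (∑ i, d i)) d).map
      ((degSpace r n ℓ (∑ i, d i)).subtype.restrictScalars ℚ) = homogComp ℓ n d := by
  ext f
  simp only [Submodule.mem_map, WeightData.mem_wtSpace]
  constructor
  · rintro ⟨f, hf, rfl⟩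
    exact proj_eq_self_iff.1 (congr_arg Subtype.val hf)
  · intro hf
    exact ⟨⟨f, homogComp_le_degSpace r hf⟩, Subtype.ext (proj_eq_self_iff.2 hf), rfl⟩

lemma map_wtSpace_inf_idealSpace (r : ℕ) (d : Fin ℓ → ℕ) :
    ((opData r n ℓ).wtSpace (degSpace r n ℓ (∑ i, d i)) d ⊓
      (idealSpace r n ℓ (∑ i, d i)).restrictScalars ℚ).map
      ((degSpace r n ℓ (∑ i, d i)).subtype.restrictScalars ℚ) =
    homogComp ℓ n d ⊓ LinearMap.ker (Ideal.Quotient.mkₐ ℚ (Jdeal r n ℓ)).toLinearMap := by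
  have hker : ∀ f : PolyR ℓ n,
      f ∈ LinearMap.ker (Ideal.Quotient.mkₐ ℚ (Jdeal r n ℓ)).toLinearMap ↔ f ∈ Jdeal r n ℓ :=
    fun f => Ideal.Quotient.eq_zero_iff_mem
  ext f
  rw [Submodule.mem_inf, hker, ← map_wtSpace_degSpace r d]
  simp only [Submodule.mem_map, Submodule.mem_inf]
  constructor
  · rintro ⟨f, ⟨hf, hf'⟩, rfl⟩
    exact ⟨⟨f, hf, rfl⟩, hf'⟩
  · rintro ⟨⟨f, hf, rfl⟩, hf'⟩
    exact ⟨f, ⟨hf, hf'⟩, rfl⟩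

lemma mult_degSpace (r : ℕ) (d : Fin ℓ → ℕ) :
    (opData r n ℓ).mult (degSpace r n ℓ (∑ i, d i)) d = Module.finrank ℚ (homogComp ℓ n d) := by
  rw [← map_wtSpace_degSpace r d, WeightData.mult]
  exact (Submodule.equivMapOfInjective _ Subtype.val_injective _).finrank_eq

instance (d : Fin ℓ → ℕ) : Module.Finite ℚ (homogComp ℓ n d) := by
  rw [← map_wtSpace_degSpace 1 d]
  infer_instance

/-- The dimension of a component of the quotient is a weight multiplicity. -/
lemma compDim_eq_mult (r : ℕ) (d : Fin ℓ → ℕ) :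
    compDim r n ℓ d = (opData r n ℓ).mult
      (degSpace r n ℓ (∑ i, d i) ⧸ idealSpace r n ℓ (∑ i, d i)) d := by
  have h1 := finrank_map_add_finrank_inf_ker
    (Ideal.Quotient.mkₐ ℚ (Jdeal r n ℓ)).toLinearMap (homogComp ℓ n d)
  have h2 := (opData r n ℓ).mult_add (idealSpace r n ℓ (∑ i, d i)) d
  rw [mult_degSpace, WeightData.mult_submodule, ← h1, ← map_wtSpace_inf_idealSpace] at h2
  rw [← (Submodule.equivMapOfInjective ((degSpace r n ℓ (∑ i, d i)).subtype.restrictScalars ℚ)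
    Subtype.val_injective _).finrank_eq] at h2
  rw [compDim]
  omega

end CoQuasi

/-! ### The Schur expansion of the polynomial ring -/

namespace CoQuasi

open MvPolynomial

lemma one_sub_X_pow_mul_multichoose (n : ℕ) :
    (1 - PowerSeries.X : PowerSeries ℚ) ^ n * PowerSeries.mk (fun k => (n.multichoose k : ℚ)) =
      1 := by
  induction n with
  | zero =>
    ext k
    cases k <;> simp [PowerSeries.coeff_one]
  | succ n ih =>
    have h : (1 - PowerSeries.X : PowerSeries ℚ) *
        PowerSeries.mk (fun k => ((n + 1).multichoose k : ℚ)) =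
        PowerSeries.mk (fun k => (n.multichoose k : ℚ)) := by
      ext k
      cases k with
      | zero => simp [sub_mul]
      | succ k =>
        rw [sub_mul, one_mul, map_sub, PowerSeries.coeff_succ_X_mul, PowerSeries.coeff_mk,
          PowerSeries.coeff_mk, PowerSeries.coeff_mk, Nat.multichoose_succ_succ]
        push_cast
        ring
    rw [pow_succ, mul_assoc, h, ih]

lemma sum_multichoose_mul (n : ℕ) : ∃ c : ℕ → ℚ, c 0 = 1 ∧ (∀ t, n < t → c t = 0) ∧
    ∀ k, k ≠ 0 → ∑ t ∈ Finset.range (k + 1), c t * (n.multichoose (k - t) : ℚ) = 0 := by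
  let P : Polynomial ℚ := (1 - Polynomial.X) ^ n
  have hP : (P : PowerSeries ℚ) = (1 - PowerSeries.X) ^ n := by simp [P]
  refine ⟨P.coeff, ?_, fun t ht => Polynomial.coeff_eq_zero_of_natDegree_lt (lt_of_le_of_lt ?_ ht),
    fun k hk => ?_⟩
  · simp [P, Polynomial.coeff_zero_eq_eval_zero]
  · refine Polynomial.natDegree_pow_le.trans ?_
    have : (1 - Polynomial.X : Polynomial ℚ).natDegree ≤ 1 := by compute_degree
    simpa using Nat.mul_le_mul_left n this
  · have h := congr_arg (PowerSeries.coeff k) (one_sub_X_pow_mul_multichoose n)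
    rw [← hP, PowerSeries.coeff_mul, Finset.Nat.sum_antidiagonal_eq_sum_range_succ_mk,
      PowerSeries.coeff_one, if_neg hk] at h
    simpa using h

/-- The Jacobi-Trudi determinant of complete symmetric functions in `n` variables vanishes on
partitions with more than `n` parts. -/
lemma det_multichoose_eq_zero {ℓ n : ℕ} (hn : n < ℓ) {l : Fin ℓ → ℕ}
    (h : ∀ a : Fin ℓ, ℓ - 1 - n ≤ a → ℓ - 1 - n < l a) :
    (Matrix.of fun j i : Fin ℓ =>
      if (j : ℕ) ≤ l i then (n.multichoose (l i - j) : ℚ) else 0).det = 0 := by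
  obtain ⟨c, hc0, hcn, hc⟩ := sum_multichoose_mul n
  obtain ⟨j₀, hj₀, hj₀'⟩ : ∃ j₀ ≤ ℓ - 1 - n, ∀ i, l i ≠ j₀ := by
    by_contra! hcon
    have hcard : (Finset.range (ℓ - 1 - n + 1)).card ≤
        ((Finset.univ.filter fun a : Fin ℓ => (a : ℕ) < ℓ - 1 - n).image l).card := by
      refine Finset.card_le_card fun j hj => ?_
      obtain ⟨i, hi⟩ := hcon j (by simpa [Nat.lt_succ_iff] using hj)
      refine Finset.mem_image.2 ⟨i, ?_, hi⟩
      rw [Finset.mem_filter]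
      refine ⟨Finset.mem_univ _, ?_⟩
      by_contra! hle
      have := h i hle
      simp only [Finset.mem_range] at hj
      omega
    have h1 := hcard.trans Finset.card_image_le
    have h2 : (Finset.univ.filter fun a : Fin ℓ => (a : ℕ) < ℓ - 1 - n).card ≤
        (Finset.range (ℓ - 1 - n)).card :=
      Finset.card_le_card_of_injOn (fun a => (a : ℕ)) (fun a ha => by simpa using ha)
        Fin.val_injective.injOn
    simp only [Finset.card_range] at h1 h2
    omega
  refine Matrix.exists_vecMul_eq_zero_iff.1
    ⟨fun j => if j₀ ≤ (j : ℕ) then c (j - j₀) else 0, fun h0 => ?_, funext fun i => ?_⟩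
  · have := congr_fun h0 ⟨j₀, by omega⟩
    simp [hc0] at this
  · simp only [Matrix.vecMul, dotProduct, Matrix.of_apply, Pi.zero_apply]
    rw [Fin.sum_univ_eq_sum_range (fun j => (if j₀ ≤ j then c (j - j₀) else 0) *
      if j ≤ l i then (n.multichoose (l i - j) : ℚ) else 0)]
    rcases lt_or_gt_of_ne (hj₀' i) with hlt | hgt
    · refine Finset.sum_eq_zero fun j _ => ?_
      split_ifs <;> first | omega | simp
    · rw [Finset.sum_congr_of_eq_on_inter (s₂ := Finset.Ico j₀ (l i + 1))
        (g := fun j => c (j - j₀) * (n.multichoose (l i - j) : ℚ)),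
        Finset.sum_Ico_eq_sum_range, ← hc (l i - j₀) (by omega)]
      · rw [show l i + 1 - j₀ = l i - j₀ + 1 by omega]
        refine Finset.sum_congr rfl fun t _ => ?_
        rw [Nat.add_sub_cancel_left, Nat.sub_add_eq]
      · intro j _ hj
        rw [Finset.mem_Ico, not_and_or] at hj
        split_ifs <;> first | omega | simp
      · intro j hj hj'
        rw [Finset.mem_range] at hj'
        rw [hcn _ (by omega), zero_mul]
      · intro j _ hj
        rw [Finset.mem_Ico] at hj
        rw [if_pos hj.1, if_pos (by omega)]

/-- The Schur coefficients of a product of one-variable series are determinants. -/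
lemma schurCoeff_eq_zero_of_det {ℓ m : ℕ} {χ : MvPolynomial (Fin ℓ) ℚ} {g : ℕ → ℚ}
    (hχ : ∀ d, coeff (ex d) χ = if ∑ i, d i = m then ∏ i, g (d i) else 0) {l : Fin ℓ → ℕ}
    (h : (Matrix.of fun j i : Fin ℓ => if (j : ℕ) ≤ l i then g (l i - j) else 0).det = 0) :
    schurCoeff χ l = 0 := by
  have hterm : ∀ σ : Equiv.Perm (Fin ℓ), coeff (ex l)
      (monomial (ex ((fun j : Fin ℓ => (j : ℕ)) ∘ σ)) (((Equiv.Perm.sign σ : ℤ)) : ℚ) * χ) =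
      if ∑ i, l i = m + ∑ i : Fin ℓ, (i : ℕ) then
        ((Equiv.Perm.sign σ : ℤ) : ℚ) *
          ∏ i, (if ((σ i : Fin ℓ) : ℕ) ≤ l i then g (l i - σ i) else 0)
      else 0 := by
    intro σ
    rw [coeff_monomial_mul']
    have hle : ex ((fun j : Fin ℓ => (j : ℕ)) ∘ σ) ≤ ex l ↔
        ∀ i, ((σ i : Fin ℓ) : ℕ) ≤ l i := Iff.rfl
    by_cases hσ : ∀ i, ((σ i : Fin ℓ) : ℕ) ≤ l i
    · rw [if_pos (hle.2 hσ)]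
      have hsub : ex l - ex ((fun j : Fin ℓ => (j : ℕ)) ∘ σ) = ex fun i => l i - (σ i : Fin ℓ) := by
        ext i
        rfl
      have hsum : ∑ i, (l i - ((σ i : Fin ℓ) : ℕ)) + ∑ i : Fin ℓ, (i : ℕ) = ∑ i, l i := by
        rw [← Equiv.sum_comp σ fun i : Fin ℓ => (i : ℕ), ← Finset.sum_add_distrib]
        exact Finset.sum_congr rfl fun i _ => Nat.sub_add_cancel (hσ i)
      rw [hsub, hχ, mul_ite, mul_zero]
      simp only [hσ, if_true]
      refine if_congr ?_ rfl rfl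
      omega
    · rw [if_neg fun h => hσ (hle.1 h)]
      push Not at hσ
      obtain ⟨i, hi⟩ := hσ
      rw [Finset.prod_eq_zero (Finset.mem_univ i) (if_neg (by omega)), mul_zero, ite_self]
  rw [schurCoeff, alt_eq_sum, Finset.sum_mul, coeff_sum]
  simp only [hterm]
  rw [Matrix.det_apply'] at h
  simp only [Matrix.of_apply] at h
  split_ifs
  · exact h
  · simp

end CoQuasi

namespace CoQuasi

open MvPolynomial

variable {ℓ n : ℕ}

lemma card_weight_rowWt (d : Fin ℓ → ℕ) :
    Nat.card {s : Fin ℓ × Fin n →₀ ℕ // Finsupp.weight (rowWt ℓ n) s = d} =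
      ∏ k, n.multichoose (d k) := by
  let e : {s : Fin ℓ × Fin n →₀ ℕ // Finsupp.weight (rowWt ℓ n) s = d} ≃
      ((k : Fin ℓ) → {t : Fin n →₀ ℕ // t ∈ Finset.univ.finsuppAntidiag (d k)}) :=
    ((((Finsupp.equivFunOnFinite.trans (Equiv.curry (Fin ℓ) (Fin n) ℕ)).trans
      (Equiv.piCongrRight fun _ => Finsupp.equivFunOnFinite.symm)).subtypeEquiv
        (q := fun t => ∀ k, t k ∈ Finset.univ.finsuppAntidiag (d k)) (fun s => by
        simp only [funext_iff, weight_rowWt, Finset.mem_finsuppAntidiag]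
        refine forall_congr' fun k => ?_
        simp [Equiv.piCongrRight])).trans Equiv.subtypePiEquivPi)
  rw [Nat.card_congr e, Nat.card_pi]
  refine Finset.prod_congr rfl fun k _ => ?_
  rw [Nat.card_eq_fintype_card, Fintype.card_coe, Finset.card_finsuppAntidiag_nat_eq_multichoose,
    Finset.card_univ, Fintype.card_fin]

lemma finrank_homogComp (d : Fin ℓ → ℕ) :
    Module.finrank ℚ (homogComp ℓ n d) = ∏ k, n.multichoose (d k) := by
  rw [homogComp, weightedHomogeneousSubmodule_eq_finsupp_supported, ← card_weight_rowWt]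
  exact Module.finrank_eq_nat_card_basis
    (basisRestrictSupport ℚ {s | Finsupp.weight (rowWt ℓ n) s = d})

/-- The character of the degree `m` component of the quotient `R/J`. -/
def compChar (r n ℓ m : ℕ) : MvPolynomial (Fin ℓ) ℚ :=
  (opData r n ℓ).char (degSpace r n ℓ m ⧸ idealSpace r n ℓ m) m

lemma hasDegree_comp (r n ℓ m : ℕ) :
    (opData r n ℓ).HasDegree (degSpace r n ℓ m ⧸ idealSpace r n ℓ m) m :=
  (opData r n ℓ).hasDegree_quotient _ (hasDegree_degSpace r n ℓ m)

lemma coeff_compChar (r n m : ℕ) (d : Fin ℓ → ℕ) :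
    coeff (ex d) (compChar r n ℓ m) = if ∑ i, d i = m then (compDim r n ℓ d : ℚ) else 0 := by
  rw [compChar, WeightData.coeff_char _ _ (hasDegree_comp r n ℓ m)]
  split_ifs with h
  · subst h
    rw [compDim_eq_mult]
  · rw [WeightData.mult_eq_zero _ _ (hasDegree_comp r n ℓ m) h, Nat.cast_zero]

lemma isSymm_compChar (r n ℓ m : ℕ) : IsSymm (compChar r n ℓ m) :=
  (opData r n ℓ).isSymm_char _ (hasDegree_comp r n ℓ m)

lemma schurCoeff_compChar_nonneg (r n m : ℕ) {l : Fin ℓ → ℕ} (hl : StrictMono l) :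
    0 ≤ schurCoeff (compChar r n ℓ m) l :=
  (opData r n ℓ).schurCoeff_char_nonneg hl _ _ (hasDegree_comp r n ℓ m) rfl

lemma schurCoeff_char_degSpace (r m : ℕ) (hn : n < ℓ) {l : Fin ℓ → ℕ}
    (h : ∀ a : Fin ℓ, ℓ - 1 - n ≤ a → ℓ - 1 - n < l a) :
    schurCoeff ((opData r n ℓ).char (degSpace r n ℓ m) m) l = 0 := by
  refine schurCoeff_eq_zero_of_det (m := m) (g := fun k => (n.multichoose k : ℚ)) (fun d => ?_)
    (det_multichoose_eq_zero hn h)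
  rw [WeightData.coeff_char _ _ (hasDegree_degSpace r n ℓ m)]
  split_ifs with h
  · subst h
    rw [mult_degSpace, finrank_homogComp, Nat.cast_prod]
  · rw [WeightData.mult_eq_zero _ _ (hasDegree_degSpace r n ℓ m) h, Nat.cast_zero]

/-- Only partitions with at most `n` parts contribute. -/
lemma colLen_le_of_schurCoeff_compChar (r m : ℕ) {μ : YoungDiagram} (hμ : μ.colLen 0 ≤ ℓ)
    (h : schurCoeff (compChar r n ℓ m) (expo ℓ μ) ≠ 0) : μ.colLen 0 ≤ n := by
  by_contra! hn
  refine h ?_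
  have h0 := schurCoeff_char_degSpace r m (hn.trans_le hμ) (l := expo ℓ μ) fun a ha => by
    have hmem : (ℓ - 1 - (a : ℕ), 0) ∈ μ := by
      rw [YoungDiagram.mem_iff_lt_colLen]
      omega
    rw [YoungDiagram.mem_iff_lt_rowLen] at hmem
    rw [expo]
    omega
  rw [(opData r n ℓ).char_add (idealSpace r n ℓ m) (hasDegree_degSpace r n ℓ m),
    schurCoeff_add] at h0
  have h1 := schurCoeff_compChar_nonneg r n m (strictMono_expo ℓ μ)
  have := Module.Finite.of_injective ((idealSpace r n ℓ m).subtype.restrictScalars ℚ)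
    Subtype.val_injective
  have h2 := (opData r n ℓ).schurCoeff_char_nonneg (strictMono_expo ℓ μ) _ (idealSpace r n ℓ m)
    ((opData r n ℓ).hasDegree_submodule _ (hasDegree_degSpace r n ℓ m)) rfl
  rw [compChar] at h1 ⊢
  linarith

/-- The components of large degree of the quotient vanish. -/
lemma compDim_eq_zero {r : ℕ} (hr : 1 ≤ r) (hn : 1 ≤ n) {d : Fin ℓ → ℕ}
    (hd : 2 * r * n - r - n < ∑ i, d i) : compDim r n ℓ d = 0 := by
  have h : (homogComp ℓ n d).map (Ideal.Quotient.mkₐ ℚ (Jdeal r n ℓ)).toLinearMap = ⊥ := by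
    rw [eq_bot_iff]
    rintro _ ⟨f, hf, rfl⟩
    refine Ideal.Quotient.eq_zero_iff_mem.2 ?_
    rw [f.as_sum]
    refine Ideal.sum_mem _ fun s hs => ?_
    have hw : Finsupp.weight (rowWt ℓ n) s = d := hf (mem_support_iff.1 hs)
    rw [← mul_one (coeff s f), ← C_mul_monomial]
    refine Ideal.mul_mem_left _ _ (monomial_mem_Jdeal r n hr hn s ?_)
    simpa only [← hw, weight_rowWt] using hd
  rw [compDim, h, finrank_bot]

lemma compChar_eq_zero {r m : ℕ} (hr : 1 ≤ r) (hn : 1 ≤ n) (hm : 2 * r * n - r - n < m) :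
    compChar r n ℓ m = 0 := by
  ext d
  obtain ⟨d, rfl⟩ := exists_ex d
  rw [coeff_compChar, coeff_zero]
  split_ifs with h
  · rw [compDim_eq_zero hr hn (by omega), Nat.cast_zero]
  · rfl

/-- The Schur functions in a homogeneous symmetric polynomial have the same degree. -/
lemma card_yd_of_schurCoeff {χ : MvPolynomial (Fin ℓ) ℚ} {m : ℕ}
    (hχ : ∀ d, coeff (ex d) χ ≠ 0 → ∑ i, d i = m) {l : Fin ℓ → ℕ} (hl : StrictMono l)
    (h : schurCoeff χ l ≠ 0) : (yd ℓ l).card = m := by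
  rw [schurCoeff, alt_eq_sum, Finset.sum_mul, coeff_sum] at h
  obtain ⟨σ, -, hσ⟩ := Finset.exists_ne_zero_of_sum_ne_zero h
  rw [coeff_monomial_mul'] at hσ
  split_ifs at hσ with hle
  · have hle' : ∀ i, ((σ i : Fin ℓ) : ℕ) ≤ l i := hle
    have hsub : ex l - ex ((fun j : Fin ℓ => (j : ℕ)) ∘ σ) = ex fun i => l i - (σ i : Fin ℓ) := by
      ext i
      rfl
    rw [hsub] at hσ
    have h1 := hχ _ (right_ne_zero_of_mul hσ)
    have h2 := card_yd hl
    have h3 : ∑ i, (l i - ((σ i : Fin ℓ) : ℕ)) + ∑ i : Fin ℓ, (i : ℕ) = ∑ i, l i := by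
      rw [← Equiv.sum_comp σ fun i : Fin ℓ => (i : ℕ), ← Finset.sum_add_distrib]
      exact Finset.sum_congr rfl fun i _ => Nat.sub_add_cancel (hle' i)
    omega
  · exact absurd rfl hσ

lemma schurCoeff_mem_range {χ : MvPolynomial (Fin ℓ) ℚ}
    (hχ : ∀ d, coeff (ex d) χ ∈ (Int.castRingHom ℚ).range) (l : Fin ℓ → ℕ) :
    schurCoeff χ l ∈ (Int.castRingHom ℚ).range := by
  rw [schurCoeff, alt_eq_sum, Finset.sum_mul, coeff_sum]
  refine sum_mem fun σ _ => ?_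
  rw [coeff_monomial_mul']
  split_ifs
  · obtain ⟨d, hd⟩ := exists_ex (ex l - ex ((fun j : Fin ℓ => (j : ℕ)) ∘ σ))
    exact mul_mem ⟨_, rfl⟩ (hd ▸ hχ d)
  · exact zero_mem _

/-- The Schur coefficients of the quotient are natural numbers. -/
lemma exists_nat_schurCoeff_compChar (r n m : ℕ) {l : Fin ℓ → ℕ} (hl : StrictMono l) :
    ∃ c : ℕ, schurCoeff (compChar r n ℓ m) l = c := by
  obtain ⟨z, hz⟩ := schurCoeff_mem_range (χ := compChar r n ℓ m) (fun d => by
    rw [coeff_compChar]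
    split_ifs
    · exact ⟨compDim r n ℓ d, by simp⟩
    · exact zero_mem _) l
  have h0 := schurCoeff_compChar_nonneg r n m hl
  rw [← hz] at h0 ⊢
  lift z to ℕ using (by simpa using h0)
  exact ⟨z, by simp⟩

end CoQuasi

/-! ### Adding rows of variables -/

namespace CoQuasi

open MvPolynomial

variable {ℓ ℓ' n : ℕ}

/-- Extension of a vector by zero. -/
def pad (ℓ' : ℕ) (d : Fin ℓ → ℕ) (i : Fin ℓ') : ℕ := if h : (i : ℕ) < ℓ then d ⟨i, h⟩ else 0

lemma pad_castLE (h : ℓ ≤ ℓ') (d : Fin ℓ → ℕ) (i : Fin ℓ) : pad ℓ' d (Fin.castLE h i) = d i := by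
  simp [pad]

lemma prod_pad {M : Type*} [CommMonoid M] (h : ℓ ≤ ℓ') {f : Fin ℓ → M} {g : Fin ℓ' → M}
    (h1 : ∀ i : Fin ℓ, f i = g (Fin.castLE h i)) (h2 : ∀ i : Fin ℓ', ℓ ≤ i → g i = 1) :
    ∏ i, f i = ∏ i, g i := by
  refine Fintype.prod_of_injective (Fin.castLE h) (Fin.castLE_injective h) _ _ (fun i hi => ?_) h1
  refine h2 i ?_
  by_contra! hlt
  exact hi ⟨⟨i, hlt⟩, rfl⟩

lemma sum_pad (h : ℓ ≤ ℓ') (d : Fin ℓ → ℕ) : ∑ i, pad ℓ' d i = ∑ i, d i :=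
  (Fintype.sum_of_injective (Fin.castLE h) (Fin.castLE_injective h) d (pad ℓ' d) (fun i hi => by
    rw [pad, dif_neg fun hlt => hi ⟨⟨i, hlt⟩, rfl⟩]) fun i => (pad_castLE h d i).symm).symm

/-- The inclusion of the variables of the first `ℓ` rows. -/
def rowIncl (h : ℓ ≤ ℓ') (n : ℕ) : Fin ℓ × Fin n → Fin ℓ' × Fin n := Prod.map (Fin.castLE h) id

lemma rowIncl_injective (h : ℓ ≤ ℓ') (n : ℕ) : Function.Injective (rowIncl h n) :=
  (Fin.castLE_injective h).prodMap Function.injective_id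

lemma weight_mapDomain_rowIncl (h : ℓ ≤ ℓ') (s : Fin ℓ × Fin n →₀ ℕ) :
    Finsupp.weight (rowWt ℓ' n) (s.mapDomain (rowIncl h n)) =
      pad ℓ' (Finsupp.weight (rowWt ℓ n) s) := by
  funext i
  rw [weight_rowWt, pad]
  split_ifs with hi
  · rw [weight_rowWt]
    exact Finset.sum_congr rfl fun b _ =>
      Finsupp.mapDomain_apply (rowIncl_injective h n) s (⟨i, hi⟩, b)
  · refine Finset.sum_eq_zero fun b _ => Finsupp.mapDomain_of_notMem_range _ _ ?_
    rintro ⟨⟨a, b'⟩, hab⟩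
    refine hi ?_
    rw [← congr_arg (fun p : Fin ℓ' × Fin n => (p.1 : ℕ)) hab]
    exact a.2

lemma map_homogComp (h : ℓ ≤ ℓ') (d : Fin ℓ → ℕ) :
    (homogComp ℓ n d).map (rename (R := ℚ) (rowIncl h n)).toLinearMap =
      homogComp ℓ' n (pad ℓ' d) := by
  refine le_antisymm ?_ fun f hf => ?_
  · rintro _ ⟨f, hf, rfl⟩ s hs
    obtain ⟨t, rfl, ht⟩ := coeff_rename_ne_zero (rowIncl h n) f s hs
    exact (weight_mapDomain_rowIncl h t).trans (congr_arg (pad ℓ') (hf ht))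
  · rw [f.as_sum]
    refine Submodule.sum_mem _ fun s hs => ?_
    have hw : Finsupp.weight (rowWt ℓ' n) s = pad ℓ' d := hf (mem_support_iff.1 hs)
    obtain ⟨t, rfl⟩ : ∃ t, Finsupp.mapDomain (rowIncl h n) t = s := by
      refine ⟨s.comapDomain _ (rowIncl_injective h n).injOn,
        Finsupp.mapDomain_comapDomain _ (rowIncl_injective h n) _ fun p hp => ?_⟩
      by_cases hlt : (p.1 : ℕ) < ℓ
      · exact ⟨(⟨p.1, hlt⟩, p.2), rfl⟩
      · have := congr_fun hw p.1
        rw [weight_rowWt, pad, dif_neg hlt, Finset.sum_eq_zero_iff] at this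
        exact absurd (this p.2 (Finset.mem_univ _)) (Finsupp.mem_support_iff.1 hp)
    refine ⟨monomial t (coeff (t.mapDomain (rowIncl h n)) f), ?_, rename_monomial _ _ _⟩
    refine isWeightedHomogeneous_monomial _ _ _ (funext fun i => ?_)
    rw [weight_mapDomain_rowIncl] at hw
    have := congr_fun hw (Fin.castLE h i)
    rwa [pad_castLE, pad_castLE] at this

/-- Setting the variables outside of the first `ℓ` rows to zero. -/
def rowRestr (ℓ ℓ' n : ℕ) : PolyR ℓ' n →ₐ[ℚ] PolyR ℓ n :=
  aeval fun p => if h : (p.1 : ℕ) < ℓ then X (⟨p.1, h⟩, p.2) else 0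

lemma rowRestr_rename (h : ℓ ≤ ℓ') (f : PolyR ℓ n) :
    rowRestr ℓ ℓ' n (rename (rowIncl h n) f) = f := by
  have : (fun p : Fin ℓ' × Fin n =>
      if h : (p.1 : ℕ) < ℓ then (X (⟨p.1, h⟩, p.2) : PolyR ℓ n) else 0) ∘ rowIncl h n = X := by
    funext p
    simp [rowIncl]
  rw [rowRestr, aeval_rename, this, aeval_X_left_apply]

lemma rename_colPow (h : ℓ ≤ ℓ') (V : Fin ℓ → ℕ) (b : Fin n) :
    rename (rowIncl h n) (colPow V b) = colPow (pad ℓ' V) b := by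
  rw [colPow, map_prod, colPow]
  refine prod_pad h (fun i => ?_) fun i hi => ?_
  · rw [map_pow, rename_X, pad_castLE]
    rfl
  · rw [pad, dif_neg (by omega), pow_zero]

lemma rowRestr_colPow (h : ℓ ≤ ℓ') (V : Fin ℓ' → ℕ) (b : Fin n) :
    rowRestr ℓ ℓ' n (colPow V b) =
      if ∀ i : Fin ℓ', ℓ ≤ i → V i = 0 then colPow (V ∘ Fin.castLE h) b else 0 := by
  have hX : ∀ i, rowRestr ℓ ℓ' n (X (i, b)) =
      if h : (i : ℕ) < ℓ then X (⟨i, h⟩, b) else 0 := fun i => aeval_X _ _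
  rw [colPow, map_prod]
  simp only [map_pow, hX]
  split_ifs with hV
  · rw [colPow]
    refine (prod_pad h (fun i => ?_) fun i hi => ?_).symm
    · simp
    · rw [hV i hi, pow_zero]
  · push Not at hV
    obtain ⟨i, hi, hVi⟩ := hV
    refine Finset.prod_eq_zero (Finset.mem_univ i) ?_
    rw [dif_neg (by omega), zero_pow hVi]

lemma rename_mem_Jdeal (h : ℓ ≤ ℓ') {r : ℕ} {f : PolyR ℓ n} (hf : f ∈ Jdeal r n ℓ) :
    rename (rowIncl h n) f ∈ Jdeal r n ℓ' := by
  suffices Jdeal r n ℓ ≤ (Jdeal r n ℓ').comap (rename (R := ℚ) (rowIncl h n)) from this hf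
  rw [Jdeal_eq_span, Ideal.span_le]
  rintro _ ⟨k, B, hk, hkn, hB, rfl⟩
  have : rename (rowIncl h n) (quasiMon n B) = quasiMon n fun c => pad ℓ' (B c) := by
    simp only [quasiMon, map_sum, map_prod, rename_colPow]
  rw [SetLike.mem_coe, Ideal.mem_comap, this]
  exact quasiMon_mem hk hkn fun c => by simpa only [sum_pad h] using hB c

lemma rowRestr_mem_Jdeal (h : ℓ ≤ ℓ') {r : ℕ} {f : PolyR ℓ' n} (hf : f ∈ Jdeal r n ℓ') :
    rowRestr ℓ ℓ' n f ∈ Jdeal r n ℓ := by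
  suffices Jdeal r n ℓ' ≤ (Jdeal r n ℓ).comap (rowRestr ℓ ℓ' n) from this hf
  rw [Jdeal_eq_span, Ideal.span_le]
  rintro _ ⟨k, B, hk, hkn, hB, rfl⟩
  rw [SetLike.mem_coe, Ideal.mem_comap]
  simp only [quasiMon, map_sum, map_prod, rowRestr_colPow h]
  by_cases hBz : ∀ c, ∀ i : Fin ℓ', ℓ ≤ i → B c i = 0
  · rw [Finset.sum_congr rfl fun s _ => Finset.prod_congr rfl fun c _ => if_pos (hBz c)]
    refine quasiMon_mem (B := fun c => B c ∘ Fin.castLE h) hk hkn fun c => ?_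
    rw [show ∑ i, (B c ∘ Fin.castLE h) i = ∑ i, B c i from
      Fintype.sum_of_injective (Fin.castLE h) (Fin.castLE_injective h) _ _ (fun i hi =>
        hBz c i (by by_contra! hlt; exact hi ⟨⟨i, hlt⟩, rfl⟩)) fun i => rfl]
    exact hB c
  · push Not at hBz
    obtain ⟨c, i, hi, hBc⟩ := hBz
    refine Ideal.sum_mem _ fun s _ => ?_
    rw [Finset.prod_eq_zero (Finset.mem_univ c) (if_neg fun hz => hBc (hz i hi))]
    exact zero_mem _

/-- Adding rows of variables does not change the dimensions of the components. -/
lemma compDim_pad (r : ℕ) (h : ℓ ≤ ℓ') (d : Fin ℓ → ℕ) :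
    compDim r n ℓ' (pad ℓ' d) = compDim r n ℓ d := by
  have hle : Jdeal r n ℓ ≤ (Jdeal r n ℓ').comap (rename (R := ℚ) (rowIncl h n)) :=
    fun f hf => rename_mem_Jdeal h hf
  have hinj : Function.Injective (Ideal.quotientMapₐ (Jdeal r n ℓ') (rename (rowIncl h n)) hle) :=
    Ideal.quotientMap_injective' (H := hle) fun f hf => by
      rw [← rowRestr_rename h f]
      exact rowRestr_mem_Jdeal h hf
  have hmap : (homogComp ℓ' n (pad ℓ' d)).map (Ideal.Quotient.mkₐ ℚ (Jdeal r n ℓ')).toLinearMap =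
      ((homogComp ℓ n d).map (Ideal.Quotient.mkₐ ℚ (Jdeal r n ℓ)).toLinearMap).map
        (Ideal.quotientMapₐ (Jdeal r n ℓ') (rename (rowIncl h n)) hle).toLinearMap := by
    rw [← map_homogComp h, ← Submodule.map_comp, ← Submodule.map_comp]
    rfl
  rw [compDim, hmap]
  exact (Submodule.equivMapOfInjective _ hinj _).finrank_eq.symm

lemma ssytCount_pad (h : ℓ ≤ ℓ') (μ : YoungDiagram) (d : Fin ℓ → ℕ) :
    ssytCount μ ℓ' (pad ℓ' d) = ssytCount μ ℓ d := by
  refine Nat.card_congr (Equiv.subtypeEquivRight fun T => ?_)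
  constructor
  · rintro ⟨h1, h2⟩
    refine ⟨fun c hc => ?_, fun v => ?_⟩
    · by_contra! hlt
      have h3 := h2 ⟨T c.1 c.2, h1 c hc⟩
      rw [pad, dif_neg (not_lt.2 hlt), Finset.card_eq_zero] at h3
      exact Finset.notMem_empty c (h3 ▸ Finset.mem_filter.2 ⟨hc, rfl⟩)
    · rw [← pad_castLE h d v, ← h2]
      rfl
  · rintro ⟨h1, h2⟩
    refine ⟨fun c hc => (h1 c hc).trans_le h, fun v => ?_⟩
    rw [pad]
    split_ifs with hv
    · exact h2 ⟨v, hv⟩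
    · rw [Finset.card_eq_zero, Finset.filter_eq_empty_iff]
      intro c hc hcv
      exact hv (hcv ▸ h1 c hc)

lemma ssytCount_eq_zero_of_lt {μ : YoungDiagram} (h : ℓ < μ.colLen 0) (d : Fin ℓ → ℕ) :
    ssytCount μ ℓ d = 0 := by
  have : IsEmpty {T : SemistandardYoungTableau μ // (∀ c ∈ μ.cells, T c.1 c.2 < ℓ) ∧
      ∀ v : Fin ℓ, (μ.cells.filter (fun c => T c.1 c.2 = (v : ℕ))).card = d v} := by
    refine ⟨fun T => ?_⟩
    have hmem : (ℓ, 0) ∈ μ := YoungDiagram.mem_iff_lt_colLen.2 h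
    exact absurd (T.2.1 _ hmem) (not_lt.2 (SSYT_le_entry T.1 hmem))
  exact Nat.card_of_isEmpty

lemma sum_eq_card_of_ssytCount {μ : YoungDiagram} {d : Fin ℓ → ℕ} (h : ssytCount μ ℓ d ≠ 0) :
    ∑ i, d i = μ.card := by
  obtain ⟨T, hT, hc⟩ : Nonempty _ := (Nat.card_ne_zero.1 h).1
  have h1 := sum_content_eq T hc (e := fun v => if hv : v < ℓ then d ⟨v, hv⟩ else 0)
    (fun v => by simp) ℓ le_rfl
  rw [Finset.filter_true_of_mem hT, ← Fin.sum_univ_eq_sum_range] at h1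
  simpa using h1

end CoQuasi

/-! ### The coefficients of the Schur expansion -/

namespace CoQuasi

open MvPolynomial

variable {ℓ ℓ' n : ℕ}

/-- Schur coefficients are determined by an expansion in terms of tableaux. -/
lemma schurCoeff_eq_of_coeff {χ : MvPolynomial (Fin ℓ) ℚ} {T : Finset YoungDiagram}
    {q : YoungDiagram → ℚ} (hχ : ∀ d, coeff (ex d) χ = ∑ μ ∈ T, q μ * ssytCount μ ℓ d)
    {μ : YoungDiagram} (hμ : μ.colLen 0 ≤ ℓ) :
    schurCoeff χ (expo ℓ μ) = if μ ∈ T then q μ else 0 := by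
  let S := {ν ∈ T | ν.colLen 0 ≤ ℓ}
  have hyd : ∀ ν ∈ S, yd ℓ (expo ℓ ν) = ν := fun ν hν => yd_expo ℓ ν (Finset.mem_filter.1 hν).2
  have h : χ = ∑ l ∈ S.image (expo ℓ), C (q (yd ℓ l)) * schur (xv ℓ) (yd ℓ l) ℓ := by
    ext d
    obtain ⟨d, rfl⟩ := exists_ex d
    rw [hχ, coeff_sum, Finset.sum_image fun ν hν ν' hν' h => by
      rw [← hyd ν hν, h, hyd ν' hν'], Finset.sum_filter]
    refine Finset.sum_congr rfl fun ν hν => ?_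
    split_ifs with hν'
    · rw [coeff_C_mul, coeff_schur, yd_expo ℓ ν hν']
    · rw [ssytCount_eq_zero_of_lt (not_le.1 hν'), Nat.cast_zero, mul_zero]
  rw [h, schurCoeff_sum _ (fun l hl => ?_) _ (strictMono_expo ℓ μ), yd_expo ℓ μ hμ]
  · refine if_congr ⟨fun hl => ?_, fun hl => ?_⟩ rfl rfl
    · obtain ⟨ν, hν, hνμ⟩ := Finset.mem_image.1 hl
      rw [← yd_expo ℓ μ hμ, ← hνμ, hyd ν hν]
      exact (Finset.mem_filter.1 hν).1
    · exact Finset.mem_image_of_mem _ (Finset.mem_filter.2 ⟨hl, hμ⟩)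
  · obtain ⟨ν, -, rfl⟩ := Finset.mem_image.1 hl
    exact strictMono_expo ℓ ν

/-- The shapes in the Schur expansion of a component of `R/J`. -/
def compShapes (r n ℓ m : ℕ) : Finset YoungDiagram :=
  (schurSupport (compChar r n ℓ m)).image (yd ℓ)

lemma mem_compShapes {r m : ℕ} {μ : YoungDiagram} : μ ∈ compShapes r n ℓ m ↔
    μ.colLen 0 ≤ ℓ ∧ schurCoeff (compChar r n ℓ m) (expo ℓ μ) ≠ 0 := by
  rw [compShapes, Finset.mem_image]
  constructor
  · rintro ⟨l, hl, rfl⟩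
    rw [mem_schurSupport] at hl
    exact ⟨colLen_yd_le l, by rw [expo_yd hl.1]; exact hl.2⟩
  · rintro ⟨h1, h2⟩
    exact ⟨expo ℓ μ, mem_schurSupport.2 ⟨strictMono_expo ℓ μ, h2⟩, yd_expo ℓ μ h1⟩

lemma coeff_compChar_eq_sum (r n m : ℕ) (d : Fin ℓ → ℕ) : coeff (ex d) (compChar r n ℓ m) =
    ∑ μ ∈ compShapes r n ℓ m,
      schurCoeff (compChar r n ℓ m) (expo ℓ μ) * ssytCount μ ℓ d := by
  have h : ∀ l ∈ schurSupport (compChar r n ℓ m), expo ℓ (yd ℓ l) = l :=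
    fun l hl => expo_yd (mem_schurSupport.1 hl).1
  rw [coeff_eq_sum_schurCoeff (isSymm_compChar r n ℓ m), compShapes,
    Finset.sum_image fun l hl l' hl' hll' => by rw [← h l hl, hll', h l' hl']]
  exact Finset.sum_congr rfl fun l hl => by rw [h l hl]

lemma card_of_mem_compShapes {r m : ℕ} {μ : YoungDiagram} (h : μ ∈ compShapes r n ℓ m) :
    μ.card = m := by
  rw [mem_compShapes] at h
  rw [← yd_expo ℓ μ h.1]
  refine card_yd_of_schurCoeff (fun d hd => ?_) (strictMono_expo ℓ μ) h.2
  rw [coeff_compChar] at hd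
  by_contra hne
  exact hd (if_neg hne)

/-- The Schur coefficients do not depend on the number of rows. -/
lemma schurCoeff_compChar_eq (r n m : ℕ) {μ : YoungDiagram} (h : μ.colLen 0 ≤ ℓ)
    (h' : μ.colLen 0 ≤ ℓ') : schurCoeff (compChar r n ℓ m) (expo ℓ μ) =
      schurCoeff (compChar r n ℓ' m) (expo ℓ' μ) := by
  wlog hle : ℓ ≤ ℓ' generalizing ℓ ℓ'
  · exact (this h' h (le_of_not_ge hle)).symm
  rw [schurCoeff_eq_of_coeff (T := compShapes r n ℓ' m)
    (q := fun ν => schurCoeff (compChar r n ℓ' m) (expo ℓ' ν)) (fun d => ?_) h]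
  · split_ifs with hμ
    · rfl
    · rw [mem_compShapes, not_and, not_not] at hμ
      exact (hμ h').symm
  · simp only [← ssytCount_pad hle]
    rw [← coeff_compChar_eq_sum, coeff_compChar, coeff_compChar, sum_pad hle, compDim_pad r hle]

/-- The coefficient of the Schur function of `μ` in the Hilbert series of `R/J`. -/
def coQuasiCoeff (r n : ℕ) (μ : YoungDiagram) : ℕ :=
  if μ.colLen 0 ≤ n then
    (exists_nat_schurCoeff_compChar r n μ.card (strictMono_expo n μ)).choose
  else 0

lemma cast_coQuasiCoeff (r : ℕ) {μ : YoungDiagram} (h : μ.colLen 0 ≤ ℓ) :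
    (coQuasiCoeff r n μ : ℚ) = schurCoeff (compChar r n ℓ μ.card) (expo ℓ μ) := by
  rw [coQuasiCoeff]
  split_ifs with hn
  · rw [← (exists_nat_schurCoeff_compChar r n μ.card (strictMono_expo n μ)).choose_spec,
      schurCoeff_compChar_eq r n _ hn h]
  · by_contra hne
    exact hn (colLen_le_of_schurCoeff_compChar r _ h (by simpa [eq_comm] using hne))

lemma coQuasiCoeff_ne_zero {r : ℕ} (hr : 1 ≤ r) (hn : 1 ≤ n) {μ : YoungDiagram}
    (h : coQuasiCoeff r n μ ≠ 0) : μ.colLen 0 ≤ n ∧ μ.card ≤ 2 * r * n - r - n := by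
  have hμ : μ.colLen 0 ≤ n := by
    by_contra hμ
    exact h (if_neg hμ)
  refine ⟨hμ, ?_⟩
  by_contra! hm
  have h0 := cast_coQuasiCoeff (n := n) r hμ
  rw [compChar_eq_zero hr hn hm, schurCoeff, mul_zero, coeff_zero] at h0
  exact h (by exact_mod_cast h0)

lemma compDim_eq_finsum (r n : ℕ) (d : Fin ℓ → ℕ) :
    compDim r n ℓ d = ∑ᶠ μ : YoungDiagram, coQuasiCoeff r n μ * ssytCount μ ℓ d := by
  rw [finsum_eq_sum_of_support_subset (s := compShapes r n ℓ (∑ i, d i))]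
  · have h := coeff_compChar r n (∑ i, d i) d
    rw [if_pos rfl, coeff_compChar_eq_sum] at h
    rw [← Nat.cast_inj (R := ℚ), ← h, Nat.cast_sum]
    refine Finset.sum_congr rfl fun μ hμ => ?_
    rw [Nat.cast_mul, cast_coQuasiCoeff r (mem_compShapes.1 hμ).1, card_of_mem_compShapes hμ]
  · intro μ hμ
    have hc : coQuasiCoeff r n μ ≠ 0 := left_ne_zero_of_mul hμ
    have hs : ssytCount μ ℓ d ≠ 0 := right_ne_zero_of_mul hμ
    have hlen : μ.colLen 0 ≤ ℓ := by
      by_contra! hlt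
      exact hs (ssytCount_eq_zero_of_lt hlt d)
    rw [Finset.mem_coe, mem_compShapes, sum_eq_card_of_ssytCount hs, ← cast_coQuasiCoeff r hlen]
    exact ⟨hlen, mod_cast hc⟩

end CoQuasi

/-- There is a function `c` on partitions, vanishing unless the partition has
at most `n` parts and size at most `2rn - r - n`, such that for every `ℓ ≥ 1` and every
`d ∈ ℕ^ℓ` the dimension of the multidegree-`d` component of `R/J` is `Σ_μ c μ * K_{μ,d}`. -/
theorem statement0 (r n : ℕ) (hr : 1 ≤ r) (hn : 1 ≤ n) :
    ∃ c : YoungDiagram → ℕ,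
      (∀ μ : YoungDiagram, c μ ≠ 0 → μ.rowLens.length ≤ n ∧ μ.card ≤ 2 * r * n - r - n) ∧
      ∀ ℓ : ℕ, 1 ≤ ℓ → ∀ d : Fin ℓ → ℕ,
        compDim r n ℓ d = ∑ᶠ μ : YoungDiagram, c μ * ssytCount μ ℓ d := by
  refine ⟨CoQuasi.coQuasiCoeff r n, fun μ hμ => ?_, fun ℓ _ d => CoQuasi.compDim_eq_finsum r n d⟩
  rw [YoungDiagram.length_rowLens]
  exact CoQuasi.coQuasiCoeff_ne_zero hr hn hμ

end
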